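/- Fix an integer k ≥ 4. Let (m_j) and (n_j) be sequences of positive integers tending to infinity with m_j/n_j → c. If c ∈ (2/k, 1), then there is a constant K such that for all sufficiently large j the probability that a uniformly random constrained k-XORSAT instance with m_j equations and n_j variables is satisfiable is at least 1 − K · m_j^{−(k−2)}. If c > 1, then the satisfiability probability is at most 2^{n_j − m_j}, hence O(2^{−(m_j − n_j)}) and in particular tends to 0. -/

import Mathlib

open scoped Classical

/-- The set of `m × n` matrices over `F₂` in which every row has exactly `k`
entries equal to `1` and every column has at least `2` entries equal to `1`. -/
noncomputable def constrainedSet (k m n : ℕ) : Finset (Matrix (Fin m) (Fin n) (ZMod 2)) :=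
  Finset.univ.filter (fun A =>
    (∀ i : Fin m, (Finset.univ.filter (fun j : Fin n => A i j = 1)).card = k) ∧
    (∀ j : Fin n, 2 ≤ (Finset.univ.filter (fun i : Fin m => A i j = 1)).card))

/-- The probability that a uniformly random constrained `k`-XORSAT instance with
`m` equations and `n` variables is satisfiable: the fraction of pairs `(A, b)`
with `A` in the constrained set and `b ∈ F₂^m` such that `A x = b` has a solution. -/
noncomputable def satProb (k m n : ℕ) : ℝ :=
  (((constrainedSet k m n ×ˢ (Finset.univ : Finset (Fin m → ZMod 2))).filter
      (fun p => ∃ x : Fin n → ZMod 2, p.1.mulVec x = p.2)).card : ℝ) /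
    (((constrainedSet k m n).card : ℝ) * 2 ^ m)

/-- Row systems: families of `k`-subsets of the columns such that each column outside `V`
is covered at least twice. -/
noncomputable def rowSys (ι : Type) [Fintype ι] (k n : ℕ) (V : Finset (Fin n)) :
    Finset (ι → Finset (Fin n)) :=
  Finset.univ.filter (fun r => (∀ i, (r i).card = k) ∧
    ∀ v, v ∉ V → 2 ≤ (Finset.univ.filter (fun i => v ∈ r i)).card)

/-- Row systems for which the rows in `R` sum to zero mod two. -/
noncomputable def critSys (k m n : ℕ) (R : Finset (Fin m)) : Finset (Fin m → Finset (Fin n)) :=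
  (rowSys (Fin m) k n ∅).filter (fun r => ∀ v, Even ((R.filter (fun i => v ∈ r i)).card))


lemma satProb_le (k m n : ℕ) : satProb k m n ≤ (2 : ℝ) ^ ((n : ℤ) - (m : ℤ)) := by
  unfold satProb
  set T := constrainedSet k m n
  have h1 : (((T ×ˢ (Finset.univ : Finset (Fin m → ZMod 2))).filter
      (fun p => ∃ x : Fin n → ZMod 2, p.1.mulVec x = p.2)).card) ≤ T.card * 2 ^ n := by
    have : ((T ×ˢ (Finset.univ : Finset (Fin m → ZMod 2))).filter
      (fun p => ∃ x : Fin n → ZMod 2, p.1.mulVec x = p.2)) ⊆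
      (T ×ˢ (Finset.univ : Finset (Fin n → ZMod 2))).image (fun q => (q.1, q.1.mulVec q.2)) := by
      intro p hp
      simp only [Finset.mem_filter, Finset.mem_product, Finset.mem_univ, and_true] at hp
      obtain ⟨hA, x, hx⟩ := hp
      simp only [Finset.mem_image, Finset.mem_product, Finset.mem_univ, and_true]
      exact ⟨(p.1, x), hA, by simp [hx]⟩
    refine (Finset.card_le_card this).trans (Finset.card_image_le.trans ?_)
    rw [Finset.card_product]
    simp [ZMod.card]
  rw [zpow_sub₀ (by norm_num), zpow_natCast, zpow_natCast]
  rcases Nat.eq_zero_or_pos T.card with h0 | h0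
  · rw [h0]; simp; positivity
  · have h0' : (0 : ℝ) < T.card := by exact_mod_cast h0
    rw [div_le_div_iff₀ (by positivity) (by positivity)]
    have h2 : ((((T ×ˢ (Finset.univ : Finset (Fin m → ZMod 2))).filter
      (fun p => ∃ x : Fin n → ZMod 2, p.1.mulVec x = p.2)).card : ℕ) : ℝ) ≤ T.card * 2 ^ n := by
      exact_mod_cast h1
    calc _ ≤ (T.card * 2 ^ n : ℝ) * 2 ^ m := by gcongr
      _ = _ := by ring

lemma supercritical (k : ℕ) (m n : ℕ → ℕ)
    (hn : ∀ j, 0 < n j)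
    (hntop : Filter.Tendsto n Filter.atTop Filter.atTop)
    (c : ℝ)
    (hc : Filter.Tendsto (fun j => (m j : ℝ) / (n j : ℝ)) Filter.atTop (nhds c)) (h1 : 1 < c) :
    Filter.Tendsto (fun j => satProb k (m j) (n j)) Filter.atTop (nhds 0) := by
  have hup : ∀ᶠ j in Filter.atTop, satProb k (m j) (n j) ≤
      ((2 : ℝ) ^ (-((c - 1) / 2))) ^ (n j) := by
    have : ∀ᶠ j in Filter.atTop, (1 + c) / 2 < (m j : ℝ) / (n j : ℝ) :=
      hc.eventually (lt_mem_nhds (by linarith))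
    filter_upwards [this] with j hj
    refine (satProb_le k (m j) (n j)).trans ?_
    have hnj : (0 : ℝ) < n j := by exact_mod_cast hn j
    rw [lt_div_iff₀ hnj] at hj
    rw [← Real.rpow_intCast, ← Real.rpow_natCast, ← Real.rpow_mul (by norm_num)]
    apply Real.rpow_le_rpow_of_exponent_le (by norm_num)
    push_cast
    nlinarith
  have hlim : Filter.Tendsto (fun j => ((2 : ℝ) ^ (-((c - 1) / 2))) ^ (n j))
      Filter.atTop (nhds 0) := by
    refine (tendsto_pow_atTop_nhds_zero_of_lt_one (by positivity) ?_).comp hntop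
    exact Real.rpow_lt_one_of_one_lt_of_neg (by norm_num) (by linarith)
  refine tendsto_of_tendsto_of_tendsto_of_le_of_le' tendsto_const_nhds hlim ?_ hup
  exact Filter.Eventually.of_forall (fun j => by unfold satProb; positivity)

/-- support map -/
noncomputable def suppRow {m n : ℕ} (A : Matrix (Fin m) (Fin n) (ZMod 2)) :
    Fin m → Finset (Fin n) := fun i => Finset.univ.filter (fun j => A i j = 1)

lemma zmod2_cases (a : ZMod 2) : a = 0 ∨ a = 1 := by
  revert a; decide

lemma suppRow_injective {m n : ℕ} : Function.Injective (@suppRow m n) := by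
  intro A B h
  ext i j
  have := congrFun h i
  have h2 : (j ∈ suppRow A i) ↔ (j ∈ suppRow B i) := by rw [this]
  simp only [suppRow, Finset.mem_filter, Finset.mem_univ, true_and] at h2
  rcases zmod2_cases (A i j) with h3 | h3 <;> rcases zmod2_cases (B i j) with h4 | h4 <;>
    simp_all

lemma suppRow_image (k m n : ℕ) :
    (constrainedSet k m n).image suppRow = rowSys (Fin m) k n ∅ := by
  ext r
  simp only [Finset.mem_image, constrainedSet, rowSys, Finset.mem_filter, Finset.mem_univ, true_and]
  constructor
  · rintro ⟨A, ⟨h1, h2⟩, rfl⟩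
    refine ⟨h1, fun v _ => ?_⟩
    simpa [suppRow] using h2 v
  · rintro ⟨h1, h2⟩
    refine ⟨fun i j => if j ∈ r i then 1 else 0, ⟨fun i => ?_, fun j => ?_⟩, ?_⟩
    · simpa using h1 i
    · simpa using h2 j (by simp)
    · funext i; ext j; simp [suppRow]

lemma card_constrained (k m n : ℕ) :
    (constrainedSet k m n).card = (rowSys (Fin m) k n ∅).card := by
  rw [← suppRow_image, Finset.card_image_of_injective _ suppRow_injective]

lemma surj_of_no_crit {m n : ℕ} (A : Matrix (Fin m) (Fin n) (ZMod 2))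
    (h : ∀ R : Finset (Fin m), (∀ v, ∑ i ∈ R, A i v = 0) → R = ∅) (b : Fin m → ZMod 2) :
    ∃ x, A.mulVec x = b := by
  have hli : LinearIndependent (ZMod 2) A.row := by
    rw [Fintype.linearIndependent_iff]
    intro g hg i
    have := h (Finset.univ.filter (fun i => g i = 1)) (fun v => by
      have h1 := congrFun hg v
      simp only [Finset.sum_apply, Pi.smul_apply, Matrix.row, smul_eq_mul, Pi.zero_apply] at h1
      rw [Finset.sum_filter]
      refine Eq.trans ?_ h1
      refine Finset.sum_congr rfl (fun i _ => ?_)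
      rcases zmod2_cases (g i) with h3 | h3 <;> simp [h3])
    rcases zmod2_cases (g i) with h3 | h3
    · exact h3
    · exfalso
      have : i ∈ (∅ : Finset (Fin m)) := by rw [← this]; simp [h3]
      simp at this
  have hr : A.rank = m := by
    have := hli.rank_matrix
    simpa using this
  have htop : LinearMap.range A.mulVecLin = ⊤ := by
    apply Submodule.eq_top_of_finrank_eq
    have : Module.finrank (ZMod 2) (LinearMap.range A.mulVecLin) = m := hr
    rw [this]; simp
  have := LinearMap.range_eq_top.1 htop b
  obtain ⟨x, hx⟩ := this
  exact ⟨x, by simpa using hx⟩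

lemma sum_zero_even {m n : ℕ} (A : Matrix (Fin m) (Fin n) (ZMod 2)) (R : Finset (Fin m)) (v : Fin n)
    (h : ∑ i ∈ R, A i v = 0) : Even ((R.filter (fun i => v ∈ suppRow A i)).card) := by
  have h1 : ∑ i ∈ R, A i v = ((R.filter (fun i => v ∈ suppRow A i)).card : ZMod 2) := by
    rw [Finset.card_filter]
    push_cast
    refine Finset.sum_congr rfl (fun i _ => ?_)
    rcases zmod2_cases (A i v) with h3 | h3 <;> simp [suppRow, h3]
  rw [h1, ZMod.natCast_eq_zero_iff] at h
  exact even_iff_two_dvd.2 h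

lemma satProb_ge (k m n : ℕ) (hpos : 0 < (rowSys (Fin m) k n ∅).card) :
    1 - (∑ R ∈ (Finset.univ : Finset (Finset (Fin m))).erase ∅, ((critSys k m n R).card : ℝ)) /
      ((rowSys (Fin m) k n ∅).card : ℝ) ≤ satProb k m n := by
  set T := constrainedSet k m n with hT
  have hTc := card_constrained k m n
  rw [← hTc] at hpos ⊢
  rw [← hT] at hpos ⊢
  set bad := T.filter (fun A => ∃ R : Finset (Fin m), R ≠ ∅ ∧ ∀ v, ∑ i ∈ R, A i v = 0) with hbad
  have hb : bad.card ≤ ∑ R ∈ (Finset.univ : Finset (Finset (Fin m))).erase ∅,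
      (critSys k m n R).card := by
    rw [← Finset.card_image_of_injective bad suppRow_injective]
    refine le_trans (Finset.card_le_card (t := ((Finset.univ : Finset (Finset (Fin m))).erase
      ∅).biUnion (fun R => critSys k m n R)) ?_) Finset.card_biUnion_le
    intro r hr
    rw [Finset.mem_image] at hr
    obtain ⟨A, hA, rfl⟩ := hr
    rw [hbad, Finset.mem_filter] at hA
    obtain ⟨hA, R, hR, hv⟩ := hA
    rw [Finset.mem_biUnion]
    refine ⟨R, by simp [hR], ?_⟩
    unfold critSys
    rw [Finset.mem_filter, ← suppRow_image]
    exact ⟨Finset.mem_image_of_mem _ hA, fun v => sum_zero_even A R v (hv v)⟩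
  have hs : (T.card - bad.card) * 2 ^ m ≤ (((T ×ˢ (Finset.univ : Finset (Fin m → ZMod 2))).filter
      (fun p => ∃ x : Fin n → ZMod 2, p.1.mulVec x = p.2)).card) := by
    have h1 : (T \ bad) ×ˢ (Finset.univ : Finset (Fin m → ZMod 2)) ⊆
        ((T ×ˢ (Finset.univ : Finset (Fin m → ZMod 2))).filter
      (fun p => ∃ x : Fin n → ZMod 2, p.1.mulVec x = p.2)) := by
      intro p hp
      simp only [Finset.mem_product, Finset.mem_sdiff, Finset.mem_univ, and_true, hbad,
        Finset.mem_filter, not_and, not_exists] at hp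
      simp only [Finset.mem_filter, Finset.mem_product, Finset.mem_univ, and_true]
      refine ⟨hp.1, surj_of_no_crit _ (fun R hR => ?_) _⟩
      by_contra hne
      exact hp.2 hp.1 R hne hR
    have h2 := Finset.card_le_card h1
    rw [Finset.card_product, Finset.card_sdiff_of_subset (Finset.filter_subset _ _)] at h2
    simpa [ZMod.card] using h2
  have hbT : bad.card ≤ T.card := Finset.card_le_card (Finset.filter_subset _ _)
  have hs' : ((T.card : ℝ) - bad.card) * 2 ^ m ≤
      ((((T ×ˢ (Finset.univ : Finset (Fin m → ZMod 2))).filter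
      (fun p => ∃ x : Fin n → ZMod 2, p.1.mulVec x = p.2)).card : ℕ) : ℝ) := by
    rw [← Nat.cast_sub hbT]; exact_mod_cast hs
  have hb' : (bad.card : ℝ) ≤ ∑ R ∈ (Finset.univ : Finset (Finset (Fin m))).erase ∅,
      ((critSys k m n R).card : ℝ) := by exact_mod_cast hb
  have hp' : (0 : ℝ) < T.card := by exact_mod_cast hpos
  unfold satProb
  rw [← hT, le_div_iff₀ (by positivity)]
  refine le_trans ?_ hs'
  rw [one_sub_div hp'.ne']
  have : ((T.card : ℝ) - ∑ R ∈ (Finset.univ : Finset (Finset (Fin m))).erase ∅,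
      ((critSys k m n R).card : ℝ)) / T.card * (T.card * 2 ^ m) =
      ((T.card : ℝ) - ∑ R ∈ (Finset.univ : Finset (Finset (Fin m))).erase ∅,
      ((critSys k m n R).card : ℝ)) * 2 ^ m := by field_simp
  rw [this]
  gcongr


noncomputable def cdeg {ι : Type} [Fintype ι] {n : ℕ} (r : ι → Finset (Fin n)) (v : Fin n) : ℕ :=
  (Finset.univ.filter (fun i => v ∈ r i)).card

noncomputable def xlev (ι : Type) [Fintype ι] (k n : ℕ) (V : Finset (Fin n)) (v : Fin n) (d : ℕ) :
    Finset (ι → Finset (Fin n)) :=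
  (rowSys ι k n (insert v V)).filter (fun r => cdeg r v = d)

noncomputable def moveRow {ι : Type} {n : ℕ} (r : ι → Finset (Fin n)) (i : ι) (w v : Fin n) :
    ι → Finset (Fin n) := Function.update r i (insert v ((r i).erase w))

lemma cdeg_move_v {ι : Type} [Fintype ι] {n : ℕ} (r : ι → Finset (Fin n)) (i : ι) (w v : Fin n)
    (hv : v ∉ r i) : cdeg (moveRow r i w v) v = cdeg r v + 1 := by
  unfold cdeg
  have : (Finset.univ.filter (fun j => v ∈ moveRow r i w v j)) =
      insert i (Finset.univ.filter (fun j => v ∈ r j)) := by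
    ext j
    by_cases hj : j = i
    · subst hj; simp only [Finset.mem_filter, Finset.mem_univ, true_and, Finset.mem_insert, Finset.mem_erase]; simp [moveRow]
    · simp only [Finset.mem_filter, Finset.mem_univ, true_and, Finset.mem_insert, Finset.mem_erase]; simp [moveRow, hj]
  rw [this, Finset.card_insert_of_notMem (by simp [hv])]

lemma cdeg_move_w {ι : Type} [Fintype ι] {n : ℕ} (r : ι → Finset (Fin n)) (i : ι) (w v : Fin n)
    (hv : v ∉ r i) (hw : w ∈ r i) : cdeg (moveRow r i w v) w + 1 = cdeg r w := by
  unfold cdeg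
  have hne : w ≠ v := by rintro rfl; exact hv hw
  have : (Finset.univ.filter (fun j => w ∈ moveRow r i w v j)) =
      (Finset.univ.filter (fun j => w ∈ r j)).erase i := by
    ext j
    by_cases hj : j = i
    · subst hj; simp only [Finset.mem_filter, Finset.mem_univ, true_and, Finset.mem_insert, Finset.mem_erase]; simp [moveRow, hne]
    · simp only [Finset.mem_filter, Finset.mem_univ, true_and, Finset.mem_insert, Finset.mem_erase]; simp [moveRow, hj]
  rw [this, Finset.card_erase_add_one (by simp [hw])]

lemma cdeg_move_u {ι : Type} [Fintype ι] {n : ℕ} (r : ι → Finset (Fin n)) (i : ι) (w v u : Fin n)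
    (h1 : u ≠ v) (h2 : u ≠ w) : cdeg (moveRow r i w v) u = cdeg r u := by
  unfold cdeg
  congr 1
  ext j
  by_cases hj : j = i
  · subst hj; simp only [Finset.mem_filter, Finset.mem_univ, true_and]; simp [moveRow, h1, h2]
  · simp only [Finset.mem_filter, Finset.mem_univ, true_and]; simp [moveRow, hj]

noncomputable def fwd {ι : Type} [Fintype ι] {n : ℕ} (V : Finset (Fin n)) (v : Fin n)
    (r : ι → Finset (Fin n)) : Finset (ι × Fin n) :=
  Finset.univ.filter (fun p => p.2 ∈ r p.1 ∧ v ∉ r p.1 ∧ (p.2 ∈ V ∨ 3 ≤ cdeg r p.2))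

lemma card_all {ι : Type} [Fintype ι] {n k : ℕ} (r : ι → Finset (Fin n)) (h : ∀ i, (r i).card = k) :
    (Finset.univ.filter (fun p : ι × Fin n => p.2 ∈ r p.1)).card = k * Fintype.card ι := by
  have : (Finset.univ.filter (fun p : ι × Fin n => p.2 ∈ r p.1)).card = ∑ i, (r i).card := by
    rw [Finset.card_filter, Fintype.sum_prod_type]
    refine Finset.sum_congr rfl (fun i _ => ?_)
    rw [← Finset.card_filter]; simp
  rw [this]; simp [h, mul_comm]

lemma fwd_card {ι : Type} [Fintype ι] {n k : ℕ} (V : Finset (Fin n)) (v : Fin n) (d : ℕ)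
    (r : ι → Finset (Fin n)) (hr : r ∈ xlev ι k n V v d) :
    k * Fintype.card ι ≤ (fwd V v r).card + (k * d + 2 * n) := by
  simp only [xlev, rowSys, Finset.mem_filter, Finset.mem_univ, true_and] at hr
  obtain ⟨⟨hk, hdeg⟩, hd⟩ := hr
  rw [← card_all r hk]
  set B := Finset.univ.filter (fun p : ι × Fin n => v ∈ r p.1 ∧ p.2 ∈ r p.1) with hB
  set C := Finset.univ.filter (fun p : ι × Fin n => p.2 ∈ r p.1 ∧ cdeg r p.2 ≤ 2) with hC
  have hsub : (Finset.univ.filter (fun p : ι × Fin n => p.2 ∈ r p.1)) ⊆ fwd V v r ∪ (B ∪ C) := by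
    intro p hp
    simp only [Finset.mem_filter, Finset.mem_univ, true_and] at hp
    simp only [fwd, hB, hC, Finset.mem_union, Finset.mem_filter, Finset.mem_univ, true_and]
    by_cases h1 : v ∈ r p.1
    · right; left; exact ⟨h1, hp⟩
    · by_cases h2 : p.2 ∈ V ∨ 3 ≤ cdeg r p.2
      · left; exact ⟨hp, h1, h2⟩
      · right; right
        push Not at h2
        exact ⟨hp, by omega⟩
  have hBc : B.card ≤ k * d := by
    have : B.card = ∑ i ∈ (Finset.univ.filter (fun i => v ∈ r i)), (r i).card := by
      rw [hB, Finset.card_filter, Fintype.sum_prod_type, Finset.sum_filter]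
      refine Finset.sum_congr rfl (fun i _ => ?_)
      split_ifs with h
      · simp [h]
      · simp [h]
    rw [this, Finset.sum_congr rfl (fun i _ => hk i), Finset.sum_const, smul_eq_mul]
    unfold cdeg at hd
    rw [hd, mul_comm]
  have hCc : C.card ≤ 2 * n := by
    have : C.card = ∑ w : Fin n, if cdeg r w ≤ 2 then cdeg r w else 0 := by
      rw [hC, Finset.card_filter, Fintype.sum_prod_type_right]
      refine Finset.sum_congr rfl (fun w _ => ?_)
      split_ifs with h
      · simp only [h, and_true]; rw [← Finset.card_filter]; rfl
      · simp [h]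
    rw [this]
    calc _ ≤ ∑ w : Fin n, 2 := Finset.sum_le_sum (fun w _ => by split_ifs <;> omega)
      _ = 2 * n := by simp [mul_comm]
  calc _ ≤ (fwd V v r ∪ (B ∪ C)).card := Finset.card_le_card hsub
    _ ≤ (fwd V v r).card + (B.card + C.card) :=
      (Finset.card_union_le _ _).trans (by gcongr; exact Finset.card_union_le _ _)
    _ ≤ _ := by omega

lemma move_mem {ι : Type} [Fintype ι] {n k : ℕ} (V : Finset (Fin n)) (v : Fin n) (d : ℕ)
    (r : ι → Finset (Fin n)) (hr : r ∈ xlev ι k n V v d) (p : ι × Fin n) (hp : p ∈ fwd V v r) :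
    moveRow r p.1 p.2 v ∈ xlev ι k n V v (d + 1) := by
  obtain ⟨i, w⟩ := p
  simp only [xlev, rowSys, fwd, Finset.mem_filter, Finset.mem_univ, true_and] at hr hp ⊢
  obtain ⟨⟨hk, hdeg⟩, hd⟩ := hr
  obtain ⟨hw, hv, hor⟩ := hp
  refine ⟨⟨fun j => ?_, fun u hu => ?_⟩, ?_⟩
  · by_cases hj : j = i
    · subst hj
      simp only [moveRow, Function.update_self]
      rw [Finset.card_insert_of_notMem (by simp [hv]), Finset.card_erase_add_one hw, hk]
    · simp [moveRow, hj, hk]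
  · change 2 ≤ cdeg (moveRow r i w v) u
    have h2 : 2 ≤ cdeg r u := hdeg u hu
    simp only [Finset.mem_insert, not_or] at hu
    by_cases huw : u = w
    · subst huw
      have := cdeg_move_w r i u v hv hw
      rcases hor with h | h
      · exact absurd h hu.2
      · omega
    · rw [cdeg_move_u r i w v u hu.1 huw]; exact h2
  · rw [cdeg_move_v r i w v hv, hd]

lemma switch_step (ι : Type) [Fintype ι] (k n : ℕ) (V : Finset (Fin n)) (v : Fin n) (d : ℕ) :
    k * Fintype.card ι * (xlev ι k n V v d).card ≤
      (k * d + 2 * n) * (xlev ι k n V v d).card + (d + 1) * n * (xlev ι k n V v (d + 1)).card := by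
  have h1 : ((xlev ι k n V v d).sigma (fun r => fwd V v r)).card ≤
      ((xlev ι k n V v (d + 1)).sigma (fun r =>
        (Finset.univ.filter (fun i => v ∈ r i)) ×ˢ (Finset.univ : Finset (Fin n)))).card := by
    apply Finset.card_le_card_of_injOn (fun q => ⟨moveRow q.1 q.2.1 q.2.2 v, q.2⟩)
    · intro q hq
      simp only [Finset.mem_coe, Finset.mem_sigma] at hq ⊢
      refine ⟨move_mem V v d q.1 hq.1 q.2 hq.2, ?_⟩
      simp only [Finset.mem_product, Finset.mem_filter, Finset.mem_univ, true_and, and_true]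
      simp [moveRow]
    · rintro ⟨r, i, w⟩ hq ⟨r', i', w'⟩ hq' heq
      simp only [Finset.mem_coe, Finset.mem_sigma, fwd, Finset.mem_filter, Finset.mem_univ,
        true_and] at hq hq'
      simp only [Sigma.mk.injEq, heq_eq_eq, Prod.mk.injEq] at heq
      obtain ⟨h1, rfl, rfl⟩ := heq
      have : r = r' := by
        funext j
        have h2 := congrFun h1 j
        by_cases hj : j = i
        · subst hj
          simp only [moveRow, Function.update_self] at h2
          have h3 : ((r j).erase w) = ((r' j).erase w) := by
            have e1 : (insert v ((r j).erase w)).erase v = (r j).erase w :=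
              Finset.erase_insert (by simp [hq.2.2.1])
            have e2 : (insert v ((r' j).erase w)).erase v = (r' j).erase w :=
              Finset.erase_insert (by simp [hq'.2.2.1])
            rw [← e1, ← e2, h2]
          rw [← Finset.insert_erase hq.2.1, ← Finset.insert_erase hq'.2.1, h3]
        · simpa [moveRow, hj] using h2
      subst this; rfl
  rw [Finset.card_sigma, Finset.card_sigma] at h1
  have h2 : ∑ r ∈ xlev ι k n V v (d + 1), ((Finset.univ.filter (fun i => v ∈ r i)) ×ˢ
      (Finset.univ : Finset (Fin n))).card = (d + 1) * n * (xlev ι k n V v (d + 1)).card := by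
    rw [Finset.sum_congr rfl (g := fun _ => (d + 1) * n), Finset.sum_const, smul_eq_mul, mul_comm]
    intro r hr
    simp only [xlev, Finset.mem_filter] at hr
    rw [Finset.card_product]
    have := hr.2
    unfold cdeg at this
    rw [this]; simp
  have h3 : ∑ r ∈ xlev ι k n V v d, k * Fintype.card ι ≤
      ∑ r ∈ xlev ι k n V v d, ((fwd V v r).card + (k * d + 2 * n)) :=
    Finset.sum_le_sum (fun r hr => fwd_card V v d r hr)
  rw [Finset.sum_add_distrib, Finset.sum_const, Finset.sum_const, smul_eq_mul, smul_eq_mul] at h3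
  rw [h2] at h1
  nlinarith

lemma relax_one (ι : Type) [Fintype ι] (k n : ℕ) (V : Finset (Fin n)) (v : Fin n) (hv : v ∉ V)
    (hn : 0 < n) (δ : ℝ) (hδ : 0 < δ) (h : 2 * n + k + δ * n ≤ (k : ℝ) * Fintype.card ι) :
    ((rowSys ι k n (insert v V)).card : ℝ) ≤
      (1 + 2 / δ + 2 / δ ^ 2) * ((rowSys ι k n V).card : ℝ) := by
  have s0 := switch_step ι k n V v 0
  have s1 := switch_step ι k n V v 1
  have hn' : (0 : ℝ) < n := by exact_mod_cast hn
  set N0 := (xlev ι k n V v 0).card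
  set N1 := (xlev ι k n V v 1).card
  set N2 := (xlev ι k n V v 2).card
  set M := (rowSys ι k n V).card
  have hN2 : N2 ≤ M := by
    apply Finset.card_le_card
    intro r hr
    simp only [xlev, rowSys, Finset.mem_filter, Finset.mem_univ, true_and] at hr ⊢
    refine ⟨hr.1.1, fun u hu => ?_⟩
    by_cases huv : u = v
    · subst huv
      have := hr.2
      unfold cdeg at this
      omega
    · exact hr.1.2 u (by simp [hu, huv])
  have htot : (rowSys ι k n (insert v V)).card ≤ N0 + (N1 + M) := by
    have : rowSys ι k n (insert v V) ⊆ xlev ι k n V v 0 ∪ (xlev ι k n V v 1 ∪ rowSys ι k n V) := by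
      intro r hr
      rw [Finset.mem_union, Finset.mem_union]
      by_cases h0 : cdeg r v = 0
      · left; exact Finset.mem_filter.2 ⟨hr, h0⟩
      by_cases h1 : cdeg r v = 1
      · right; left; exact Finset.mem_filter.2 ⟨hr, h1⟩
      right; right
      simp only [rowSys, Finset.mem_filter, Finset.mem_univ, true_and] at hr ⊢
      refine ⟨hr.1, fun u hu => ?_⟩
      by_cases huv : u = v
      · subst huv
        change 2 ≤ cdeg r u
        omega
      · exact hr.2 u (by simp [hu, huv])
    exact (Finset.card_le_card this).trans ((Finset.card_union_le _ _).trans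
      (by gcongr; exact Finset.card_union_le _ _))
  have s0' : (k : ℝ) * Fintype.card ι * N0 ≤ (k * 0 + 2 * n) * N0 + (0 + 1) * n * N1 := by
    exact_mod_cast s0
  have s1' : (k : ℝ) * Fintype.card ι * N1 ≤ (k * 1 + 2 * n) * N1 + (1 + 1) * n * N2 := by
    exact_mod_cast s1
  have t0 : δ * N0 ≤ N1 := by
    have h1 : (2 * n + k + δ * n) * N0 ≤ (k : ℝ) * Fintype.card ι * N0 := by gcongr
    have h2 : n * (δ * N0) ≤ (n : ℝ) * N1 := by
      have : (0 : ℝ) ≤ k * N0 := by positivity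
      nlinarith
    exact le_of_mul_le_mul_left h2 hn'
  have t1 : δ * N1 ≤ 2 * N2 := by
    have h1 : (2 * n + k + δ * n) * N1 ≤ (k : ℝ) * Fintype.card ι * N1 := by gcongr
    have h2 : n * (δ * N1) ≤ (n : ℝ) * (2 * N2) := by nlinarith
    exact le_of_mul_le_mul_left h2 hn'
  have hN2' : (N2 : ℝ) ≤ M := by exact_mod_cast hN2
  have htot' : ((rowSys ι k n (insert v V)).card : ℝ) ≤ N0 + (N1 + M) := by exact_mod_cast htot
  have u1 : (N1 : ℝ) ≤ 2 / δ * M := by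
    rw [div_mul_eq_mul_div, le_div_iff₀ hδ]; nlinarith
  have u0 : (N0 : ℝ) ≤ 2 / δ ^ 2 * M := by
    have : (N0 : ℝ) ≤ N1 / δ := by rw [le_div_iff₀ hδ]; nlinarith
    calc (N0 : ℝ) ≤ N1 / δ := this
      _ ≤ (2 / δ * M) / δ := by gcongr
      _ = _ := by field_simp
  linarith

lemma relax_all (ι : Type) [Fintype ι] (k n : ℕ) (V : Finset (Fin n))
    (hn : 0 < n) (δ : ℝ) (hδ : 0 < δ) (h : 2 * n + k + δ * n ≤ (k : ℝ) * Fintype.card ι) :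
    ((rowSys ι k n V).card : ℝ) ≤
      (1 + 2 / δ + 2 / δ ^ 2) ^ V.card * ((rowSys ι k n ∅).card : ℝ) := by
  induction V using Finset.induction_on with
  | empty => simp
  | insert v V hv ih =>
    rw [Finset.card_insert_of_notMem hv, pow_succ]
    refine (relax_one ι k n V v hv hn δ hδ h).trans ?_
    have : (0 : ℝ) < 1 + 2 / δ + 2 / δ ^ 2 := by positivity
    calc _ ≤ (1 + 2 / δ + 2 / δ ^ 2) * ((1 + 2 / δ + 2 / δ ^ 2) ^ V.card *
        ((rowSys ι k n ∅).card : ℝ)) := by gcongr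
      _ = _ := by ring


lemma glue_bound (k m n : ℕ) (R : Finset (Fin m)) :
    (n.choose k) ^ R.card * (rowSys {i : Fin m // i ∉ R} k n ∅).card ≤
      (rowSys (Fin m) k n ∅).card := by
  have h1 : (Fintype.piFinset (fun _ : {i : Fin m // i ∈ R} =>
      Finset.powersetCard k (Finset.univ : Finset (Fin n)))).card = (n.choose k) ^ R.card := by
    simp
  rw [← h1, ← Finset.card_product]
  apply Finset.card_le_card_of_injOn
    (fun p => fun i => if h : i ∈ R then p.1 ⟨i, h⟩ else p.2 ⟨i, h⟩)
  · rintro ⟨a, b⟩ hp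
    simp only [Finset.coe_product, Set.mem_prod, Finset.mem_coe, Fintype.mem_piFinset,
      Finset.mem_powersetCard, rowSys, Finset.mem_filter, Finset.mem_univ, true_and] at hp ⊢
    obtain ⟨ha, hb, hd⟩ := hp
    refine ⟨fun i => ?_, fun v hv => ?_⟩
    · by_cases h : i ∈ R
      · simp only [h, dite_true]; exact (ha ⟨i, h⟩).2
      · simp only [h, dite_false]; exact hb ⟨i, h⟩
    · refine (hd v hv).trans ?_
      apply Finset.card_le_card_of_injOn (fun i => i.1)
      · intro i hi
        simp only [Finset.coe_filter, Finset.mem_univ, true_and, Set.mem_setOf_eq] at hi ⊢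
        simp only [i.2, dite_false]; exact hi
      · intro i _ j _ h; exact Subtype.ext h
  · rintro ⟨a, b⟩ _ ⟨a', b'⟩ _ heq
    simp only at heq
    refine Prod.ext (funext fun i => ?_) (funext fun i => ?_)
    · have := congrFun heq i.1
      simpa [i.2] using this
    · have := congrFun heq i.1
      simpa [i.2] using this

lemma union_card (k m n : ℕ) (R : Finset (Fin m)) (r : Fin m → Finset (Fin n))
    (hr : r ∈ critSys k m n R) : 2 * (R.biUnion r).card ≤ k * R.card := by
  simp only [critSys, rowSys, Finset.mem_filter, Finset.mem_univ, true_and] at hr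
  obtain ⟨⟨hk, _⟩, he⟩ := hr
  have h1 : ∑ v ∈ R.biUnion r, (R.filter (fun i => v ∈ r i)).card = k * R.card := by
    have : ∀ v ∈ (Finset.univ : Finset (Fin n)), v ∉ R.biUnion r →
        (R.filter (fun i => v ∈ r i)).card = 0 := by
      intro v _ hv
      rw [Finset.card_eq_zero, Finset.filter_eq_empty_iff]
      intro i hi hvi
      exact hv (Finset.mem_biUnion.2 ⟨i, hi, hvi⟩)
    rw [Finset.sum_subset (Finset.subset_univ _) this]
    simp only [Finset.card_filter]
    rw [Finset.sum_comm]
    have : ∀ i ∈ R, (∑ v : Fin n, if v ∈ r i then 1 else 0) = k := by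
      intro i _
      rw [← hk i, ← Finset.card_filter]; simp
    rw [Finset.sum_congr rfl this, Finset.sum_const, smul_eq_mul, mul_comm]
  rw [← h1, mul_comm, ← smul_eq_mul]
  refine Finset.card_nsmul_le_sum _ _ _ (fun v hv => ?_)
  obtain ⟨i, hi, hvi⟩ := Finset.mem_biUnion.1 hv
  have hpos : 0 < (R.filter (fun i => v ∈ r i)).card :=
    Finset.card_pos.2 ⟨i, Finset.mem_filter.2 ⟨hi, hvi⟩⟩
  obtain ⟨x, hx⟩ := he v
  omega

lemma crit_small_nat (k m n t : ℕ) (R : Finset (Fin m)) (ht : t = k * R.card / 2) (htn : t ≤ n) :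
    (critSys k m n R).card ≤ ∑ V ∈ Finset.powersetCard t (Finset.univ : Finset (Fin n)),
      (t.choose k) ^ R.card * (rowSys {i : Fin m // i ∉ R} k n V).card := by
  set E : Finset (Fin n) → Finset (Fin m → Finset (Fin n)) := fun V =>
    Finset.univ.filter (fun r => (∀ i ∈ R, r i ∈ Finset.powersetCard k V) ∧
      (fun i : {i : Fin m // i ∉ R} => r i.1) ∈ rowSys {i : Fin m // i ∉ R} k n V) with hE
  have hsub : critSys k m n R ⊆ (Finset.powersetCard t (Finset.univ : Finset (Fin n))).biUnion E := by
    intro r hr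
    have hu := union_card k m n R r hr
    obtain ⟨V, hV1, hV2⟩ := Finset.exists_superset_card_eq (s := R.biUnion r) (n := t)
      (by omega) (by simpa using htn)
    simp only [critSys, rowSys, Finset.mem_filter, Finset.mem_univ, true_and] at hr
    obtain ⟨⟨hk, hd⟩, he⟩ := hr
    rw [Finset.mem_biUnion]
    refine ⟨V, by simp [Finset.mem_powersetCard, hV2], ?_⟩
    simp only [hE, rowSys, Finset.mem_filter, Finset.mem_univ, true_and, Finset.mem_powersetCard]
    refine ⟨fun i hi => ⟨(Finset.subset_biUnion_of_mem r hi).trans hV1, hk i⟩,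
      fun i => hk i.1, fun v hv => ?_⟩
    refine (hd v (by simp)).trans ?_
    have : (Finset.univ.filter (fun i => v ∈ r i)) ⊆
        (Finset.univ.filter (fun i : {i : Fin m // i ∉ R} => v ∈ r i.1)).map
          (Function.Embedding.subtype _) := by
      intro i hi
      simp only [Finset.mem_filter, Finset.mem_univ, true_and] at hi
      have hiR : i ∉ R := fun h => hv (hV1 (Finset.mem_biUnion.2 ⟨i, h, hi⟩))
      simp only [Finset.mem_map, Finset.mem_filter, Finset.mem_univ, true_and,
        Function.Embedding.subtype_apply]
      exact ⟨⟨i, hiR⟩, hi, rfl⟩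
    exact (Finset.card_le_card this).trans (by rw [Finset.card_map])
  refine (Finset.card_le_card hsub).trans (Finset.card_biUnion_le.trans ?_)
  refine Finset.sum_le_sum (fun V hV => ?_)
  rw [Finset.mem_powersetCard] at hV
  have h1 : (Fintype.piFinset (fun _ : {i : Fin m // i ∈ R} =>
      Finset.powersetCard k V)).card = (t.choose k) ^ R.card := by
    simp [hV.2]
  rw [← h1, ← Finset.card_product]
  apply Finset.card_le_card_of_injOn (fun r => (fun i => r i.1, fun i => r i.1))
  · intro r hr
    simp only [hE, Finset.coe_filter, Finset.mem_univ, true_and, Set.mem_setOf_eq] at hr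
    simp only [Finset.coe_product, Set.mem_prod, Finset.mem_coe, Fintype.mem_piFinset]
    exact ⟨fun i => hr.1 i.1 i.2, hr.2⟩
  · intro r _ r' _ heq
    simp only [Prod.mk.injEq] at heq
    funext i
    by_cases h : i ∈ R
    · exact congrFun heq.1 ⟨i, h⟩
    · exact congrFun heq.2 ⟨i, h⟩

lemma crit_small (k m n t : ℕ) (R : Finset (Fin m)) (ht : t = k * R.card / 2) (htn : t ≤ n)
    (hn : 0 < n) (δ : ℝ) (hδ : 0 < δ)
    (h : 2 * n + k + δ * n ≤ (k : ℝ) * ((m : ℝ) - R.card)) :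
    ((n.choose k : ℕ) : ℝ) ^ R.card * ((critSys k m n R).card : ℝ) ≤
      (n.choose t : ℕ) * ((t.choose k : ℕ) : ℝ) ^ R.card * (1 + 2 / δ + 2 / δ ^ 2) ^ t *
        ((rowSys (Fin m) k n ∅).card : ℝ) := by
  have hcard : (Fintype.card {i : Fin m // i ∉ R} : ℝ) = (m : ℝ) - R.card := by
    have : Fintype.card {i : Fin m // i ∉ R} = m - R.card := by
      rw [Fintype.card_subtype_compl]; simp
    have h2 : R.card ≤ m := by simpa using Finset.card_le_univ R
    rw [this, Nat.cast_sub h2]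
  have h1 : ((critSys k m n R).card : ℝ) ≤
      ∑ V ∈ Finset.powersetCard t (Finset.univ : Finset (Fin n)),
      ((t.choose k : ℕ) : ℝ) ^ R.card * ((rowSys {i : Fin m // i ∉ R} k n V).card : ℝ) := by
    exact_mod_cast crit_small_nat k m n t R ht htn
  have h2 : ∑ V ∈ Finset.powersetCard t (Finset.univ : Finset (Fin n)),
      ((t.choose k : ℕ) : ℝ) ^ R.card * ((rowSys {i : Fin m // i ∉ R} k n V).card : ℝ) ≤
      ∑ V ∈ Finset.powersetCard t (Finset.univ : Finset (Fin n)),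
      ((t.choose k : ℕ) : ℝ) ^ R.card * ((1 + 2 / δ + 2 / δ ^ 2) ^ t *
        ((rowSys {i : Fin m // i ∉ R} k n ∅).card : ℝ)) := by
    refine Finset.sum_le_sum (fun V hV => ?_)
    rw [Finset.mem_powersetCard] at hV
    gcongr
    rw [← hV.2]
    exact relax_all _ k n V hn δ hδ (by rw [hcard]; exact h)
  rw [Finset.sum_const, Finset.card_powersetCard, Finset.card_univ, Fintype.card_fin,
    nsmul_eq_mul] at h2
  have h3 : ((n.choose k : ℕ) : ℝ) ^ R.card * ((rowSys {i : Fin m // i ∉ R} k n ∅).card : ℝ) ≤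
      ((rowSys (Fin m) k n ∅).card : ℝ) := by exact_mod_cast glue_bound k m n R
  have h4 := h1.trans h2
  have hC : (0 : ℝ) < 1 + 2 / δ + 2 / δ ^ 2 := by positivity
  calc _ ≤ ((n.choose k : ℕ) : ℝ) ^ R.card * (((n.choose t : ℕ) : ℝ) *
      (((t.choose k : ℕ) : ℝ) ^ R.card * ((1 + 2 / δ + 2 / δ ^ 2) ^ t *
        ((rowSys {i : Fin m // i ∉ R} k n ∅).card : ℝ)))) := by gcongr
    _ = (n.choose t : ℕ) * ((t.choose k : ℕ) : ℝ) ^ R.card * (1 + 2 / δ + 2 / δ ^ 2) ^ t *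
      (((n.choose k : ℕ) : ℝ) ^ R.card *
        ((rowSys {i : Fin m // i ∉ R} k n ∅).card : ℝ)) := by ring
    _ ≤ _ := by gcongr


lemma choose_ratio (t n k : ℕ) (h : t ≤ n) : (t.choose k : ℝ) * (n:ℝ)^k ≤ (n.choose k : ℝ) * (t:ℝ)^k := by
  have key : t.descFactorial k * n^k ≤ n.descFactorial k * t^k := by
    induction k with
    | zero => simp
    | succ j ih =>
      rw [Nat.descFactorial_succ, Nat.descFactorial_succ, pow_succ, pow_succ]
      have h1 : (t - j) * n ≤ (n - j) * t := by
        rcases le_total t j with h2 | h2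
        · simp [Nat.sub_eq_zero_of_le h2]
        · zify [h2, h2.trans h]
          have : (j:ℤ) * t ≤ j * n := by exact_mod_cast Nat.mul_le_mul_left j h
          nlinarith
      calc (t - j) * t.descFactorial j * (n^j * n) = ((t-j)*n) * (t.descFactorial j * n^j) := by ring
        _ ≤ ((n-j)*t) * (n.descFactorial j * t^j) := Nat.mul_le_mul h1 ih
        _ = _ := by ring
  rw [Nat.descFactorial_eq_factorial_mul_choose, Nat.descFactorial_eq_factorial_mul_choose] at key
  have hk : 0 < k.factorial := Nat.factorial_pos k
  have : t.choose k * n^k ≤ n.choose k * t^k := by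
    refine Nat.le_of_mul_le_mul_left ?_ hk
    calc _ = k.factorial * t.choose k * n^k := by ring
      _ ≤ _ := key
      _ = _ := by ring
  exact_mod_cast this

lemma choose_le_three (n r : ℕ) (hr : 0 < r) : (n.choose r : ℝ) ≤ (3 * n / r)^r := by
  have h1 : (n.choose r : ℝ) ≤ (n:ℝ)^r / (r.factorial : ℝ) := Nat.choose_le_pow_div r n
  have h2 : ((r:ℝ))^r / r.factorial ≤ 3^r := by
    refine (Real.pow_div_factorial_le_exp (r:ℝ) (by positivity) r).trans ?_
    have : Real.exp (r:ℝ) = (Real.exp 1)^r := by rw [← Real.exp_nat_mul]; simp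
    rw [this]
    gcongr
    exact Real.exp_one_lt_three.le
  have hr' : (0:ℝ) < r := by exact_mod_cast hr
  have hf : (0:ℝ) < r.factorial := by exact_mod_cast Nat.factorial_pos r
  refine h1.trans ?_
  rw [div_pow, mul_pow, div_le_div_iff₀ hf (by positivity)]
  rw [div_le_iff₀ hf] at h2
  nlinarith [pow_nonneg (Nat.cast_nonneg (α:=ℝ) n) r]

lemma small_term (k m n l : ℕ) (hk : 4 ≤ k) (hmn : m ≤ n) (hn : 0 < n) (hm : 0 < m) (hl : 2 ≤ l)
    (C0 : ℝ) (hC0 : 1 ≤ C0) (htn : k * l / 2 ≤ n) 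
    (hu : (3^(1+k) * C0^k * (k:ℝ)^k) * (l:ℝ) / n ≤ 1/4) (hln : l ≤ n):
    (m.choose l : ℝ) * ((n.choose (k*l/2) : ℝ) * ((k*l/2).choose k : ℝ)^l * C0^(k*l/2)) ≤
      (n.choose k : ℝ)^l * (16 * (3^(1+k) * C0^k * (k:ℝ)^k)^2 * ((l:ℝ)^(k-2) * (1/4)^l) / (m:ℝ)^(k-2)) := by
  set t := k*l/2 with ht
  set C1 : ℝ := 3^(1+k) * C0^k * (k:ℝ)^k with hC1
  have hkl : 4 * l ≤ k * l := Nat.mul_le_mul_right l hk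
  have ht1 : 2 * l ≤ t := by omega
  have ht2 : t ≤ k * l - t := by omega
  have ht3 : t ≤ k * l := by omega
  have hexp : (k - 2) + (l - 2) + l ≤ k * l - t := by
    have : 2 * ((k - 2) + (l - 2) + l) ≤ k * l := by
      obtain ⟨k', rfl⟩ := Nat.exists_eq_add_of_le hk
      obtain ⟨l', rfl⟩ := Nat.exists_eq_add_of_le hl
      have e1 : 4 + k' - 2 = k' + 2 := by omega
      have e2 : 2 + l' - 2 = l' := by omega
      rw [e1, e2]; nlinarith
    omega
  have hn' : (0:ℝ) < n := by exact_mod_cast hn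
  have hm' : (0:ℝ) < m := by exact_mod_cast hm
  have hl' : (0:ℝ) < l := by exact_mod_cast (by omega : 0 < l)
  have htp : (0:ℝ) < t := by exact_mod_cast (by omega : 0 < t)
  have hk1 : (1:ℝ) ≤ k := by exact_mod_cast (by omega : 1 ≤ k)
  set u : ℝ := l / n with hu'
  have hu0 : 0 < u := by positivity
  have hu1 : u ≤ 1 := by rw [hu', div_le_one hn']; exact_mod_cast hln
  have htu : (t:ℝ)/n ≤ k * u := by
    rw [hu', ← mul_div_assoc]; gcongr; exact_mod_cast ht3
  have h1 : (m.choose l : ℝ) ≤ (3 / u)^l := by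
    refine (choose_le_three m l (by omega)).trans ?_
    apply pow_le_pow_left₀ (by positivity)
    rw [hu', div_div_eq_mul_div]
    gcongr
  have h2 : (n.choose t : ℝ) ≤ (3 / (t/n))^t := by
    refine (choose_le_three n t (by omega)).trans ?_
    rw [div_div_eq_mul_div]
  have h3 : (t.choose k : ℝ) ≤ (n.choose k : ℝ) * ((t:ℝ)/n)^k := by
    rw [div_pow, ← mul_div_assoc, le_div_iff₀ (by positivity)]
    exact choose_ratio t n k htn
  set τ : ℝ := (t:ℝ)/n with hτ
  have hτ0 : 0 < τ := by positivity
  have hC1' : 1 ≤ C1 := by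
    have := one_le_pow₀ hC0 (n := k)
    have := one_le_pow₀ hk1 (n := k)
    have : (1:ℝ) ≤ 3^(1+k) := one_le_pow₀ (by norm_num)
    rw [hC1]
    exact one_le_mul_of_one_le_of_one_le (one_le_mul_of_one_le_of_one_le ‹_› ‹_›) ‹_›
  have hCu : C1 * u ≤ 1/4 := by rw [hu', ← mul_div_assoc]; exact hu
  calc (m.choose l : ℝ) * ((n.choose t : ℝ) * (t.choose k : ℝ)^l * C0^t) 
      ≤ (3/u)^l * ((3/τ)^t * ((n.choose k : ℝ) * τ^k)^l * C0^t) := by gcongr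
    _ = (n.choose k : ℝ)^l * ((3/u)^l * (3^t * C0^t) * τ^(k*l - t)) := by
        have : τ^(k*l) = τ^(k*l-t) * τ^t := by rw [← pow_add]; congr 1; omega
        rw [mul_pow, ← pow_mul, this, div_pow 3 τ]
        field_simp
    _ ≤ (n.choose k : ℝ)^l * ((3/u)^l * (3^(k*l) * C0^(k*l)) * (k*u)^(k*l-t)) := by
        gcongr
        norm_num
    _ = (n.choose k : ℝ)^l * ((3/u)^l * (3^(k*l) * C0^(k*l)) * (k^(k*l-t) * u^(k*l-t))) := by rw [mul_pow (k:ℝ)]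
    _ ≤ (n.choose k : ℝ)^l * ((3/u)^l * (3^(k*l) * C0^(k*l)) * (k^(k*l) * u^((k - 2) + (l - 2) + l))) := by
        have e1 : (k:ℝ)^(k*l-t) ≤ (k:ℝ)^(k*l) := pow_le_pow_right₀ hk1 (by omega)
        have e2 : u^(k*l-t) ≤ u^((k - 2) + (l - 2) + l) := pow_le_pow_of_le_one hu0.le hu1 hexp
        gcongr
    _ = (n.choose k : ℝ)^l * (C1^l * u^(l-2) * u^(k-2)) := by
        congr 1
        rw [hC1, pow_add u, pow_add u, div_pow, mul_pow, mul_pow, ← pow_mul, ← pow_mul, ← pow_mul, 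
          add_mul, pow_add, one_mul]
        field_simp
    _ = (n.choose k : ℝ)^l * (C1^2 * (C1*u)^(l-2) * u^(k-2)) := by
        have : C1^l = C1^2 * C1^(l-2) := by rw [← pow_add]; congr 1; omega
        rw [this, mul_pow]; ring
    _ ≤ (n.choose k : ℝ)^l * (C1^2 * (1/4)^(l-2) * (l/m)^(k-2)) := by
        gcongr
        rw [hu']; gcongr
    _ = _ := by
        have : (1/4:ℝ)^l = (1/4)^2 * (1/4)^(l-2) := by rw [← pow_add]; congr 1; omega
        rw [this, div_pow (l:ℝ)]; ring

lemma crit_small_sum (k : ℕ) (hk : 4 ≤ k) (δ0 : ℝ) (hδ0 : 0 < δ0) :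
    ∃ ε : ℝ, 0 < ε ∧ ∃ K : ℝ, 0 ≤ K ∧ ∃ n0 : ℕ, ∀ m n : ℕ, m ≤ n → n0 ≤ n → 0 < m → (2 + δ0) * n ≤ k * m →
      ∑ R ∈ ((Finset.univ : Finset (Finset (Fin m))).erase ∅).filter (fun R => (R.card:ℝ) ≤ ε * m), ((critSys k m n R).card : ℝ)
        ≤ K / (m:ℝ)^(k-2) * ((rowSys (Fin m) k n ∅).card : ℝ) := by
  set δ := δ0/2 with hδ
  have hδp : 0 < δ := by positivity
  set C0 : ℝ := 1 + 2/δ + 2/δ^2 with hC0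
  have hC0' : 1 ≤ C0 := by rw [hC0]; have : 0 < 2/δ := by positivity
                           have : 0 < 2/δ^2 := by positivity
                           linarith
  set C1 : ℝ := 3^(1+k) * C0^k * (k:ℝ)^k with hC1
  have hkp : (0:ℝ) < k := by exact_mod_cast (by omega : 0 < k)
  have hC1p : 0 < C1 := by positivity
  set ε : ℝ := min (min (δ0/(4*(2+δ0))) (1/(4*C1))) (1/k) with hε
  have hεp : 0 < ε := by rw [hε]; positivity
  have hs : Summable (fun l : ℕ => (l:ℝ)^(k-2) * (1/4:ℝ)^l) :=
    summable_pow_mul_geometric_of_norm_lt_one (k-2) (by norm_num)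
  refine ⟨ε, hεp, 16 * C1^2 * ∑' l : ℕ, (l:ℝ)^(k-2) * (1/4:ℝ)^l, ?_, Nat.ceil (4*k/δ0) + k + 1, ?_⟩
  · have : 0 ≤ ∑' l : ℕ, (l:ℝ)^(k-2) * (1/4:ℝ)^l := tsum_nonneg (fun l => by positivity)
    positivity
  intro m n hmn hn0 hm hd
  have hn : 0 < n := by omega
  have hkn : k ≤ n := by omega
  have hnr : (4*k/δ0) ≤ n := (Nat.le_ceil _).trans (Nat.cast_le.mpr (by omega))
  have hn' : (0:ℝ) < n := by exact_mod_cast hn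
  have hm' : (0:ℝ) < m := by exact_mod_cast hm
  have hmn' : (m:ℝ) ≤ n := by exact_mod_cast hmn
  set T : ℝ := ((rowSys (Fin m) k n ∅).card : ℝ)
  have hT : 0 ≤ T := by positivity
  -- group by card
  have hck : (0:ℝ) < n.choose k := by exact_mod_cast Nat.choose_pos hkn
  have hbound : ∀ l : ℕ, 0 < l → (l:ℝ) ≤ ε * m → 
      ∑ R ∈ (Finset.univ : Finset (Finset (Fin m))).filter (fun R => R.card = l), ((critSys k m n R).card : ℝ)
       ≤ (16 * C1^2 * ((l:ℝ)^(k-2) * (1/4)^l)/(m:ℝ)^(k-2)) * T := by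
    intro l hl hle
    have hln' : (l:ℝ) ≤ ε * n := hle.trans (by gcongr)
    have hε3 : ε ≤ 1/k := min_le_right _ _
    have hε2 : ε ≤ 1/(4*C1) := (min_le_left _ _).trans (min_le_right _ _)
    have hε1 : ε ≤ δ0/(4*(2+δ0)) := (min_le_left _ _).trans (min_le_left _ _)
    have hkl : (k:ℝ) * l ≤ n := by
      calc (k:ℝ) * l ≤ k * (1/k * n) := by gcongr; exact hln'.trans (by gcongr)
        _ = n := by field_simp
    have hkl' : k * l ≤ n := by exact_mod_cast hkl
    have hln : l ≤ n := le_trans (Nat.le_mul_of_pos_left l (by omega)) hkl'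
    have htn : k * l / 2 ≤ n := (Nat.div_le_self _ _).trans hkl'
    have hmain : (2:ℝ)*n + k + δ*n ≤ (k:ℝ)*((m:ℝ) - l) := by
      have e1 : (k:ℝ) * l ≤ k * (δ0/(4*(2+δ0)) * m) := by gcongr; exact hle.trans (by gcongr)
      have e2 : (k:ℝ) ≤ δ0/4 * n := by
        rw [div_le_iff₀ hδ0] at hnr; linarith
      have e3 : (k:ℝ) * m * (1 - δ0/(4*(2+δ0))) ≥ (2+δ0) * n * (1 - δ0/(4*(2+δ0))) := by
        have : 0 ≤ 1 - δ0/(4*(2+δ0)) := by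
          rw [sub_nonneg, div_le_one (by positivity)]; linarith
        gcongr
      have e4 : (2+δ0) * n * (1 - δ0/(4*(2+δ0))) = (2+δ0) * n - δ0/4*n := by field_simp
      rw [hδ]; nlinarith
    have hcs : ∀ R : Finset (Fin m), R.card = l → (n.choose k:ℝ)^l * ((critSys k m n R).card:ℝ) ≤
        (n.choose (k*l/2)) * ((k*l/2).choose k:ℝ)^l * C0^(k*l/2) * T := by
      intro R hR
      have := crit_small k m n (k*l/2) R (by rw [hR]) htn hn δ hδp (by rw [hR]; exact hmain)
      rw [hR] at this; exact this
    have hckl : 0 < (n.choose k:ℝ)^l := by positivity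
    have hcard : (((Finset.univ : Finset (Finset (Fin m))).filter (fun R => R.card = l)).card : ℝ) = m.choose l := by
      have : (Finset.univ : Finset (Finset (Fin m))).filter (fun R => R.card = l) = (Finset.univ : Finset (Fin m)).powersetCard l := by
        ext R; simp [Finset.mem_powersetCard]
      rw [this, Finset.card_powersetCard]; simp
    refine le_of_mul_le_mul_left ?_ hckl
    rw [Finset.mul_sum]
    calc _ ≤ ∑ R ∈ (Finset.univ : Finset (Finset (Fin m))).filter (fun R => R.card = l), 
          ((n.choose (k*l/2)) * ((k*l/2).choose k:ℝ)^l * C0^(k*l/2) * T) := by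
          apply Finset.sum_le_sum; intro R hR
          exact hcs R (Finset.mem_filter.mp hR).2
      _ = (m.choose l : ℝ) * ((n.choose (k*l/2) : ℝ) * ((k*l/2).choose k : ℝ)^l * C0^(k*l/2)) * T := by
          rw [Finset.sum_const, nsmul_eq_mul, hcard]; ring
      _ ≤ (n.choose k : ℝ)^l * (16 * C1^2 * ((l:ℝ)^(k-2) * (1/4)^l) / (m:ℝ)^(k-2)) * T := by
          rcases Nat.lt_or_ge l 2 with h2 | h2
          · have : l = 1 := by omega
            subst this
            have : (k*1/2).choose k = 0 := Nat.choose_eq_zero_of_lt (by omega)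
            rw [this]; simp; positivity
          · refine mul_le_mul_of_nonneg_right ?_ hT
            refine small_term k m n l hk hmn hn hm h2 C0 hC0' htn ?_ hln
            rw [← hC1]
            rw [div_le_iff₀ hn']
            calc C1 * l ≤ C1 * (1/(4*C1) * n) := by gcongr; exact hln'.trans (by gcongr)
              _ = 1/4 * n := by field_simp
      _ = _ := by ring
  have hstep : ∑ R ∈ ((Finset.univ : Finset (Finset (Fin m))).erase ∅).filter (fun R => (R.card:ℝ) ≤ ε * m), ((critSys k m n R).card : ℝ)
      = ∑ l ∈ (Finset.range (m+1)).filter (fun l : ℕ => 0 < l ∧ (l:ℝ) ≤ ε * m), 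
         ∑ R ∈ (Finset.univ : Finset (Finset (Fin m))).filter (fun R => R.card = l), ((critSys k m n R).card : ℝ) := by
    rw [← Finset.sum_fiberwise_of_maps_to (t := (Finset.range (m+1)).filter (fun l : ℕ => 0 < l ∧ (l:ℝ) ≤ ε * m)) (g := Finset.card)]
    · apply Finset.sum_congr rfl
      intro l hl
      apply Finset.sum_congr _ (fun _ _ => rfl)
      ext R
      simp only [Finset.mem_filter, Finset.mem_erase, Finset.mem_univ, true_and, and_true, ne_eq]
      have hl := (Finset.mem_filter.mp hl).2
      constructor
      · exact fun h => h.2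
      · rintro rfl
        exact ⟨⟨fun h => by simp [h] at hl, hl.2⟩, rfl⟩
    · intro R hR
      simp only [Finset.mem_filter, Finset.mem_erase, Finset.mem_univ, and_true, ne_eq] at hR
      simp only [Finset.mem_filter, Finset.mem_range]
      refine ⟨?_, ?_, hR.2⟩
      · have := Finset.card_le_univ R; simp at this; omega
      · exact Finset.card_pos.mpr (Finset.nonempty_iff_ne_empty.mpr hR.1)
  rw [hstep]
  calc _ ≤ ∑ l ∈ (Finset.range (m+1)).filter (fun l : ℕ => 0 < l ∧ (l:ℝ) ≤ ε * m), (16 * C1^2 * ((l:ℝ)^(k-2) * (1/4)^l)/(m:ℝ)^(k-2)) * T := by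
        apply Finset.sum_le_sum; intro l hl
        have hl := (Finset.mem_filter.mp hl).2
        exact hbound l hl.1 hl.2
    _ = (16 * C1^2 * ∑ l ∈ (Finset.range (m+1)).filter (fun l : ℕ => 0 < l ∧ (l:ℝ) ≤ ε * m), ((l:ℝ)^(k-2) * (1/4)^l)) /(m:ℝ)^(k-2) * T := by
        rw [Finset.mul_sum, Finset.sum_div, Finset.sum_mul]
    _ ≤ _ := by
        gcongr
        exact hs.sum_le_tsum _ (fun l _ => by positivity)


/-- fibre sizes -/
noncomputable def fib {X V : Type} [Fintype X] (f : X → V) (v : V) : ℕ :=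
  (Finset.univ.filter (fun x => f x = v)).card

lemma fib_sum {X V : Type} [Fintype X] [Fintype V] (f : X → V) : ∑ v, fib f v = Fintype.card X := by
  unfold fib
  rw [← Finset.card_univ (α := X)]
  exact (Finset.card_eq_sum_card_fiberwise (fun x _ => Finset.mem_univ (f x))).symm

lemma fib_count {X V : Type} [Fintype X] [Fintype V] (d : V → ℕ) (hd : ∑ v, d v = Fintype.card X) :
    ((Finset.univ : Finset (X → V)).filter (fun f => fib f = d)).card * ∏ v, (d v).factorial
      = (Fintype.card X).factorial := by
  have h1 : (∑ v, (MvPolynomial.X v : MvPolynomial V ℕ)) ^ (Fintype.card X) = 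
      ∑ f : X → V, ∏ v, (MvPolynomial.X v : MvPolynomial V ℕ) ^ (fib f v) := by
    have := Finset.prod_univ_sum (fun _ : X => (Finset.univ : Finset V)) (fun _ v => (MvPolynomial.X v : MvPolynomial V ℕ))
    rw [Finset.prod_const, Finset.card_univ, Fintype.piFinset_univ] at this
    rw [this]
    apply Finset.sum_congr rfl
    intro f _
    rw [← Finset.prod_fiberwise' Finset.univ f (fun v => (MvPolynomial.X v : MvPolynomial V ℕ))]
    apply Finset.prod_congr rfl
    intro v _
    rw [Finset.prod_const]; rfl
  have h2 := Finset.sum_pow_eq_sum_piAntidiag (Finset.univ : Finset V) (fun v => (MvPolynomial.X v : MvPolynomial V ℕ)) (Fintype.card X)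
  rw [h1] at h2
  have h3 := congrArg (MvPolynomial.coeff (Finsupp.equivFunOnFinite.symm d)) h2
  have hind : ∀ e : V → ℕ, (Finsupp.equivFunOnFinite.symm d = Finsupp.indicator Finset.univ (fun i _ => e i)) ↔ e = d := by
    intro e
    rw [Finsupp.ext_iff, funext_iff]
    simp [eq_comm]
  rw [MvPolynomial.coeff_sum, MvPolynomial.coeff_sum] at h3
  simp only [MvPolynomial.coeff_prod_X_pow, hind] at h3
  rw [Finset.sum_boole] at h3
  have h4 : ∀ e : V → ℕ, MvPolynomial.coeff (Finsupp.equivFunOnFinite.symm d) ((Nat.multinomial Finset.univ e : MvPolynomial V ℕ) * ∏ v, (MvPolynomial.X v : MvPolynomial V ℕ)^(e v)) = if e = d then Nat.multinomial Finset.univ e else 0 := by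
    intro e
    have : (Nat.multinomial Finset.univ e : MvPolynomial V ℕ) = MvPolynomial.C (Nat.multinomial Finset.univ e) := by simp
    rw [this, MvPolynomial.coeff_C_mul, MvPolynomial.coeff_prod_X_pow]
    simp only [hind]
    split_ifs <;> simp
  simp only [h4] at h3
  rw [Finset.sum_ite_eq' , if_pos (by simp [hd])] at h3
  rw [← hd, ← Nat.multinomial_spec Finset.univ d, ← h3, mul_comm]
  simp

lemma fib_sum_eq {X V : Type} [Fintype X] [Fintype V] (G : (V → ℕ) → ℝ) :
    ∑ f : X → V, G (fib f) = ∑ d ∈ Finset.piAntidiag (Finset.univ : Finset V) (Fintype.card X), 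
       ((Fintype.card X).factorial : ℝ) * ((∏ v, ((d v).factorial : ℝ)⁻¹) * G d) := by
  rw [← Finset.sum_fiberwise_of_maps_to (s := (Finset.univ : Finset (X → V))) (t := Finset.piAntidiag (Finset.univ : Finset V) (Fintype.card X)) (g := fib)]
  · apply Finset.sum_congr rfl
    intro d hd
    have hd' : ∑ v, d v = Fintype.card X := by simpa using hd
    have h := fib_count (X := X) d hd'
    have : ∑ f ∈ (Finset.univ : Finset (X → V)).filter (fun f => fib f = d), G (fib f) = 
       ∑ f ∈ (Finset.univ : Finset (X → V)).filter (fun f => fib f = d), G d := by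
      apply Finset.sum_congr rfl
      intro f hf; rw [(Finset.mem_filter.mp hf).2]
    rw [this, Finset.sum_const, nsmul_eq_mul, ← h]
    push_cast
    rw [Finset.prod_inv_distrib]
    have : (∏ v, ((d v).factorial:ℝ)) ≠ 0 := by positivity
    field_simp
  · intro f _
    simp [fib_sum]

/-- upper bound for two kinds of positions -/
lemma fib_two_upper {X Y V : Type} [Fintype X] [Fintype Y] [Fintype V] (P : ℕ → ℕ → Prop) (x y W : ℝ) (hx : 0 ≤ x) (hy : 0 ≤ y)
    (hW : ∀ a b : ℕ, ∑ i ∈ Finset.range a, ∑ j ∈ Finset.range b, (if P i j then x^i/i.factorial * (y^j/j.factorial) else 0) ≤ W) :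
    (((Finset.univ : Finset ((X → V) × (Y → V))).filter (fun p => ∀ v, P (fib p.1 v) (fib p.2 v))).card : ℝ) * (x^(Fintype.card X) * y^(Fintype.card Y))
      ≤ (Fintype.card X).factorial * (Fintype.card Y).factorial * W ^ (Fintype.card V) := by
  set a := Fintype.card X with ha
  set b := Fintype.card Y with hb
  have e1 : (((Finset.univ : Finset ((X → V) × (Y → V))).filter (fun p => ∀ v, P (fib p.1 v) (fib p.2 v))).card : ℝ) = 
      ∑ f : X → V, ∑ g : Y → V, ∏ v, (if P (fib f v) (fib g v) then (1:ℝ) else 0) := by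
    rw [← Finset.sum_boole, ← Finset.univ_product_univ, Finset.sum_product]
    apply Finset.sum_congr rfl; intro f _
    apply Finset.sum_congr rfl; intro g _
    rw [Finset.prod_boole]; simp
  have e2 : ∀ f : X → V, ∑ g : Y → V, ∏ v, (if P (fib f v) (fib g v) then (1:ℝ) else 0) = 
     ∑ e ∈ Finset.piAntidiag (Finset.univ : Finset V) b, 
       (b.factorial : ℝ) * ((∏ v, ((e v).factorial : ℝ)⁻¹) * ∏ v, (if P (fib f v) (e v) then (1:ℝ) else 0)) := 
    fun f => fib_sum_eq (X := Y) (fun e => ∏ v, (if P (fib f v) (e v) then (1:ℝ) else 0))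
  have e3 := fib_sum_eq (X := X) (fun d : V → ℕ => ∑ e ∈ Finset.piAntidiag (Finset.univ : Finset V) b, 
       (b.factorial : ℝ) * ((∏ v, ((e v).factorial : ℝ)⁻¹) * ∏ v, (if P (d v) (e v) then (1:ℝ) else 0)))
  rw [e1]
  simp only [e2]
  rw [e3, Finset.sum_mul]
  have hterm : ∀ d ∈ Finset.piAntidiag (Finset.univ : Finset V) a, 
    (a.factorial : ℝ) * ((∏ v, ((d v).factorial : ℝ)⁻¹) * ∑ e ∈ Finset.piAntidiag (Finset.univ : Finset V) b, 
       (b.factorial : ℝ) * ((∏ v, ((e v).factorial : ℝ)⁻¹) * ∏ v, (if P (d v) (e v) then (1:ℝ) else 0))) * (x^a * y^b)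
     = a.factorial * b.factorial * ∑ e ∈ Finset.piAntidiag (Finset.univ : Finset V) b, ∏ v, (if P (d v) (e v) then x^(d v)/(d v).factorial * (y^(e v)/(e v).factorial) else 0) := by
    intro d hd
    have hd' : ∑ v, d v = a := by simpa using hd
    rw [Finset.mul_sum, Finset.mul_sum, Finset.mul_sum, Finset.sum_mul]
    apply Finset.sum_congr rfl
    intro e he
    have he' : ∑ v, e v = b := by simpa using he
    rw [← hd', ← he', ← Finset.prod_pow_eq_pow_sum, ← Finset.prod_pow_eq_pow_sum]
    have : ∏ v, (if P (d v) (e v) then x^(d v)/(d v).factorial * (y^(e v)/(e v).factorial) else 0) =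
       (∏ v, ((d v).factorial : ℝ)⁻¹) * (∏ v, ((e v).factorial : ℝ)⁻¹) * (∏ v, (if P (d v) (e v) then (1:ℝ) else 0)) * ((∏ v, x^(d v)) * (∏ v, y^(e v))) := by
      rw [← Finset.prod_mul_distrib, ← Finset.prod_mul_distrib, ← Finset.prod_mul_distrib, ← Finset.prod_mul_distrib]
      apply Finset.prod_congr rfl
      intro v _
      split_ifs
      · field_simp
      · simp
    rw [this]; ring
  rw [Finset.sum_congr rfl hterm, ← Finset.mul_sum]
  apply mul_le_mul_of_nonneg_left _ (by positivity)
  have hsub : ∀ N : ℕ, Finset.piAntidiag (Finset.univ : Finset V) N ⊆ Fintype.piFinset (fun _ : V => Finset.range (N+1)) := by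
    intro N d hd
    have hd' : ∑ v, d v = N := by simpa using hd
    rw [Fintype.mem_piFinset]
    intro v
    have := Finset.single_le_sum (f := d) (fun i _ => Nat.zero_le _) (Finset.mem_univ v)
    simp; omega
  have hnn : ∀ i j : ℕ, 0 ≤ (if P i j then x^i/i.factorial * (y^j/j.factorial) else 0) := by
    intro i j; split_ifs <;> positivity
  calc _ ≤ ∑ d ∈ Fintype.piFinset (fun _ : V => Finset.range (a+1)), ∑ e ∈ Fintype.piFinset (fun _ : V => Finset.range (b+1)), ∏ v, (if P (d v) (e v) then x^(d v)/(d v).factorial * (y^(e v)/(e v).factorial) else 0) := by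
        refine (Finset.sum_le_sum_of_subset_of_nonneg (hsub a) ?_).trans ?_
        · intro d _ _
          exact Finset.sum_nonneg (fun e _ => Finset.prod_nonneg (fun v _ => hnn _ _))
        · apply Finset.sum_le_sum; intro d _
          refine Finset.sum_le_sum_of_subset_of_nonneg (hsub b) ?_
          intro e _ _
          exact Finset.prod_nonneg (fun v _ => hnn _ _)
    _ = ∑ d ∈ Fintype.piFinset (fun _ : V => Finset.range (a+1)), ∏ v, ∑ j ∈ Finset.range (b+1), (if P (d v) j then x^(d v)/(d v).factorial * (y^j/j.factorial) else 0) := by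
        apply Finset.sum_congr rfl; intro d _
        rw [Finset.prod_univ_sum]
    _ = ∏ v : V, ∑ i ∈ Finset.range (a+1), ∑ j ∈ Finset.range (b+1), (if P i j then x^i/i.factorial * (y^j/j.factorial) else 0) := by
        rw [Finset.prod_univ_sum]
    _ = (∑ i ∈ Finset.range (a+1), ∑ j ∈ Finset.range (b+1), (if P i j then x^i/i.factorial * (y^j/j.factorial) else 0))^(Fintype.card V) := by
        rw [Finset.prod_const, Finset.card_univ]
    _ ≤ _ := by
        apply pow_le_pow_left₀ _ (hW _ _)
        exact Finset.sum_nonneg (fun i _ => Finset.sum_nonneg (fun j _ => hnn i j))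


lemma card_inj_image (k n : ℕ) (s : Finset (Fin n)) (hs : s.card = k) :
    ((Finset.univ : Finset (Fin k → Fin n)).filter (fun g => Function.Injective g ∧ Finset.univ.image g = s)).card = k.factorial := by
  have hc : Fintype.card (Fin k) = Fintype.card s := by simp [hs]
  have h1 : Fintype.card (Fin k ≃ s) = k.factorial := by
    rw [Fintype.card_equiv (Fintype.equivOfCardEq hc)]; simp
  rw [← h1, ← Finset.card_univ]
  symm
  refine Finset.card_bij (fun e _ i => (e i).1) ?_ ?_ ?_
  · intro e _
    simp only [Finset.mem_filter, Finset.mem_univ, true_and]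
    refine ⟨fun a b hab => e.injective (Subtype.ext hab), ?_⟩
    ext v
    simp only [Finset.mem_image, Finset.mem_univ, true_and]
    constructor
    · rintro ⟨a, rfl⟩; exact (e a).2
    · intro hv; exact ⟨e.symm ⟨v, hv⟩, by simp⟩
  · intro e _ e' _ h
    ext i
    exact congrArg Fin.val (congrFun h i)
  · intro g hg
    simp only [Finset.mem_filter, Finset.mem_univ, true_and] at hg
    obtain ⟨hg1, hg2⟩ := hg
    have hmem : ∀ i, g i ∈ s := fun i => by rw [← hg2]; simp
    refine ⟨Equiv.ofBijective (fun i => (⟨g i, hmem i⟩ : s)) ?_, Finset.mem_univ _, ?_⟩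
    · rw [Fintype.bijective_iff_injective_and_card]
      exact ⟨fun a b hab => hg1 (congrArg Subtype.val hab), hc⟩
    · funext i; rfl

/-- ordered versions of a set of row systems -/
noncomputable def ordSys (k m n : ℕ) (S : Finset (Fin m → Finset (Fin n))) : Finset (Fin m → Fin k → Fin n) :=
  Finset.univ.filter (fun F => (∀ i, Function.Injective (F i)) ∧ (fun i => Finset.univ.image (F i)) ∈ S)

lemma ordSys_card (k m n : ℕ) (S : Finset (Fin m → Finset (Fin n))) (hS : ∀ r ∈ S, ∀ i, (r i).card = k) :
    (ordSys k m n S).card = k.factorial ^ m * S.card := by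
  rw [Finset.card_eq_sum_card_fiberwise (f := fun F i => Finset.univ.image (F i)) (t := S)]
  · rw [mul_comm, ← smul_eq_mul, ← Finset.sum_const]
    apply Finset.sum_congr rfl
    intro r hr
    have : (ordSys k m n S).filter (fun F => (fun i => Finset.univ.image (F i)) = r) = 
        Fintype.piFinset (fun i : Fin m => (Finset.univ : Finset (Fin k → Fin n)).filter (fun g => Function.Injective g ∧ Finset.univ.image g = r i)) := by
      ext F
      simp only [ordSys, Finset.mem_filter, Finset.mem_univ, true_and, Fintype.mem_piFinset]
      constructor
      · rintro ⟨⟨h1, h2⟩, h3⟩ i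
        exact ⟨h1 i, congrFun h3 i⟩
      · intro h
        have h3 : (fun i => Finset.univ.image (F i)) = r := funext (fun i => (h i).2)
        exact ⟨⟨fun i => (h i).1, by rw [h3]; exact hr⟩, h3⟩
    rw [this, Fintype.card_piFinset]
    rw [Finset.prod_congr rfl (fun i _ => card_inj_image k n (r i) (hS r hr i))]
    simp
  · intro F hF
    exact (Finset.mem_filter.mp hF).2.2

lemma fib_rows {κ : Type} [Fintype κ] (k n : ℕ) (G : κ → Fin k → Fin n) (hG : ∀ i, Function.Injective (G i)) (v : Fin n) :
    fib (fun p : κ × Fin k => G p.1 p.2) v = (Finset.univ.filter (fun i => v ∈ Finset.univ.image (G i))).card := by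
  unfold fib
  refine Finset.card_bij (fun p _ => p.1) ?_ ?_ ?_
  · intro p hp
    simp only [Finset.mem_filter, Finset.mem_univ, true_and, Finset.mem_image] at hp ⊢
    exact ⟨p.2, hp⟩
  · rintro ⟨i, a⟩ hp ⟨j, b⟩ hq h
    simp only [Finset.mem_filter, Finset.mem_univ, true_and] at hp hq h
    subst h
    rw [hG i (hp.trans hq.symm)]
  · intro i hi
    simp only [Finset.mem_filter, Finset.mem_univ, true_and, Finset.mem_image] at hi
    obtain ⟨a, ha⟩ := hi
    exact ⟨(i, a), by simpa using ha, rfl⟩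

lemma fib_rows_sub (k m n : ℕ) (F : Fin m → Fin k → Fin n) (hF : ∀ i, Function.Injective (F i)) (v : Fin n) (R : Finset (Fin m)) :
    fib (fun p : {i // i ∈ R} × Fin k => F p.1 p.2) v = (R.filter (fun i => v ∈ Finset.univ.image (F i))).card := by
  rw [fib_rows k n (fun i : {i // i ∈ R} => F i) (fun i => hF i)]
  refine Finset.card_bij (fun p _ => p.1) ?_ ?_ ?_
  · intro p hp
    simp only [Finset.mem_filter, Finset.mem_univ, true_and] at hp ⊢
    exact ⟨p.2, hp⟩
  · intro p _ q _ h; exact Subtype.ext h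
  · intro i hi
    simp only [Finset.mem_filter] at hi
    exact ⟨⟨i, hi.1⟩, by simpa using hi.2, rfl⟩

/-- The generating function for columns. -/
noncomputable def Fgen (x y : ℝ) : ℝ := Real.cosh x * Real.exp y - 1 - y

lemma partial_le_Fgen (x y : ℝ) (hx : 0 ≤ x) (hy : 0 ≤ y) (a b : ℕ) :
    ∑ i ∈ Finset.range a, ∑ j ∈ Finset.range b, (if (Even i ∧ 2 ≤ i + j) then x^i/i.factorial * (y^j/j.factorial) else 0) ≤ Fgen x y := by
  have hnn : ∀ i j : ℕ, 0 ≤ (if (Even i ∧ 2 ≤ i + j) then x^i/i.factorial * (y^j/j.factorial) else 0) := by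
    intro i j; split_ifs <;> positivity
  have h1 : ∑ i ∈ Finset.range a, ∑ j ∈ Finset.range b, (if (Even i ∧ 2 ≤ i + j) then x^i/i.factorial * (y^j/j.factorial) else 0)
     ≤ ∑ i ∈ Finset.range (a+1), ∑ j ∈ Finset.range (b+2), (if (Even i ∧ 2 ≤ i + j) then x^i/i.factorial * (y^j/j.factorial) else 0) := by
    refine (Finset.sum_le_sum_of_subset_of_nonneg (Finset.range_mono (Nat.le_succ a)) ?_).trans ?_
    · intro i _ _; exact Finset.sum_nonneg (fun j _ => hnn i j)
    · apply Finset.sum_le_sum; intro i _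
      exact Finset.sum_le_sum_of_subset_of_nonneg (Finset.range_mono (by omega)) (fun j _ _ => hnn i j)
  refine h1.trans ?_
  set E : ℕ → ℝ := fun i => if Even i then x^i/i.factorial else 0 with hE
  have hE0 : ∀ i, 0 ≤ E i := by intro i; simp only [hE]; split_ifs <;> positivity
  have h2 : ∑ i ∈ Finset.range (a+1), ∑ j ∈ Finset.range (b+2), (if (Even i ∧ 2 ≤ i + j) then x^i/i.factorial * (y^j/j.factorial) else 0) 
     = (∑ i ∈ Finset.range (a+1), E i) * (∑ j ∈ Finset.range (b+2), y^j/j.factorial) - 1 - y := by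
    have e1 : ∀ i ∈ Finset.range a, ∑ j ∈ Finset.range (b+2), (if (Even (i+1) ∧ 2 ≤ (i+1) + j) then x^(i+1)/(i+1).factorial * (y^j/j.factorial) else 0) = E (i+1) * (∑ j ∈ Finset.range (b+2), y^j/j.factorial) := by
      intro i _
      rw [Finset.mul_sum]
      apply Finset.sum_congr rfl; intro j _
      simp only [hE]
      by_cases he : Even (i+1)
      · have : 2 ≤ i + 1 + j := by
          rcases i with _ | i
          · simp at he
          · omega
        simp only [he, this, and_self, if_true]
      · simp only [he, false_and, if_false, zero_mul]
    rw [Finset.sum_range_succ', Finset.sum_congr rfl e1, ← Finset.sum_mul]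
    have e2 : ∑ j ∈ Finset.range (b+2), (if (Even 0 ∧ 2 ≤ 0 + j) then x^0/(0:ℕ).factorial * (y^j/j.factorial) else 0) = 
       ∑ j ∈ Finset.range (b+2), y^j/j.factorial - 1 - y := by
      rw [Finset.sum_range_succ', Finset.sum_range_succ', Finset.sum_range_succ', Finset.sum_range_succ']
      simp [Nat.factorial]
    rw [e2, Finset.sum_range_succ' E]
    simp only [hE]
    simp
    ring
  rw [h2, Fgen]
  have h3 : ∑ j ∈ Finset.range (b+2), y^j/j.factorial ≤ Real.exp y := Real.sum_le_exp_of_nonneg hy _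
  have h4 : ∑ i ∈ Finset.range (a+1), E i ≤ Real.cosh x := by
    have hs : HasSum E (Real.cosh x) := by
      have s1 := NormedSpace.expSeries_div_hasSum_exp (𝔸 := ℝ) x
      have s2 := NormedSpace.expSeries_div_hasSum_exp (𝔸 := ℝ) (-x)
      have s3 := (s1.add s2).div_const 2
      rw [← Real.exp_eq_exp_ℝ, ← Real.cosh_eq] at s3
      refine s3.congr_fun ?_
      intro i
      simp only [hE]
      split_ifs with he
      · rw [he.neg_pow]; ring
      · rw [(Nat.not_even_iff_odd.mp he).neg_pow]; ring
    exact sum_le_hasSum _ (fun i _ => hE0 i) hs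
  have : (∑ i ∈ Finset.range (a+1), E i) * (∑ j ∈ Finset.range (b+2), y^j/j.factorial) ≤ Real.cosh x * Real.exp y := by
    apply mul_le_mul h4 h3
    · exact Finset.sum_nonneg (fun j _ => by positivity)
    · exact (Real.cosh_pos x).le
  linarith

lemma fib_two_upper' {Z X Y V : Type} [Fintype X] [Fintype Y] [Fintype V] (A : Finset Z) (φ : Z → (X → V) × (Y → V)) (P : ℕ → ℕ → Prop) (x y W : ℝ) (hx : 0 ≤ x) (hy : 0 ≤ y)
    (hW : ∀ a b : ℕ, ∑ i ∈ Finset.range a, ∑ j ∈ Finset.range b, (if P i j then x^i/i.factorial * (y^j/j.factorial) else 0) ≤ W)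
    (hA : ∀ z ∈ A, ∀ v, P (fib (φ z).1 v) (fib (φ z).2 v)) (hφ : Function.Injective φ) :
    (A.card : ℝ) * (x^(Fintype.card X) * y^(Fintype.card Y))
      ≤ (Fintype.card X).factorial * (Fintype.card Y).factorial * W ^ (Fintype.card V) := by
  refine le_trans ?_ (fib_two_upper P x y W hx hy hW)
  apply mul_le_mul_of_nonneg_right _ (by positivity)
  rw [Nat.cast_le]
  refine Finset.card_le_card_of_injOn φ ?_ (hφ.injOn)
  intro z hz
  rw [Finset.mem_coe, Finset.mem_filter]
  exact ⟨Finset.mem_univ _, hA z hz⟩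

lemma mem_rowSys {m k n : ℕ} {V : Finset (Fin n)} {r : Fin m → Finset (Fin n)} : r ∈ rowSys (Fin m) k n V ↔
   (∀ i, (r i).card = k) ∧ ∀ v, v ∉ V → 2 ≤ (Finset.univ.filter (fun i => v ∈ r i)).card := by
  unfold rowSys; simp only [Finset.mem_filter, Finset.mem_univ, true_and]

lemma mem_critSys {m k n : ℕ} {R : Finset (Fin m)} {r : Fin m → Finset (Fin n)} : r ∈ critSys k m n R ↔
   r ∈ rowSys (Fin m) k n ∅ ∧ ∀ v, Even ((R.filter (fun i => v ∈ r i)).card) := by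
  unfold critSys; simp only [Finset.mem_filter]

lemma mem_ordSys {m k n : ℕ} {S : Finset (Fin m → Finset (Fin n))} {F : Fin m → Fin k → Fin n} : F ∈ ordSys k m n S ↔ 
   (∀ i, Function.Injective (F i)) ∧ (fun i => Finset.univ.image (F i)) ∈ S := by
  unfold ordSys; simp only [Finset.mem_filter, Finset.mem_univ, true_and]

lemma crit_upper (k m n : ℕ) (R : Finset (Fin m)) (x y : ℝ) (hx : 0 ≤ x) (hy : 0 ≤ y) :
    (k.factorial : ℝ)^m * ((critSys k m n R).card : ℝ) * (x^(k * R.card) * y^(k * (m - R.card))) ≤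
      (k*R.card).factorial * (k * (m - R.card)).factorial * (Fgen x y)^n := by
  have hS : ∀ r ∈ critSys k m n R, ∀ i, (r i).card = k := by
    intro r hr
    exact (mem_rowSys.mp (mem_critSys.mp hr).1).1
  have h0 := fib_two_upper' (X := {i // i ∈ R} × Fin k) (Y := {i // i ∈ Rᶜ} × Fin k) (V := Fin n) 
    (ordSys k m n (critSys k m n R)) (fun F => (fun p => F p.1 p.2, fun p => F p.1 p.2)) 
    (fun i j => Even i ∧ 2 ≤ i + j) x y (Fgen x y) hx hy (fun a b => by convert partial_le_Fgen x y hx hy a b) 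
    (by
      intro F hF v
      have hF' := mem_ordSys.mp hF
      have h1 := mem_critSys.mp hF'.2
      have h2 := (mem_rowSys.mp h1.1).2
      simp only
      rw [fib_rows_sub k m n F hF'.1 v R, fib_rows_sub k m n F hF'.1 v Rᶜ]
      refine ⟨h1.2 v, ?_⟩
      have h3 := h2 v (by simp)
      rw [← Finset.card_union_of_disjoint]
      · rw [← Finset.filter_union, Finset.union_compl]; exact h3
      · exact Finset.disjoint_filter_filter disjoint_compl_right)
    (by
      intro F G h
      simp only [Prod.mk.injEq] at h
      funext i j
      by_cases hi : i ∈ R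
      · exact congrFun h.1 (⟨i, hi⟩, j)
      · exact congrFun h.2 (⟨i, Finset.mem_compl.mpr hi⟩, j))
  have c1 : Fintype.card ({i // i ∈ R} × Fin k) = k * R.card := by
    rw [Fintype.card_prod, Fintype.card_coe]; simp [mul_comm]
  have c2 : Fintype.card ({i // i ∈ Rᶜ} × Fin k) = k * (m - R.card) := by
    rw [Fintype.card_prod, Fintype.card_coe, Finset.card_compl]; simp [mul_comm]
  rw [c1, c2, Fintype.card_fin] at h0
  have := ordSys_card k m n (critSys k m n R) hS
  rw [this] at h0
  push_cast at h0
  exact h0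


lemma fib_comp_perm {X V : Type} [Fintype X] (f : X → V) (σ : Equiv.Perm X) : fib (f ∘ σ) = fib f := by
  funext v
  unfold fib
  refine Finset.card_bij (fun x _ => σ x) ?_ ?_ ?_
  · intro x hx; simpa using hx
  · intro x _ y _ h; exact σ.injective h
  · intro y hy; exact ⟨σ.symm y, by simpa using hy, by simp⟩

/-- functions with all fibres of size in `[2,D]` -/
noncomputable def Gset (X : Type) [Fintype X] (n D : ℕ) : Finset (X → Fin n) :=
  Finset.univ.filter (fun f => ∀ v, 2 ≤ fib f v ∧ fib f v ≤ D)

lemma mem_Gset {X : Type} [Fintype X] {n D : ℕ} {f : X → Fin n} : f ∈ Gset X n D ↔ ∀ v, 2 ≤ fib f v ∧ fib f v ≤ D := by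
  unfold Gset; simp only [Finset.mem_filter, Finset.mem_univ, true_and]

lemma Gset_comp {X : Type} [Fintype X] {n D : ℕ} {f : X → Fin n} (σ : Equiv.Perm X) (h : f ∈ Gset X n D) : f ∘ σ ∈ Gset X n D := by
  rw [mem_Gset] at h ⊢; rw [fib_comp_perm]; exact h

/-- defects -/
noncomputable def Dset {m k n : ℕ} (f : Fin m × Fin k → Fin n) : Finset ((Fin m × Fin k) × (Fin m × Fin k)) :=
  Finset.univ.filter (fun p => p.1.1 = p.2.1 ∧ p.1 ≠ p.2 ∧ f p.1 = f p.2)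

lemma mem_Dset {m k n : ℕ} {f : Fin m × Fin k → Fin n} {p : (Fin m × Fin k) × (Fin m × Fin k)} : 
    p ∈ Dset f ↔ p.1.1 = p.2.1 ∧ p.1 ≠ p.2 ∧ f p.1 = f p.2 := by
  unfold Dset; simp only [Finset.mem_filter, Finset.mem_univ, true_and]

lemma switch_exists {m k n D : ℕ} (f : Fin m × Fin k → Fin n) (hf : f ∈ Gset _ n D) (hN : 2 * k * D < m * k)
    (hd : (Dset f).Nonempty) : ∃ P Q, (Dset (f ∘ Equiv.swap P Q)).card < (Dset f).card := by
  obtain ⟨⟨P, P'⟩, hP⟩ := hd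
  rw [mem_Dset] at hP
  simp only at hP
  rw [mem_Gset] at hf
  have hf' : ∀ v, (Finset.univ.filter (fun Q => f Q = v)).card ≤ D := fun v => by
    have := (hf v).2; unfold fib at this; convert this
  set B1 : Finset (Fin m × Fin k) := (Finset.univ : Finset (Fin k)).biUnion (fun a => Finset.univ.filter (fun Q => f Q = f (P.1, a)))
  set B2 : Finset (Fin m × Fin k) := (Finset.univ.filter (fun Q => f Q = f P)).biUnion (fun A => Finset.univ.image (fun b : Fin k => (A.1, b)))
  have h1 : B1.card ≤ k * D := by
    refine (Finset.card_biUnion_le).trans ?_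
    refine (Finset.sum_le_sum (fun a _ => hf' (f (P.1, a)))).trans ?_
    simp
  have h2 : B2.card ≤ k * D := by
    refine (Finset.card_biUnion_le).trans ?_
    have : ∀ A ∈ Finset.univ.filter (fun Q => f Q = f P), (Finset.univ.image (fun b : Fin k => (A.1, b))).card ≤ k := by
      intro A _
      refine Finset.card_image_le.trans ?_
      simp
    refine (Finset.sum_le_sum this).trans ?_
    rw [Finset.sum_const, smul_eq_mul, mul_comm]
    exact Nat.mul_le_mul_left _ (hf' (f P))
  have h3 : ∃ Q, Q ∉ B1 ∪ B2 := by
    by_contra hcon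
    push Not at hcon
    have : (Finset.univ : Finset (Fin m × Fin k)) ⊆ B1 ∪ B2 := fun x _ => hcon x
    have h4 := Finset.card_le_card this
    have h5 := Finset.card_union_le B1 B2
    simp at h4
    nlinarith
  obtain ⟨Q, hQ⟩ := h3
  rw [Finset.mem_union, not_or] at hQ
  have hQ1 : ∀ a, f Q ≠ f (P.1, a) := by
    intro a h
    apply hQ.1
    simp only [B1, Finset.mem_biUnion, Finset.mem_filter, Finset.mem_univ, true_and]
    exact ⟨a, h⟩
  have hQ2 : ∀ b, f (Q.1, b) ≠ f P := by
    intro b h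
    apply hQ.2
    simp only [B2, Finset.mem_biUnion, Finset.mem_filter, Finset.mem_univ, true_and, Finset.mem_image]
    exact ⟨(Q.1, b), h, Q.2, by simp⟩
  have hrow : P.1 ≠ Q.1 := by
    intro h; apply hQ1 Q.2; rw [h]
  refine ⟨P, Q, Finset.card_lt_card ?_⟩
  have hfP : (f ∘ Equiv.swap P Q) P = f Q := by simp
  have hfQ : (f ∘ Equiv.swap P Q) Q = f P := by simp
  have hfo : ∀ A, A ≠ P → A ≠ Q → (f ∘ Equiv.swap P Q) A = f A := by
    intro A h1 h2; simp [Equiv.swap_apply_of_ne_of_ne h1 h2]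
  have key : ∀ A B : Fin m × Fin k, A.1 = B.1 → A ≠ B → (f ∘ Equiv.swap P Q) A = (f ∘ Equiv.swap P Q) B → A ≠ P ∧ A ≠ Q := by
    intro A B g1 g2 g3
    constructor
    · intro hA
      subst hA
      have hBQ : B ≠ Q := by intro hB; subst hB; exact hrow g1
      rw [hfP, hfo B g2.symm hBQ] at g3
      apply hQ1 B.2; rw [g3, g1]
    · intro hA
      subst hA
      have hBP : B ≠ P := by intro hB; subst hB; exact hrow g1.symm
      rw [hfQ, hfo B hBP g2.symm] at g3
      apply hQ2 B.2; rw [g3, g1]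
  rw [Finset.ssubset_iff_of_subset]
  · refine ⟨(P, P'), mem_Dset.mpr hP, ?_⟩
    rw [mem_Dset]
    rintro ⟨h1, h2, h3⟩
    exact (key P P' h1 h2 h3).1 rfl
  · rintro ⟨A, B⟩ h
    rw [mem_Dset] at h ⊢
    obtain ⟨h1, h2, h3⟩ := h
    have k1 := key A B h1 h2 h3
    have k2 := key B A h1.symm h2.symm h3.symm
    refine ⟨h1, h2, ?_⟩
    simp only at h3 ⊢
    rw [hfo A k1.1 k1.2, hfo B k2.1 k2.2] at h3
    exact h3

lemma switch_card {m k n D : ℕ} (hN : 2 * k * D < m * k) (j : ℕ) :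
    ((Gset (Fin m × Fin k) n D).filter (fun f => (Dset f).card ≤ j)).card ≤ 
     (1 + (m*k)^2)^j * ((Gset (Fin m × Fin k) n D).filter (fun f => (Dset f).card = 0)).card := by
  induction j with
  | zero => simp
  | succ j ih =>
    set A := (Gset (Fin m × Fin k) n D).filter (fun f => (Dset f).card ≤ j)
    set B := (Gset (Fin m × Fin k) n D).filter (fun f => (Dset f).card = j + 1)
    have hsub : (Gset (Fin m × Fin k) n D).filter (fun f => (Dset f).card ≤ j+1) ⊆ A ∪ B := by
      intro f hf
      simp only [A, B, Finset.mem_union, Finset.mem_filter] at hf ⊢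
      rcases Nat.lt_or_ge (Dset f).card (j+1) with h | h
      · left; exact ⟨hf.1, by omega⟩
      · right; exact ⟨hf.1, by omega⟩
    have hex : ∀ f, f ∈ B → ∃ PQ : (Fin m × Fin k) × (Fin m × Fin k), (Dset (f ∘ Equiv.swap PQ.1 PQ.2)).card < (Dset f).card := by
      intro f hf
      simp only [B, Finset.mem_filter] at hf
      obtain ⟨P, Q, h⟩ := switch_exists f hf.1 hN (Finset.card_pos.mp (by omega))
      exact ⟨(P, Q), h⟩
    have : Nonempty (Fin m × Fin k) := by
      have h0 : 0 < m * k := by omega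
      exact ⟨⟨⟨0, Nat.pos_of_mul_pos_right h0⟩, ⟨0, Nat.pos_of_mul_pos_left h0⟩⟩⟩
    choose! c hc using hex
    have hB : B.card ≤ (A ×ˢ (Finset.univ : Finset ((Fin m × Fin k) × (Fin m × Fin k)))).card := by
      refine Finset.card_le_card_of_injOn (fun f => (f ∘ Equiv.swap (c f).1 (c f).2, c f)) ?_ ?_
      · intro f hf
        have h1 := hc f hf
        have hf' := hf
        simp only [B, Finset.coe_filter, Set.mem_ofPred_eq] at hf'
        rw [Finset.mem_coe, Finset.mem_product]
        refine ⟨?_, Finset.mem_univ _⟩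
        simp only [A, Finset.mem_filter]
        exact ⟨Gset_comp _ hf'.1, by omega⟩
      · intro f _ g _ h
        simp only [Prod.mk.injEq] at h
        have h1 := h.1
        rw [h.2] at h1
        funext x
        have := congrFun h1 (Equiv.swap (c g).1 (c g).2 x)
        simpa using this
    have hcard : (A ×ˢ (Finset.univ : Finset ((Fin m × Fin k) × (Fin m × Fin k)))).card = A.card * (m*k)^2 := by
      rw [Finset.card_product, Finset.card_univ]
      simp [Fintype.card_prod, sq]
    calc _ ≤ (A ∪ B).card := Finset.card_le_card hsub
      _ ≤ A.card + B.card := Finset.card_union_le _ _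
      _ ≤ A.card + A.card * (m*k)^2 := by rw [hcard] at hB; omega
      _ = (1 + (m*k)^2) * A.card := by ring
      _ ≤ (1 + (m*k)^2) * ((1 + (m*k)^2)^j * _) := Nat.mul_le_mul_left _ ih
      _ = _ := by ring

lemma perm_pair {X : Type} (P Q P' Q' : X) (h : P ≠ Q) (h' : P' ≠ Q') : ∃ σ : Equiv.Perm X, σ P = P' ∧ σ Q = Q' := by
  refine ⟨(Equiv.swap P P').trans (Equiv.swap (Equiv.swap P P' Q) Q'), ?_, ?_⟩
  · simp only [Equiv.trans_apply, Equiv.swap_apply_left]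
    apply Equiv.swap_apply_of_ne_of_ne _ h'
    intro h2
    have : Equiv.swap P P' P = Equiv.swap P P' Q := by rw [Equiv.swap_apply_left]; exact h2
    exact h ((Equiv.swap P P').injective this)
  · simp

lemma pair_sym {X : Type} [Fintype X] {n D : ℕ} (P Q P' Q' : X) (h : P ≠ Q) (h' : P' ≠ Q') :
    ((Gset X n D).filter (fun f => f P' = f Q')).card ≤ ((Gset X n D).filter (fun f => f P = f Q)).card := by
  obtain ⟨σ, h1, h2⟩ := perm_pair P Q P' Q' h h'
  refine Finset.card_le_card_of_injOn (fun f => f ∘ σ) ?_ ?_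
  · intro f hf
    simp only [Finset.coe_filter, Set.mem_ofPred_eq] at hf ⊢
    exact ⟨Gset_comp σ hf.1, by simp [h1, h2, hf.2]⟩
  · intro f _ g _ h
    funext x
    have := congrFun h (σ.symm x)
    simpa using this

lemma total_pairs {X : Type} [Fintype X] {n D : ℕ} :
    ∑ p ∈ (Finset.univ : Finset X).offDiag, ((Gset X n D).filter (fun f => f p.1 = f p.2)).card ≤ (Gset X n D).card * (Fintype.card X * D) := by
  have : ∑ p ∈ (Finset.univ : Finset X).offDiag, ((Gset X n D).filter (fun f => f p.1 = f p.2)).card = 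
     ∑ f ∈ Gset X n D, (((Finset.univ : Finset X).offDiag).filter (fun p => f p.1 = f p.2)).card := by
    simp only [Finset.card_filter]
    exact Finset.sum_comm
  rw [this, ← smul_eq_mul, ← Finset.sum_const]
  apply Finset.sum_le_sum
  intro f hf
  rw [mem_Gset] at hf
  have hf' : ∀ v, (Finset.univ.filter (fun Q => f Q = v)).card ≤ D := fun v => by
    have := (hf v).2; unfold fib at this; convert this
  have hsub : ((Finset.univ : Finset X).offDiag).filter (fun p => f p.1 = f p.2) ⊆ 
     (Finset.univ : Finset X).biUnion (fun x => (Finset.univ.filter (fun y => f y = f x)).image (fun y => (x, y))) := by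
    rintro ⟨x, y⟩ h
    simp only [Finset.mem_filter] at h
    simp only [Finset.mem_biUnion, Finset.mem_univ, true_and, Finset.mem_image, Finset.mem_filter]
    exact ⟨x, y, h.2.symm, rfl⟩
  refine (Finset.card_le_card hsub).trans (Finset.card_biUnion_le.trans ?_)
  have : ∀ x ∈ (Finset.univ : Finset X), ((Finset.univ.filter (fun y => f y = f x)).image (fun y => (x, y))).card ≤ D := by
    intro x _
    exact Finset.card_image_le.trans (hf' (f x))
  refine (Finset.sum_le_sum this).trans ?_
  simp

lemma avg_def {m k n D : ℕ} (hN : 2 ≤ m * k) :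
    ∑ f ∈ Gset (Fin m × Fin k) n D, (Dset f).card ≤ (Gset (Fin m × Fin k) n D).card * (2 * k * D) := by
  set X := Fin m × Fin k
  have e1 : ∑ f ∈ Gset X n D, (Dset f).card = ∑ p ∈ (Finset.univ : Finset (X × X)).filter (fun p => p.1.1 = p.2.1 ∧ p.1 ≠ p.2), ((Gset X n D).filter (fun f => f p.1 = f p.2)).card := by
    have : ∀ f : X → Fin n, Dset f = ((Finset.univ : Finset (X × X)).filter (fun p => p.1.1 = p.2.1 ∧ p.1 ≠ p.2)).filter (fun p => f p.1 = f p.2) := by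
      intro f; ext p
      rw [mem_Dset]
      simp only [Finset.mem_filter, Finset.mem_univ, true_and, and_assoc]
    simp only [this]
    rw [Finset.sum_congr rfl (fun f _ => Finset.card_filter _ _)]
    rw [Finset.sum_comm]
    apply Finset.sum_congr rfl
    intro p _
    rw [Finset.card_filter]
  have hXcard : Fintype.card X = m * k := by simp [X]
  -- a common value s
  obtain ⟨P0, Q0, h0⟩ : ∃ P Q : X, P ≠ Q := by
    have : 1 < Fintype.card X := by omega
    exact Fintype.exists_pair_of_one_lt_card this
  set s := ((Gset X n D).filter (fun f => f P0 = f Q0)).card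
  have hs : (m*k) * (m*k - 1) * s ≤ (Gset X n D).card * (m*k*D) := by
    have h1 := total_pairs (X := X) (n := n) (D := D)
    rw [hXcard] at h1
    refine le_trans ?_ h1
    have h2 : ∑ p ∈ (Finset.univ : Finset X).offDiag, s ≤ ∑ p ∈ (Finset.univ : Finset X).offDiag, ((Gset X n D).filter (fun f => f p.1 = f p.2)).card := by
      apply Finset.sum_le_sum
      intro p hp
      exact pair_sym p.1 p.2 P0 Q0 (by simpa using hp) h0
    refine le_trans (le_of_eq ?_) h2
    rw [Finset.sum_const, Finset.offDiag_card, Finset.card_univ, hXcard, smul_eq_mul, Nat.mul_sub, mul_one]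
  have hrow : ((Finset.univ : Finset (X × X)).filter (fun p => p.1.1 = p.2.1 ∧ p.1 ≠ p.2)).card ≤ m * k * k := by
    have : ((Finset.univ : Finset (X × X)).filter (fun p => p.1.1 = p.2.1 ∧ p.1 ≠ p.2)).card ≤ (Finset.univ : Finset (X × Fin k)).card := by
      refine Finset.card_le_card_of_injOn (fun p => (p.1, p.2.2)) (fun _ _ => Finset.mem_coe.mpr (Finset.mem_univ _)) ?_
      rintro ⟨⟨a, b⟩, ⟨c, d⟩⟩ h1 ⟨⟨a', b'⟩, ⟨c', d'⟩⟩ h2 h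
      simp only [Finset.coe_filter, Set.mem_ofPred_eq, Finset.mem_univ, true_and, Prod.mk.injEq] at h1 h2 h ⊢
      have h3 : a = a' := congrArg Prod.fst h.1
      have e1 := h1.1
      have e2 := h2.1
      have h4 : b = b' := congrArg Prod.snd h.1
      have h5 : d = d' := h.2
      have h6 : c = c' := e1.symm.trans (h3.trans e2)
      subst h3; subst h4; subst h5; subst h6; exact ⟨rfl, rfl⟩
    refine this.trans (le_of_eq ?_)
    rw [Finset.card_univ, Fintype.card_prod, hXcard]; simp
  have e2 : ∑ f ∈ Gset X n D, (Dset f).card ≤ m * k * k * s := by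
    rw [e1]
    calc _ ≤ ∑ p ∈ (Finset.univ : Finset (X × X)).filter (fun p => p.1.1 = p.2.1 ∧ p.1 ≠ p.2), s := by
          apply Finset.sum_le_sum
          intro p hp
          exact pair_sym P0 Q0 p.1 p.2 h0 (Finset.mem_filter.mp hp).2.2
      _ ≤ m * k * k * s := by
          rw [Finset.sum_const, smul_eq_mul]
          exact Nat.mul_le_mul_right _ hrow
  have h3 : (m*k - 1) * s ≤ (Gset X n D).card * D := by
    have hpos : 0 < m * k := by omega
    apply Nat.le_of_mul_le_mul_left _ hpos
    calc _ = m*k*(m*k-1)*s := by ring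
      _ ≤ _ := hs
      _ = _ := by ring
  have h4 : m * k * s ≤ 2 * ((m*k-1)*s) := by
    have : m * k ≤ 2 * (m*k-1) := by omega
    calc _ ≤ 2 * (m*k-1) * s := Nat.mul_le_mul_right _ this
      _ = _ := by ring
  calc _ ≤ m * k * k * s := e2
    _ = k * (m * k * s) := by ring
    _ ≤ k * (2 * ((Gset X n D).card * D)) := by
        apply Nat.mul_le_mul_left; omega
    _ = _ := by ring

lemma Gset_le {m k n D : ℕ} (hN : 2 * k * D < m * k) (hN2 : 2 ≤ m * k) :
    (Gset (Fin m × Fin k) n D).card ≤ 2 * (1 + (m*k)^2)^(4*k*D) * (k.factorial^m * (rowSys (Fin m) k n ∅).card) := by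
  set G := Gset (Fin m × Fin k) n D
  have h1 := avg_def (n := n) (D := D) hN2
  have h2 := switch_card (n := n) (D := D) hN (4*k*D)
  have h3 : (G.filter (fun f => (Dset f).card = 0)).card ≤ k.factorial^m * (rowSys (Fin m) k n ∅).card := by
    rw [← ordSys_card k m n (rowSys (Fin m) k n ∅) (fun r hr => (mem_rowSys.mp hr).1)]
    refine Finset.card_le_card_of_injOn (fun f i a => f (i, a)) ?_ ?_
    · intro f hf
      simp only [Finset.coe_filter, Set.mem_ofPred_eq] at hf
      obtain ⟨hf1, hf2⟩ := hf
      have hinj : ∀ i, Function.Injective (fun a => f (i, a)) := by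
        intro i a b hab
        by_contra hne
        have : ((i, a), (i, b)) ∈ Dset f := by
          rw [mem_Dset]; exact ⟨rfl, by simpa using hne, hab⟩
        rw [Finset.card_eq_zero] at hf2
        rw [hf2] at this; simp at this
      rw [Finset.mem_coe, mem_ordSys]
      refine ⟨hinj, ?_⟩
      rw [mem_rowSys]
      refine ⟨?_, ?_⟩
      · intro i
        rw [Finset.card_image_of_injective _ (hinj i)]; simp
      · intro v _
        have := fib_rows k n (fun i a => f (i, a)) hinj v
        rw [← this]
        exact ((mem_Gset.mp hf1) v).1
    · intro f _ g _ h
      funext ⟨i, a⟩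
      exact congrFun (congrFun h i) a
  have h4 : G.card ≤ 2 * (G.filter (fun f => (Dset f).card ≤ 4*k*D)).card := by
    have hsplit := Finset.card_filter_add_card_filter_not (s := G) (fun f => (Dset f).card ≤ 4*k*D)
    have hlow : (G.filter (fun f => ¬ (Dset f).card ≤ 4*k*D)).card * (4*k*D+1) ≤ ∑ f ∈ G, (Dset f).card := by
      rw [← smul_eq_mul, ← Finset.sum_const]
      refine le_trans (Finset.sum_le_sum ?_) (Finset.sum_le_sum_of_subset (Finset.filter_subset (fun f => ¬ (Dset f).card ≤ 4*k*D) G))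
      intro f hf
      have := (Finset.mem_filter.mp hf).2
      omega
    by_contra hcon
    push Not at hcon
    set p := (G.filter (fun f => (Dset f).card ≤ 4*k*D)).card
    set q := (G.filter (fun f => ¬ (Dset f).card ≤ 4*k*D)).card
    have h5 : q * (4*k*D+1) ≤ (p+q) * (2*k*D) := by rw [hsplit]; exact hlow.trans h1
    have h6 : p < q := by omega
    nlinarith [Nat.zero_le (k*D)]
  calc G.card ≤ 2 * (G.filter (fun f => (Dset f).card ≤ 4*k*D)).card := h4
    _ ≤ 2 * ((1 + (m*k)^2)^(4*k*D) * (k.factorial^m * (rowSys (Fin m) k n ∅).card)) := by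
        apply Nat.mul_le_mul_left
        exact h2.trans (Nat.mul_le_mul_left _ h3)
    _ = _ := by ring


noncomputable def aco (n D N : ℕ) : ℝ :=
  ∑ d ∈ (Finset.piAntidiag (Finset.univ : Finset (Fin n)) N).filter (fun d => ∀ v, d v ∈ Finset.Icc 2 D), ∏ v, ((d v).factorial : ℝ)⁻¹

noncomputable def pD (D : ℕ) (z : ℝ) : ℝ := ∑ j ∈ Finset.Icc 2 D, z^j / j.factorial

lemma aco_nonneg (n D N : ℕ) : 0 ≤ aco n D N := Finset.sum_nonneg (fun d _ => Finset.prod_nonneg (fun v _ => by positivity))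

lemma Gset_card (X : Type) [Fintype X] (n D : ℕ) : ((Gset X n D).card : ℝ) = (Fintype.card X).factorial * aco n D (Fintype.card X) := by
  have h := fib_sum_eq (X := X) (V := Fin n) (fun d => if ∀ v, d v ∈ Finset.Icc 2 D then (1:ℝ) else 0)
  have e : ((Gset X n D).card : ℝ) = ∑ f : X → Fin n, (if ∀ v, fib f v ∈ Finset.Icc 2 D then (1:ℝ) else 0) := by
    rw [Finset.sum_boole]
    congr 2
    ext f
    rw [mem_Gset]
    simp only [Finset.mem_filter, Finset.mem_univ, true_and, Finset.mem_Icc]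
  rw [e, h, aco, ← Finset.mul_sum, Finset.sum_filter]
  congr 1
  refine Finset.sum_congr (by ext d; simp only [Finset.mem_piAntidiag]) ?_
  intro d _
  split_ifs <;> simp

lemma aco_sum (n D : ℕ) (z : ℝ) : ∑ N ∈ Finset.range (n*D+1), aco n D N * z^N = (pD D z)^n := by
  have e1 : (pD D z)^n = ∑ d ∈ Fintype.piFinset (fun _ : Fin n => Finset.Icc 2 D), ∏ v, z^(d v)/(d v).factorial := by
    have := Finset.prod_univ_sum (fun _ : Fin n => Finset.Icc 2 D) (fun _ j => z^j/(j.factorial:ℝ))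
    rw [← this]
    simp [pD]
  rw [e1]
  rw [← Finset.sum_fiberwise_of_maps_to (t := Finset.range (n*D+1)) (g := fun d : Fin n → ℕ => ∑ v, d v)]
  · apply Finset.sum_congr rfl
    intro N _
    rw [aco, Finset.sum_mul]
    apply Finset.sum_congr
    · ext d
      simp only [Finset.mem_filter, Fintype.mem_piFinset, Finset.mem_piAntidiag, Finset.mem_univ, implies_true, and_true]
      tauto
    · intro d hd
      have hd' : ∑ v, d v = N := (Finset.mem_filter.mp hd).2
      rw [← hd', ← Finset.prod_pow_eq_pow_sum, ← Finset.prod_mul_distrib]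
      apply Finset.prod_congr rfl
      intro v _; field_simp
  · intro d hd
    rw [Fintype.mem_piFinset] at hd
    have : ∑ v, d v ≤ ∑ v : Fin n, D := Finset.sum_le_sum (fun v _ => (Finset.mem_Icc.mp (hd v)).2)
    simp at this
    simp only [Finset.mem_range]; omega

lemma aco_le (n D N : ℕ) (z : ℝ) (hz : 0 ≤ z) : aco n D N * z^N ≤ (pD D z)^n := by
  rw [← aco_sum]
  by_cases h : N < n*D+1
  · exact Finset.single_le_sum (f := fun N => aco n D N * z^N) (fun N _ => mul_nonneg (aco_nonneg _ _ _) (by positivity)) (Finset.mem_range.mpr h)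
  · have : aco n D N = 0 := by
      rw [aco, Finset.sum_eq_zero]
      intro d hd
      exfalso
      rw [Finset.mem_filter] at hd
      have h1 : ∑ v, d v = N := by simpa using hd.1
      have : ∑ v, d v ≤ ∑ v : Fin n, D := Finset.sum_le_sum (fun v _ => (Finset.mem_Icc.mp (hd.2 v)).2)
      simp at this
      omega
    rw [this, zero_mul]
    exact Finset.sum_nonneg (fun N _ => mul_nonneg (aco_nonneg _ _ _) (by positivity))

lemma aco_max (n D : ℕ) (z : ℝ) : ∃ N ≤ n*D, (pD D z)^n ≤ (n*D+1) * (aco n D N * z^N) := by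
  by_contra hcon
  push Not at hcon
  have h1 : ∑ N ∈ Finset.range (n*D+1), ((n*D+1) * (aco n D N * z^N)) < ∑ N ∈ Finset.range (n*D+1), (pD D z)^n := by
    apply Finset.sum_lt_sum_of_nonempty (by simp)
    intro N hN
    apply hcon
    simp at hN; omega
  rw [← Finset.mul_sum, aco_sum, Finset.sum_const, nsmul_eq_mul, Finset.card_range] at h1
  push_cast at h1
  exact lt_irrefl _ h1

lemma fib_snoc {N n : ℕ} (f : Fin N → Fin n) (w v : Fin n) : fib (Fin.snoc f w : Fin (N+1) → Fin n) v = fib f v + if w = v then 1 else 0 := by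
  unfold fib
  rw [Finset.card_filter, Finset.card_filter, Fin.sum_univ_castSucc]
  simp only [Fin.snoc_castSucc, Fin.snoc_last]
  congr!

lemma aco_succ (n D N : ℕ) (h : 2 * N ≤ n * D) (hD : 0 < D) : n * aco n D N ≤ 2 * (N+1) * aco n D (N+1) := by
  have hG := Gset_card (Fin N) n D
  have hG' := Gset_card (Fin (N+1)) n D
  simp only [Fintype.card_fin] at hG hG'
  have key : n * (Gset (Fin N) n D).card ≤ 2 * (Gset (Fin (N+1)) n D).card := by
    -- pairs
    set S : Finset ((Fin N → Fin n) × Fin n) := ((Gset (Fin N) n D) ×ˢ Finset.univ).filter (fun p => fib p.1 p.2 < D)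
    have h1 : S.card ≤ (Gset (Fin (N+1)) n D).card := by
      refine Finset.card_le_card_of_injOn (fun p => (Fin.snoc p.1 p.2 : Fin (N+1) → Fin n)) ?_ ?_
      · intro p hp
        rw [Finset.mem_coe, Finset.mem_filter, Finset.mem_product] at hp
        rw [Finset.mem_coe, mem_Gset]
        intro v
        have := (mem_Gset.mp hp.1.1) v
        rw [fib_snoc]
        split_ifs with hw
        · subst hw; have := hp.2; omega
        · omega
      · rintro ⟨f, w⟩ _ ⟨g, w'⟩ _ h
        simp only at h
        have := Fin.snoc_injective2 h
        exact Prod.ext this.1 this.2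
    have h2 : n * (Gset (Fin N) n D).card ≤ 2 * S.card := by
      have e : S.card = ∑ f ∈ Gset (Fin N) n D, (Finset.univ.filter (fun w => fib f w < D)).card := by
        rw [Finset.card_filter, Finset.sum_product]
        apply Finset.sum_congr rfl
        intro f _
        rw [Finset.card_filter]
      rw [e, Finset.mul_sum, mul_comm, ← smul_eq_mul, ← Finset.sum_const]
      apply Finset.sum_le_sum
      intro f hf
      have e2 := Finset.card_filter_add_card_filter_not (s := (Finset.univ : Finset (Fin n))) (fun w => fib f w < D)
      have e3 : (Finset.univ.filter (fun w => ¬ fib f w < D)).card * D ≤ N := by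
        have := fib_sum f
        rw [Fintype.card_fin] at this
        refine le_trans ?_ this.le
        rw [← smul_eq_mul, ← Finset.sum_const]
        refine le_trans (Finset.sum_le_sum ?_) (Finset.sum_le_sum_of_subset (Finset.filter_subset (fun w => ¬ fib f w < D) Finset.univ))
        intro w hw
        have := (Finset.mem_filter.mp hw).2
        omega
      simp only [Finset.card_univ, Fintype.card_fin] at e2
      set a := (Finset.univ.filter (fun w => fib f w < D)).card
      set b := (Finset.univ.filter (fun w => ¬ fib f w < D)).card
      by_contra hcon
      push Not at hcon
      have : (a + b) * D < 2 * b * D := by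
        apply Nat.mul_lt_mul_of_pos_right _ hD
        omega
      rw [e2] at this
      nlinarith
    omega
  have key' : (n:ℝ) * (Gset (Fin N) n D).card ≤ 2 * (Gset (Fin (N+1)) n D).card := by exact_mod_cast key
  rw [hG, hG', Nat.factorial_succ] at key'
  push_cast at key'
  have hf : (0:ℝ) < N.factorial := by exact_mod_cast Nat.factorial_pos N
  refine le_of_mul_le_mul_left ?_ hf
  linarith


noncomputable def phi (z : ℝ) : ℝ := Real.exp z - 1 - z

lemma phi_pos {z : ℝ} (hz : z ≠ 0) : 0 < phi z := by
  have := Real.add_one_lt_exp hz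
  unfold phi; linarith

lemma phi_hasDeriv (z : ℝ) : HasDerivAt phi (Real.exp z - 1) z := by
  unfold phi
  exact ((Real.hasDerivAt_exp z).sub_const 1).sub (hasDerivAt_id z)

lemma phi_continuous : Continuous phi := by unfold phi; fun_prop

noncomputable def Dfun (z : ℝ) : ℝ := z * (Real.exp z - 1) / phi z

lemma exp_sq_gt {z : ℝ} (hz : 0 < z) : z^2 * Real.exp z < (Real.exp z - 1)^2 := by
  have h1 : z/2 < Real.sinh (z/2) := Real.self_lt_sinh_iff.mpr (by linarith)
  rw [Real.sinh_eq] at h1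
  have h2 : Real.exp z = Real.exp (z/2) * Real.exp (z/2) := by rw [← Real.exp_add]; congr 1; ring
  have h3 : Real.exp (z/2) * Real.exp (-(z/2)) = 1 := by rw [← Real.exp_add]; simp
  have h4 : 0 < Real.exp (z/2) := Real.exp_pos _
  have h5 : z * Real.exp (z/2) < Real.exp z - 1 := by
    rw [h2]; nlinarith
  have h6 : 0 < z * Real.exp (z/2) := by positivity
  calc z^2 * Real.exp z = (z * Real.exp (z/2))^2 := by rw [h2]; ring
    _ < _ := by apply pow_lt_pow_left₀ h5 h6.le; norm_num

lemma Dfun_hasDeriv {z : ℝ} (hz : 0 < z) : HasDerivAt Dfun (((Real.exp z - 1)^2 - z^2 * Real.exp z) / (phi z)^2) z := by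
  have hp := phi_pos hz.ne'
  have h1 : HasDerivAt (fun z => z * (Real.exp z - 1)) (1 * (Real.exp z - 1) + z * Real.exp z) z :=
    (hasDerivAt_id z).mul ((Real.hasDerivAt_exp z).sub_const 1)
  have h2 := h1.div (phi_hasDeriv z) hp.ne'
  refine h2.congr_deriv ?_
  unfold phi
  ring

lemma Dfun_cont : ContinuousOn Dfun (Set.Ioi 0) := fun z hz => (Dfun_hasDeriv hz).continuousAt.continuousWithinAt

lemma Dfun_strictMono : StrictMonoOn Dfun (Set.Ioi 0) := by
  apply strictMonoOn_of_deriv_pos (convex_Ioi 0) Dfun_cont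
  intro z hz
  rw [interior_Ioi] at hz
  rw [(Dfun_hasDeriv hz).deriv]
  have := exp_sq_gt hz
  have := phi_pos (ne_of_gt (Set.mem_Ioi.mp hz))
  apply div_pos (by linarith) (by positivity)

lemma Dfun_eq {z : ℝ} (hz : 0 < z) : Dfun z = z + z^2 / phi z := by
  have hp := phi_pos hz.ne'
  unfold Dfun
  field_simp
  unfold phi; ring

lemma phi_ge {z : ℝ} (hz : 0 ≤ z) : z^2/2 ≤ phi z := by
  have := Real.quadratic_le_exp_of_nonneg hz
  unfold phi; linarith

lemma exists_lambda (d : ℝ) (hd : 2 < d) : ∃ l : ℝ, 0 < l ∧ Dfun l = d := by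
  have hz0 : 0 < (d-2)/2 := by linarith
  have h1 : Dfun ((d-2)/2) ≤ d := by
    rw [Dfun_eq hz0]
    have := phi_ge hz0.le
    have h2 : ((d-2)/2)^2 / phi ((d-2)/2) ≤ 2 := by
      rw [div_le_iff₀ (phi_pos hz0.ne')]; linarith
    linarith
  have h2 : d ≤ Dfun d := by
    rw [Dfun_eq (by linarith)]
    have : 0 ≤ d^2/phi d := div_nonneg (by positivity) (phi_pos (by linarith)).le
    linarith
  have hc : ContinuousOn Dfun (Set.Icc ((d-2)/2) d) := Dfun_cont.mono (fun x hx => lt_of_lt_of_le hz0 hx.1)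
  obtain ⟨l, hl, hl2⟩ := intermediate_value_Icc (by linarith : (d-2)/2 ≤ d) hc ⟨h1, h2⟩
  exact ⟨l, lt_of_lt_of_le hz0 hl.1, hl2⟩

lemma phi_slope {u w : ℝ} (hu : 0 < u) (huw : u < w) : ∃ ξ ∈ Set.Ioo u w, 
    Real.log (phi w) - Real.log (phi u) = Dfun ξ * (Real.log w - Real.log u) := by
  have hd1 : ∀ x, 0 < x → HasDerivAt (fun z => Real.log (phi z)) ((Real.exp x - 1)/phi x) x := 
    fun x hx => (phi_hasDeriv x).log (phi_pos hx.ne').ne'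
  have hd2 : ∀ x : ℝ, 0 < x → HasDerivAt (fun z => Real.log z) (1/x) x := fun x hx => by
    simpa using Real.hasDerivAt_log hx.ne'
  obtain ⟨ξ, hξ, h⟩ := exists_ratio_hasDerivAt_eq_ratio_slope (fun z => Real.log (phi z)) (fun x => (Real.exp x - 1)/phi x) huw 
    (fun x hx => (hd1 x (lt_of_lt_of_le hu hx.1)).continuousAt.continuousWithinAt)
    (fun x hx => hd1 x (hu.trans hx.1)) (fun z => Real.log z) (fun x => 1/x)
    (fun x hx => (hd2 x (lt_of_lt_of_le hu hx.1)).continuousAt.continuousWithinAt)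
    (fun x hx => hd2 x (hu.trans hx.1))
  refine ⟨ξ, hξ, ?_⟩
  have hξ0 : 0 < ξ := hu.trans hξ.1
  have hp := phi_pos hξ0.ne'
  unfold Dfun
  field_simp at h ⊢
  linarith

lemma pD_tendsto (z : ℝ) : Filter.Tendsto (fun D => pD D z) Filter.atTop (nhds (phi z)) := by
  have h1 := (NormedSpace.expSeries_div_hasSum_exp (𝔸 := ℝ) z).tendsto_sum_nat
  rw [← Real.exp_eq_exp_ℝ] at h1
  have h2 := (h1.comp (Filter.tendsto_add_atTop_nat 1)).sub_const (1+z)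
  have e : Real.exp z - (1+z) = phi z := by unfold phi; ring
  rw [e] at h2
  refine h2.congr' ?_
  filter_upwards [Filter.eventually_ge_atTop 1] with D hD
  unfold pD
  simp only [Function.comp]
  have : Finset.Icc 2 D = Finset.Ico 2 (D+1) := by ext x; simp only [Finset.mem_Icc, Finset.mem_Ico]; omega
  rw [this, Finset.sum_Ico_eq_sub _ (by omega : 2 ≤ D+1)]
  simp [Finset.sum_range_succ]

lemma aco_transfer (n D N s : ℕ) (q : ℝ) (hq : 0 ≤ q) (hD : 0 < D) (hn : 0 < n) (hND : 2 * N ≤ n * D) (hN : 2 * (N:ℝ) ≤ q * n) (hs : s ≤ N) :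
    aco n D s ≤ q^(N-s) * aco n D N := by
  have key : ∀ j, s + j ≤ N → aco n D s ≤ q^j * aco n D (s+j) := by
    intro j
    induction j with
    | zero => intro _; simp
    | succ j ih =>
      intro hj
      have h1 := ih (by omega)
      have h2 := aco_succ n D (s+j) (by nlinarith) hD
      have hn' : (0:ℝ) < n := by exact_mod_cast hn
      have h3 : (2:ℝ) * ((s+j : ℕ)+1) ≤ q * n := by
        refine le_trans ?_ hN
        have : ((s+j+1:ℕ):ℝ) ≤ N := by exact_mod_cast hj
        push_cast at this ⊢; linarith
      have h4 : aco n D (s+j) ≤ q * aco n D (s+j+1) := by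
        refine le_of_mul_le_mul_left ?_ hn'
        calc _ ≤ _ := h2
          _ ≤ q * n * aco n D (s+j+1) := mul_le_mul_of_nonneg_right h3 (aco_nonneg _ _ _)
          _ = _ := by ring
      calc _ ≤ _ := h1
        _ ≤ q^j * (q * aco n D (s+j+1)) := by gcongr
        _ = _ := by rw [pow_succ, ← add_assoc]; ring
  have := key (N-s) (by omega)
  rwa [Nat.add_sub_cancel' hs] at this


lemma log_lin_small (A : ℕ) (c : ℝ) (hc : 0 < c) : ∀ᶠ n : ℕ in Filter.atTop, Real.log ((n:ℝ) * A + 1) ≤ c * n := by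
  have h := Real.isLittleO_log_id_atTop.bound (show 0 < c/(A+2) by positivity)
  have ht : Filter.Tendsto (fun n : ℕ => (n:ℝ) * (A+1) + 1) Filter.atTop Filter.atTop := by
    apply Filter.tendsto_atTop_add_const_right
    exact Filter.Tendsto.atTop_mul_const (by positivity) tendsto_natCast_atTop_atTop
  filter_upwards [ht.eventually h, Filter.eventually_ge_atTop 1] with n hn hn1
  have hn1' : (1:ℝ) ≤ n := by exact_mod_cast hn1
  have hA : (0:ℝ) ≤ A := by positivity
  rw [Real.norm_of_nonneg (Real.log_nonneg (by nlinarith))] at hn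
  simp only [id] at hn
  rw [Real.norm_of_nonneg (by positivity)] at hn
  calc Real.log ((n:ℝ) * A + 1) ≤ Real.log ((n:ℝ) * (A+1) + 1) := by
        apply Real.log_le_log (by positivity); nlinarith
    _ ≤ _ := hn
    _ ≤ c/(A+2) * (n * (A+2)) := by gcongr; nlinarith
    _ = c * n := by field_simp

set_option maxHeartbeats 1000000 in
lemma aco_lower (d l ε : ℝ) (hd : 2 < d) (hl : 0 < l) (hD : Dfun l = d) (hε : 0 < ε) :
    ∃ Δ : ℕ, 0 < Δ ∧ ∃ δ : ℝ, 0 < δ ∧ ∃ n0 : ℕ, ∀ n N : ℕ, n0 ≤ n → |(N:ℝ) - d * n| ≤ δ * n →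
      0 < aco n Δ N ∧ n * Real.log (phi l) - N * Real.log l - ε * n ≤ Real.log (aco n Δ N) := by
  have hq : 0 < Real.log (4*d) := Real.log_pos (by linarith)
  obtain ⟨ζ, hζ0, hζ⟩ : ∃ ζ : ℝ, 0 < ζ ∧ ζ * (|Real.log l| + Real.log (4*d)) ≤ ε/4 := by
    have : 0 < |Real.log l| + Real.log (4*d) := by positivity
    refine ⟨ε/4 / (|Real.log l| + Real.log (4*d)), by positivity, ?_⟩
    rw [div_mul_cancel₀ _ this.ne']
  have hlogphi : ContinuousAt (fun z => Real.log (phi z)) l :=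
    ((phi_hasDeriv l).log (phi_pos hl.ne').ne').continuousAt
  have ev1 : ∀ᶠ z in nhds l, d - ζ/4 < Dfun z := by
    have := (Dfun_hasDeriv hl).continuousAt
    apply this.eventually_const_lt; rw [hD]; linarith
  have ev2 : ∀ᶠ z in nhds l, Real.log (phi l) - ε/8 < Real.log (phi z) := by
    apply hlogphi.eventually_const_lt; linarith
  have ev3 : ∀ᶠ z in nhds l, 0 < z := lt_mem_nhds hl
  obtain ⟨r, hr, hball⟩ := Metric.eventually_nhds_iff.mp (ev1.and (ev2.and ev3))
  obtain ⟨l0, hl0⟩ : ∃ l0, l0 = l - r/2 := ⟨_, rfl⟩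
  obtain ⟨l1, hl1⟩ : ∃ l1, l1 = l - r/4 := ⟨_, rfl⟩
  have b0 := hball (y := l0) (by rw [Real.dist_eq, hl0, show l - r/2 - l = -(r/2) by ring, abs_neg, abs_of_pos (by linarith)]; linarith)
  have b1 := hball (y := l1) (by rw [Real.dist_eq, hl1, show l - r/4 - l = -(r/4) by ring, abs_neg, abs_of_pos (by linarith)]; linarith)
  have h01 : l0 < l1 := by linarith
  have h1l : l1 < l := by linarith
  have p0 : 0 < l0 := b0.2.2
  have p1 : 0 < l1 := b1.2.2
  have L01 : Real.log l0 < Real.log l1 := Real.log_lt_log p0 h01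
  have L1l : Real.log l1 < Real.log l := Real.log_lt_log p1 h1l
  obtain ⟨ξ0, hξ0, e0⟩ := phi_slope p0 h01
  obtain ⟨ξ1, hξ1, e1⟩ := phi_slope p1 h1l
  have hS0 : d - ζ/4 < Dfun ξ0 := b0.1.trans (Dfun_strictMono p0 (p0.trans hξ0.1) hξ0.1)
  have hS1 : Dfun ξ1 < d := by
    rw [← hD]; exact Dfun_strictMono (p1.trans hξ1.1) hl hξ1.2
  obtain ⟨η, hη⟩ : ∃ η, η = (d - Dfun ξ1)/3 := ⟨_, rfl⟩
  have hη0 : 0 < η := by rw [hη]; linarith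
  have tl : ∀ z, 0 < z → Filter.Tendsto (fun D => Real.log (pD D z)) Filter.atTop (nhds (Real.log (phi z))) :=
    fun z hz => (pD_tendsto z).log (phi_pos hz.ne').ne'
  have E1 : ∀ᶠ D in Filter.atTop, Real.log (pD D l) - Real.log (pD D l1) < (d - 2*η) * (Real.log l - Real.log l1) := by
    apply ((tl l hl).sub (tl l1 p1)).eventually_lt_const
    rw [e1]; apply mul_lt_mul_of_pos_right _ (by linarith); rw [hη]; linarith
  have E2 : ∀ᶠ D in Filter.atTop, (d - ζ/3) * (Real.log l1 - Real.log l0) < Real.log (pD D l1) - Real.log (pD D l0) := by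
    apply ((tl l1 p1).sub (tl l0 p0)).eventually_const_lt
    rw [e0]; apply mul_lt_mul_of_pos_right _ (by linarith); linarith
  have E3 : ∀ᶠ D in Filter.atTop, Real.log (phi l) - ε/4 < Real.log (pD D l1) := by
    apply (tl l1 p1).eventually_const_lt; linarith [b1.2.1]
  have E4 : ∀ᶠ D : ℕ in Filter.atTop, 4*d ≤ D := tendsto_natCast_atTop_atTop.eventually_ge_atTop _
  have pz : ∀ z, 0 < z → ∀ᶠ D in Filter.atTop, 0 < pD D z := fun z hz =>
    (pD_tendsto z).eventually_const_lt (phi_pos hz.ne')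
  obtain ⟨Δ, h1, h2, h3, h4, q0, q1, ql⟩ := (E1.and (E2.and (E3.and (E4.and ((pz l0 p0).and ((pz l1 p1).and (pz l hl))))))).exists
  have hΔ : 0 < Δ := by
    have : (0:ℝ) < Δ := by linarith
    exact_mod_cast this
  obtain ⟨c', hc'0, hc'1, hc'2, hc'3⟩ : ∃ c' : ℝ, 0 < c' ∧ c' ≤ ε/4 ∧ c' ≤ η * (Real.log l - Real.log l1) ∧ c' ≤ ζ/6*(Real.log l1 - Real.log l0) := by
    have t1 : 0 < η * (Real.log l - Real.log l1) := mul_pos hη0 (by linarith)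
    have t2 : 0 < ζ/6*(Real.log l1 - Real.log l0) := mul_pos (by linarith) (by linarith)
    refine ⟨min (ε/4) (min (η * (Real.log l - Real.log l1)) (ζ/6*(Real.log l1 - Real.log l0))), ?_, min_le_left _ _, (min_le_right _ _).trans (min_le_left _ _), (min_le_right _ _).trans (min_le_right _ _)⟩
    exact lt_min (by linarith) (lt_min t1 t2)
  obtain ⟨n1, hn1⟩ := Filter.eventually_atTop.mp (log_lin_small Δ c' hc'0)
  refine ⟨Δ, hΔ, min η (min (ζ/2) 1), by positivity, max n1 1, ?_⟩
  intro n N hn hN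
  have hlog := hn1 n (le_of_max_le_left hn)
  have hnpos : 0 < n := le_of_max_le_right hn
  have hnR : (0:ℝ) < n := by exact_mod_cast hnpos
  obtain ⟨δ, hδ⟩ : ∃ δ, δ = min η (min (ζ/2) 1) := ⟨_, rfl⟩
  rw [← hδ] at hN
  have hδ1 : δ ≤ η := by rw [hδ]; exact min_le_left _ _
  have hδ2 : δ ≤ ζ/2 := by rw [hδ]; exact (min_le_right _ _).trans (min_le_left _ _)
  have hδ3 : δ ≤ 1 := by rw [hδ]; exact (min_le_right _ _).trans (min_le_right _ _)
  obtain ⟨hNl, hNu⟩ := abs_le.mp hN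
  obtain ⟨s, hs, hmax⟩ := aco_max n Δ l1
  have hApos : 0 < aco n Δ s := by
    rcases (aco_nonneg n Δ s).lt_or_eq with h | h
    · exact h
    · exfalso
      rw [← h] at hmax
      have : 0 < pD Δ l1 ^ n := pow_pos q1 n
      simp at hmax; linarith
  have m1 : n * Real.log (pD Δ l1) ≤ Real.log (n*Δ+1) + (Real.log (aco n Δ s) + s * Real.log l1) := by
    have := Real.log_le_log (pow_pos q1 n) hmax
    rw [Real.log_pow, Real.log_mul (by positivity) (by positivity), Real.log_mul hApos.ne' (by positivity), Real.log_pow] at this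
    exact this
  have ml : ∀ z, 0 < z → 0 < pD Δ z → Real.log (aco n Δ s) + s * Real.log z ≤ n * Real.log (pD Δ z) := by
    intro z hz hpz
    have := Real.log_le_log (by positivity) (aco_le n Δ s z hz.le)
    rwa [Real.log_pow, Real.log_mul hApos.ne' (by positivity), Real.log_pow] at this
  have mL := ml l hl ql
  have m0 := ml l0 p0 q0
  have hsu : (s:ℝ) ≤ (d - η) * n := by
    have g : 0 < Real.log l - Real.log l1 := by linarith
    refine le_of_mul_le_mul_right ?_ g
    have a1 := mul_le_mul_of_nonneg_left h1.le hnR.le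
    have a2 := mul_le_mul_of_nonneg_right hc'2 hnR.le
    linarith
  have hsl : (d - ζ/2) * n ≤ s := by
    have g : 0 < Real.log l1 - Real.log l0 := by linarith
    refine le_of_mul_le_mul_right ?_ g
    have a1 := mul_le_mul_of_nonneg_left h2.le hnR.le
    have a2 := mul_le_mul_of_nonneg_right hc'3 hnR.le
    linarith
  have hdn1 := mul_le_mul_of_nonneg_right hδ1 hnR.le
  have hdn2 := mul_le_mul_of_nonneg_right hδ2 hnR.le
  have hdn3 := mul_le_mul_of_nonneg_right hδ3 hnR.le
  have hdn4 := mul_lt_mul_of_pos_right hd hnR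
  have hsN' : (s:ℝ) ≤ N := by linarith
  have hsN : s ≤ N := by exact_mod_cast hsN'
  have hN2 : 2 * (N:ℝ) ≤ 4*d*n := by linarith
  have htr := aco_transfer n Δ N s (4*d) (by linarith) hΔ hnpos (by
    have : 2 * (N:ℝ) ≤ n * Δ := by
      have := mul_le_mul_of_nonneg_left h4 hnR.le
      linarith
    exact_mod_cast this) hN2 hsN
  have hBpos : 0 < aco n Δ N := by
    by_contra hcon
    have : aco n Δ N = 0 := le_antisymm (not_lt.mp hcon) (aco_nonneg _ _ _)
    rw [this, mul_zero] at htr; linarith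
  refine ⟨hBpos, ?_⟩
  have t := Real.log_le_log hApos htr
  rw [Real.log_mul (by positivity) hBpos.ne', Real.log_pow, Nat.cast_sub hsN] at t
  have u1 : ((N:ℝ) - s) ≤ ζ * n := by linarith
  have u2 : ((N:ℝ) - s) * (|Real.log l| + Real.log (4*d)) ≤ ε/4 * n := by
    calc _ ≤ ζ * n * (|Real.log l| + Real.log (4*d)) := by gcongr
      _ = ζ * (|Real.log l| + Real.log (4*d)) * n := by ring
      _ ≤ _ := by gcongr
  have u3 : -((N:ℝ) - s) * |Real.log l| ≤ ((N:ℝ) - s) * Real.log l := by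
    have := mul_le_mul_of_nonneg_left (neg_abs_le (Real.log l)) (sub_nonneg.mpr hsN')
    linarith
  have u4 : (s:ℝ) * Real.log l1 ≤ s * Real.log l := by gcongr
  have u5 := mul_le_mul_of_nonneg_left h3.le hnR.le
  have u6 := mul_le_mul_of_nonneg_right hc'1 hnR.le
  have u7 := mul_pos hε hnR
  linarith


lemma T_lower (k : ℕ) (hk : 4 ≤ k) (d l ε : ℝ) (hd : 2 < d) (hl : 0 < l) (hD : Dfun l = d) (hε : 0 < ε) :
    ∃ δ : ℝ, 0 < δ ∧ ∃ n0 : ℕ, ∀ m n : ℕ, n0 ≤ n → |((m*k:ℕ):ℝ) - d * n| ≤ δ * n →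
      0 < (rowSys (Fin m) k n ∅).card ∧
      Real.log ((m*k).factorial) + n * Real.log (phi l) - ((m*k:ℕ):ℝ) * Real.log l - ε * n ≤ 
        m * Real.log (k.factorial) + Real.log ((rowSys (Fin m) k n ∅).card) := by
  obtain ⟨Δ, hΔ, δ, hδ, n0, hlow⟩ := aco_lower d l (ε/2) hd hl hD (by linarith)
  obtain ⟨A, hA⟩ := exists_nat_ge (d+1)
  have hkΔ : (0:ℝ) < 8*k*Δ := by
    have : 0 < 8*k*Δ := by positivity
    exact_mod_cast this
  have e1 := log_lin_small A (ε/(4*(8*k*Δ))) (by positivity)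
  have e2 : ∀ᶠ n : ℕ in Filter.atTop, Real.log 2 / (ε/4) ≤ (n:ℝ) := tendsto_natCast_atTop_atTop.eventually_ge_atTop _
  obtain ⟨n1, hn1⟩ := Filter.eventually_atTop.mp (e1.and (e2.and (Filter.eventually_ge_atTop (2*k*Δ+2))))
  refine ⟨min δ 1, by positivity, max n0 n1, ?_⟩
  intro m n hn hN
  obtain ⟨f1, f2, f3⟩ := hn1 n (le_of_max_le_right hn)
  have hnpos : (0:ℝ) < n := by
    have : 0 < n := by omega
    exact_mod_cast this
  have hN1 : |((m*k:ℕ):ℝ) - d * n| ≤ δ * n := hN.trans (by gcongr; exact min_le_left _ _)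
  have hN2 : |((m*k:ℕ):ℝ) - d * n| ≤ 1 * n := hN.trans (by gcongr; exact min_le_right _ _)
  obtain ⟨g1, g2⟩ := abs_le.mp hN2
  have hd2 := mul_lt_mul_of_pos_right hd hnpos
  have hNn : n ≤ m*k := by
    have : (n:ℝ) ≤ ((m*k:ℕ):ℝ) := by linarith
    exact_mod_cast this
  have hNA : ((m*k:ℕ):ℝ) ≤ n * A := by
    have := mul_le_mul_of_nonneg_left hA hnpos.le
    linarith
  obtain ⟨hpos, hlo⟩ := hlow n (m*k) (le_of_max_le_left hn) hN1
  have hG := Gset_le (k := k) (m := m) (n := n) (D := Δ) (by omega) (by omega)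
  have hGc := Gset_card (Fin m × Fin k) n Δ
  have hcard : Fintype.card (Fin m × Fin k) = m*k := by simp
  rw [hcard] at hGc
  have hG' : (((Gset (Fin m × Fin k) n Δ).card : ℕ) : ℝ) ≤ ((2*(1+(m*k)^2)^(4*k*Δ) * (k.factorial^m * (rowSys (Fin m) k n ∅).card) : ℕ) : ℝ) := by
    exact_mod_cast hG
  rw [hGc] at hG'
  have hleft : 0 < ((m*k).factorial : ℝ) * aco n Δ (m*k) := by positivity
  have hT : 0 < (rowSys (Fin m) k n ∅).card := by
    by_contra hcon
    have : (rowSys (Fin m) k n ∅).card = 0 := by omega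
    rw [this] at hG'
    simp at hG'
    linarith
  refine ⟨hT, ?_⟩
  have hTR : (0:ℝ) < (rowSys (Fin m) k n ∅).card := by exact_mod_cast hT
  have hfac : (0:ℝ) < k.factorial := by positivity
  have hlog := Real.log_le_log hleft hG'
  push_cast at hlog
  rw [Real.log_mul (by positivity) hpos.ne', Real.log_mul (by positivity) (by positivity), Real.log_mul (by norm_num) (by positivity), 
    Real.log_mul (by positivity) hTR.ne', Real.log_pow, Real.log_pow] at hlog
  have h1N : Real.log (1 + ((m:ℝ)*k)^2) ≤ 2 * Real.log ((n:ℝ)*A+1) := by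
    have : (2:ℝ) * Real.log ((n:ℝ)*A+1) = Real.log (((n:ℝ)*A+1)^2) := by rw [Real.log_pow]; norm_num
    rw [this]
    apply Real.log_le_log (by positivity)
    push_cast at hNA
    have : (0:ℝ) ≤ (m:ℝ)*k := by positivity
    nlinarith
  have f1' : 8*k*Δ * Real.log ((n:ℝ)*A+1) ≤ ε/4*n := by
    calc _ ≤ 8*k*Δ * (ε/(4*(8*k*Δ)) * n) := by gcongr
      _ = _ := by field_simp
  have f2' : Real.log 2 ≤ ε/4*n := by
    rw [div_le_iff₀ (by positivity)] at f2; linarith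
  have h2N : ((4*k*Δ:ℕ):ℝ) * Real.log (1 + ((m:ℝ)*k)^2) ≤ 8*k*Δ * Real.log ((n:ℝ)*A+1) := by
    calc _ ≤ ((4*k*Δ:ℕ):ℝ) * (2 * Real.log ((n:ℝ)*A+1)) := by gcongr
      _ = _ := by push_cast; ring
  push_cast at hlo h2N hlog ⊢
  linarith


lemma log_fact_lower (n : ℕ) : n * Real.log n - n ≤ Real.log n.factorial := by
  rcases Nat.eq_zero_or_pos n with h | h
  · subst h; simp
  · have hn : (0:ℝ) < n := by exact_mod_cast h
    have h1 := Real.pow_div_factorial_le_exp (n:ℝ) hn.le n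
    have h2 := Real.log_le_log (by positivity) h1
    rw [Real.log_exp, Real.log_div (by positivity) (by positivity), Real.log_pow] at h2
    linarith

lemma log_fact_upper (n : ℕ) : Real.log n.factorial ≤ n * Real.log n - n + Real.log n + 1 := by
  induction n with
  | zero => simp
  | succ n ih =>
    rcases Nat.eq_zero_or_pos n with h | h
    · subst h; simp
    have hn : (0:ℝ) < n := by exact_mod_cast h
    rw [Nat.factorial_succ]; push_cast
    rw [Real.log_mul (by positivity) (by positivity)]
    have h1 : 1 ≤ ((n:ℝ)+1) * (Real.log (n+1) - Real.log n) := by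
      have := Real.one_sub_inv_le_log_of_pos (show (0:ℝ) < (n+1)/n by positivity)
      rw [Real.log_div (by positivity) (by positivity)] at this
      calc (1:ℝ) = (n+1) * (1 - ((n+1:ℝ)/n)⁻¹) := by field_simp; ring
        _ ≤ _ := by gcongr
    linarith

lemma log_choose_fact (m r : ℕ) (hm : 0 < m) (hr : r ≤ m) :
    |Real.log (m.choose r) - m * Real.binEntropy (r/m)| ≤ 2 * Real.log m + 2 := by
  have hmR : (0:ℝ) < m := by exact_mod_cast hm
  have e : Real.log (m.choose r) = Real.log m.factorial - Real.log r.factorial - Real.log (m-r).factorial := by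
    rw [Nat.cast_choose ℝ hr, Real.log_div (by positivity) (by positivity), Real.log_mul (by positivity) (by positivity)]
    ring
  have e2 : (m:ℝ) * Real.binEntropy (r/m) = m * Real.log m - r * Real.log r - ((m-r:ℕ):ℝ) * Real.log ((m-r:ℕ):ℝ) := by
    rw [Real.binEntropy_eq_negMulLog_add_negMulLog_one_sub]
    unfold Real.negMulLog
    have h1 : (m:ℝ) * (-(r/m:ℝ) * Real.log (r/m)) = r * Real.log m - r * Real.log r := by
      rcases Nat.eq_zero_or_pos r with h | h
      · subst h; simp
      · have hrR : (0:ℝ) < r := by exact_mod_cast h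
        rw [Real.log_div hrR.ne' hmR.ne']; field_simp; ring
    have h2 : (m:ℝ) * (-(1-r/m:ℝ) * Real.log (1-r/m)) = ((m-r:ℕ):ℝ) * Real.log m - ((m-r:ℕ):ℝ) * Real.log ((m-r:ℕ):ℝ) := by
      have e3 : (1 - (r:ℝ)/m) = ((m-r:ℕ):ℝ)/m := by rw [Nat.cast_sub hr]; field_simp
      rw [e3]
      rcases Nat.eq_zero_or_pos (m-r) with h | h
      · rw [h]; simp
      · have hrR : (0:ℝ) < ((m-r:ℕ):ℝ) := by exact_mod_cast h
        rw [Real.log_div hrR.ne' hmR.ne']; field_simp; ring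
    rw [mul_add, h1, h2, Nat.cast_sub hr]; ring
  have hle : ∀ j : ℕ, j ≤ m → Real.log j ≤ Real.log m := by
    intro j hj
    rcases Nat.eq_zero_or_pos j with h | h
    · subst h; simp; exact Real.log_natCast_nonneg m
    · exact Real.log_le_log (by exact_mod_cast h) (by exact_mod_cast hj)
  have a1 := log_fact_lower m
  have a2 := log_fact_upper m
  have b1 := log_fact_lower r
  have b2 := log_fact_upper r
  have c1 := log_fact_lower (m-r)
  have c2 := log_fact_upper (m-r)
  have d1 := hle r hr
  have d2 := hle (m-r) (by omega)
  have d3 := Real.log_natCast_nonneg m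
  have d4 : ((m-r:ℕ):ℝ) = m - r := Nat.cast_sub hr
  rw [e, e2, abs_le]
  constructor <;> linarith

/-- Property used for compactness. -/
def Pgood (k : ℕ) (c : ℝ) (S : Set ℝ) : Prop :=
  ∃ η : ℝ, 0 < η ∧ ∃ δ : ℝ, 0 < δ ∧ ∃ n0 : ℕ, ∀ m n : ℕ, n0 ≤ n → |(m:ℝ)/n - c| ≤ δ →
    ∀ R : Finset (Fin m), (R.card:ℝ)/m ∈ S →
      (m.choose R.card : ℝ) * ((critSys k m n R).card : ℝ) ≤ Real.exp (-η * n) * ((rowSys (Fin m) k n ∅).card : ℝ)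

/-- Exponent. -/
noncomputable def PhiE (k : ℕ) (l s t c α : ℝ) : ℝ :=
  c * (-((k:ℝ)-1) * Real.binEntropy α - k * (α * Real.log s + (1-α) * Real.log t)) + Real.log (Fgen (l*s) (l*t) / phi l)

lemma Fgen_pos {x y : ℝ} (hx : 0 < x) (hy : 0 ≤ y) : 0 < Fgen x y := by
  unfold Fgen
  have h1 : 1 < Real.cosh x := Real.one_lt_cosh.mpr hx.ne'
  have h2 := Real.add_one_le_exp y
  have h3 := Real.exp_pos y
  nlinarith

lemma crit_exponent (k : ℕ) (hk : 4 ≤ k) (m n : ℕ) (hm : 0 < m) (hn : 0 < n) (l s t ε : ℝ) (hl : 0 < l) (hs : 0 < s) (ht : 0 < t)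
    (hT : 0 < (rowSys (Fin m) k n ∅).card)
    (hTl : Real.log ((m*k).factorial) + n * Real.log (phi l) - ((m*k:ℕ):ℝ) * Real.log l - ε * n ≤ 
        m * Real.log (k.factorial) + Real.log ((rowSys (Fin m) k n ∅).card))
    (R : Finset (Fin m)) :
    (m.choose R.card : ℝ) * ((critSys k m n R).card : ℝ) ≤ 
      Real.exp (n * PhiE k l s t ((m:ℝ)/n) ((R.card:ℝ)/m) + ε * n + 4 * Real.log ((m*k:ℕ):ℝ) + 4) * ((rowSys (Fin m) k n ∅).card : ℝ) := by
  have hTR : (0:ℝ) < (rowSys (Fin m) k n ∅).card := by exact_mod_cast hT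
  have hmR : (0:ℝ) < m := by exact_mod_cast hm
  have hnR : (0:ℝ) < n := by exact_mod_cast hn
  have hr : R.card ≤ m := by simpa using R.card_le_univ
  rcases Nat.eq_zero_or_pos (critSys k m n R).card with h0 | h0
  · rw [h0]; simp; positivity
  have h0R : (0:ℝ) < (critSys k m n R).card := by exact_mod_cast h0
  generalize hrr : R.card = r at *
  have hch : (0:ℝ) < m.choose r := by exact_mod_cast Nat.choose_pos hr
  rw [← Real.log_le_log_iff (by positivity) (by positivity), Real.log_mul hch.ne' h0R.ne', Real.log_mul (by positivity) hTR.ne', Real.log_exp]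
  have hF : 0 < Fgen (l*s) (l*t) := Fgen_pos (by positivity) (by positivity)
  have hph := phi_pos hl.ne'
  have hup := crit_upper k m n R (l*s) (l*t) (by positivity) (by positivity)
  rw [hrr] at hup
  have hup2 := Real.log_le_log (by positivity) hup
  rw [Real.log_mul (by positivity) (by positivity), Real.log_mul (by positivity) (by positivity), 
    Real.log_mul (by positivity) (by positivity), Real.log_mul (by positivity) (by positivity), Real.log_mul (by positivity) (by positivity),
    Real.log_pow, Real.log_pow, Real.log_pow, Real.log_pow, Real.log_mul hl.ne' hs.ne', Real.log_mul hl.ne' ht.ne'] at hup2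
  have hkr : k * r ≤ m * k := by nlinarith
  have hN := log_choose_fact (m*k) (k*r) (by positivity) hkr
  have hM := log_choose_fact m r hm hr
  have eN : Real.log ((m*k).choose (k*r)) = Real.log (m*k).factorial - Real.log (k*r).factorial - Real.log (k*(m-r)).factorial := by
    rw [Nat.cast_choose ℝ hkr, Real.log_div (by positivity) (by positivity), Real.log_mul (by positivity) (by positivity)]
    rw [show m*k - k*r = k*(m-r) by rw [Nat.mul_sub, mul_comm m k]]
    ring
  have er : ((k*r:ℕ):ℝ)/((m*k:ℕ):ℝ) = (r:ℝ)/m := by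
    have : (0:ℝ) < k := by exact_mod_cast (by omega : 0 < k)
    push_cast; field_simp
  rw [er] at hN
  rw [eN] at hN
  have hN1 := (abs_le.mp hN).1
  have hM2 := (abs_le.mp hM).2
  have hlm : Real.log m ≤ Real.log ((m*k:ℕ):ℝ) := by
    apply Real.log_le_log hmR
    exact_mod_cast (by nlinarith : m ≤ m*k)
  have eP : n * PhiE k l s t ((m:ℝ)/n) ((r:ℝ)/m) = -((k:ℝ)-1) * (m * Real.binEntropy (r/m)) - k * r * Real.log s - k * (m-r) * Real.log t 
      + n * Real.log (Fgen (l*s) (l*t)) - n * Real.log (phi l) := by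
    unfold PhiE
    rw [Real.log_div hF.ne' hph.ne']
    field_simp
    ring
  rw [eP]
  have d4 : ((m-r:ℕ):ℝ) = m - r := Nat.cast_sub hr
  push_cast [d4] at hup2 hN1 hTl hlm ⊢
  linarith

lemma PhiE_cont (k : ℕ) (l s t : ℝ) : Continuous (fun p : ℝ × ℝ => PhiE k l s t p.1 p.2) := by
  unfold PhiE
  have := Real.binEntropy_continuous
  fun_prop

lemma Pgood_local (k : ℕ) (hk : 4 ≤ k) (c l s t α0 : ℝ) (hc0 : 2 < k*c) (hl : 0 < l) (hD : Dfun l = k*c) (hs : 0 < s) (ht : 0 < t)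
    (hneg : PhiE k l s t c α0 < 0) : ∃ U ∈ nhds α0, Pgood k c U := by
  obtain ⟨η, hη⟩ : ∃ η, η = - PhiE k l s t c α0 / 4 := ⟨_, rfl⟩
  have hη0 : 0 < η := by rw [hη]; linarith
  have hev : ∀ᶠ p in nhds (c, α0), PhiE k l s t p.1 p.2 < -3*η := by
    apply (PhiE_cont k l s t).continuousAt.eventually_lt_const
    show PhiE k l s t c α0 < _
    rw [hη]; linarith
  obtain ⟨r, hr, hball⟩ := Metric.eventually_nhds_iff.mp hev
  obtain ⟨δ, hδ, n0, hT⟩ := T_lower k hk (k*c) l η hc0 hl hD hη0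
  have hkR : (0:ℝ) < k := by exact_mod_cast (by omega : 0 < k)
  have hcpos : 0 < c := by
    by_contra h; push Not at h; nlinarith
  obtain ⟨A, hA⟩ := exists_nat_ge (k*(c+1))
  have e1 := log_lin_small A (η/8) (by positivity)
  have e2 : ∀ᶠ n : ℕ in Filter.atTop, 4 / (η/2) ≤ (n:ℝ) := tendsto_natCast_atTop_atTop.eventually_ge_atTop _
  obtain ⟨n1, hn1⟩ := Filter.eventually_atTop.mp (e1.and (e2.and (Filter.eventually_ge_atTop 1)))
  refine ⟨Metric.ball α0 r, Metric.ball_mem_nhds _ hr, η/2, by linarith, min (δ/k) (min (r/2) (min 1 (c/2))), by positivity, max n0 n1, ?_⟩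
  intro m n hn hmn R hR
  obtain ⟨f1, f2, f3⟩ := hn1 n (le_of_max_le_right hn)
  have hnR : (0:ℝ) < n := by exact_mod_cast f3
  have g1 : |(m:ℝ)/n - c| ≤ δ/k := hmn.trans (min_le_left _ _)
  have g2 : |(m:ℝ)/n - c| ≤ r/2 := hmn.trans ((min_le_right _ _).trans (min_le_left _ _))
  have g3 : |(m:ℝ)/n - c| ≤ 1 := hmn.trans ((min_le_right _ _).trans ((min_le_right _ _).trans (min_le_left _ _)))
  have g4 : |(m:ℝ)/n - c| ≤ c/2 := hmn.trans ((min_le_right _ _).trans ((min_le_right _ _).trans (min_le_right _ _)))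
  have hm : 0 < m := by
    by_contra h
    have : m = 0 := by omega
    rw [this] at g4
    simp at g4
    rw [abs_of_pos hcpos] at g4; linarith
  have hmn2 : |((m*k:ℕ):ℝ) - k*c * n| ≤ δ * n := by
    have : ((m*k:ℕ):ℝ) - k*c*n = ((m:ℝ)/n - c) * (k * n) := by push_cast; field_simp
    rw [this, abs_mul, abs_of_pos (by positivity : (0:ℝ) < k * n)]
    calc _ ≤ δ/k * (k*n) := by gcongr
      _ = _ := by field_simp
  obtain ⟨hTp, hTl⟩ := hT m n (le_of_max_le_left hn) hmn2
  refine (crit_exponent k hk m n hm f3 l s t η hl hs ht hTp hTl R).trans ?_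
  gcongr
  have hb : PhiE k l s t ((m:ℝ)/n) ((R.card:ℝ)/m) < -3*η := by
    apply hball (y := ((m:ℝ)/n, (R.card:ℝ)/m))
    rw [Prod.dist_eq]
    apply max_lt
    · rw [Real.dist_eq]; simp only; linarith
    · exact hR
  have hmk : ((m*k:ℕ):ℝ) ≤ n * A + 1 := by
    have h1 : (m:ℝ)/n ≤ c+1 := by linarith [(abs_le.mp g3).2]
    rw [div_le_iff₀ hnR] at h1
    push_cast
    have h2 := mul_le_mul_of_nonneg_left hA hnR.le
    have h3 := mul_le_mul_of_nonneg_right h1 hkR.le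
    linarith
  have hlog : Real.log ((m*k:ℕ):ℝ) ≤ η/8*n := by
    refine le_trans (Real.log_le_log ?_ hmk) f1
    have : 0 < m*k := by positivity
    exact_mod_cast this
  have f2' : 4 ≤ η/2*n := by
    rw [div_le_iff₀ (by positivity)] at f2; linarith
  have := mul_lt_mul_of_pos_left hb hnR
  linarith

lemma Pgood_all (k : ℕ) (c : ℝ) (ε : ℝ)
    (h : ∀ α : ℝ, ε ≤ α → α ≤ 1 → ∃ U ∈ nhds α, Pgood k c U) : Pgood k c (Set.Icc ε 1) := by
  apply isCompact_Icc.induction_on (p := Pgood k c)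
  · exact ⟨1, one_pos, 1, one_pos, 0, fun m n _ _ R hR => absurd hR (Set.notMem_empty _)⟩
  · rintro S S' hS ⟨η, hη, δ, hδ, n0, H⟩
    exact ⟨η, hη, δ, hδ, n0, fun m n a b R hR => H m n a b R (hS hR)⟩
  · rintro S S' ⟨η, hη, δ, hδ, n0, H⟩ ⟨η', hη', δ', hδ', n0', H'⟩
    refine ⟨min η η', lt_min hη hη', min δ δ', lt_min hδ hδ', max n0 n0', fun m n a b R hR => ?_⟩
    rcases hR with hR | hR
    · refine (H m n (le_of_max_le_left a) (b.trans (min_le_left _ _)) R hR).trans ?_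
      gcongr
      exact min_le_left _ _
    · refine (H' m n (le_of_max_le_right a) (b.trans (min_le_right _ _)) R hR).trans ?_
      gcongr
      exact min_le_right _ _
  · intro α hα
    obtain ⟨U, hU, hP⟩ := h α hα.1 hα.2
    exact ⟨U, mem_nhdsWithin_of_mem_nhds hU, hP⟩


lemma sum_large_bound (m : ℕ) (S : Finset (Finset (Fin m))) (f : Finset (Fin m) → ℝ) (B : ℝ) (hB : 0 ≤ B)
    (h : ∀ R ∈ S, (m.choose R.card : ℝ) * f R ≤ B) : ∑ R ∈ S, f R ≤ (m+1) * B := by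
  have hpos : ∀ R : Finset (Fin m), (0:ℝ) < m.choose R.card := by
    intro R
    exact_mod_cast Nat.choose_pos (by simpa using R.card_le_univ)
  calc ∑ R ∈ S, f R ≤ ∑ R ∈ S, B / (m.choose R.card : ℝ) := by
        apply Finset.sum_le_sum
        intro R hR
        rw [le_div_iff₀ (hpos R), mul_comm]; exact h R hR
    _ ≤ ∑ R ∈ (Finset.univ : Finset (Fin m)).powerset, B / (m.choose R.card : ℝ) := by
        apply Finset.sum_le_sum_of_subset_of_nonneg
        · intro R _; simp
        · intro R _ _; exact div_nonneg hB (hpos R).le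
    _ = _ := by
        rw [Finset.sum_powerset_apply_card (fun j => B / (m.choose j : ℝ))]
        simp only [Finset.card_univ, Fintype.card_fin, nsmul_eq_mul]
        rw [Finset.sum_congr rfl (g := fun _ => B)]
        · simp
        · intro j hj
          have : (0:ℝ) < m.choose j := by exact_mod_cast Nat.choose_pos (by simp at hj; omega)
          field_simp

lemma subcritical (k : ℕ) (hk : 4 ≤ k) (m n : ℕ → ℕ)
    (hm : ∀ j, 0 < m j) (hn : ∀ j, 0 < n j)
    (hntop : Filter.Tendsto n Filter.atTop Filter.atTop)
    (c : ℝ)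
    (hc : Filter.Tendsto (fun j => (m j : ℝ) / (n j : ℝ)) Filter.atTop (nhds c))
    (hc2 : 2 < k * c) (hc1 : c < 1) (l : ℝ) (hl : 0 < l) (hD : Dfun l = k*c)
    (hV : ∀ α, 0 < α → α ≤ 1 → ∃ s t, 0 < s ∧ 0 < t ∧ PhiE k l s t c α < 0) :
    ∃ K : ℝ, ∀ᶠ j in Filter.atTop, 1 - K / (m j : ℝ) ^ (k - 2) ≤ satProb k (m j) (n j) := by
  obtain ⟨ε, hε, K, hK, n0, hsmall⟩ := crit_small_sum k hk ((k*c-2)/2) (by linarith)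
  obtain ⟨η, hη, δ, hδ, n1, hlarge⟩ := Pgood_all k c ε (fun α h1 h2 => by
    obtain ⟨s, t, hs, ht, h⟩ := hV α (lt_of_lt_of_le hε h1) h2
    exact Pgood_local k hk c l s t α hc2 hl hD hs ht h)
  obtain ⟨δ2, hδ2, n2, hT⟩ := T_lower k hk (k*c) l 1 hc2 hl hD one_pos
  have hkR : (0:ℝ) < k := by exact_mod_cast (by omega : 0 < k)
  have e1 := hntop.eventually (log_lin_small 1 (η/k) (by positivity))
  have c1 : ∀ᶠ j in Filter.atTop, |(m j : ℝ)/(n j) - c| ≤ min δ (δ2/k) := by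
    have h := (Metric.tendsto_nhds.mp hc) (min δ (δ2/k)) (by positivity)
    filter_upwards [h] with j hj
    rw [Real.dist_eq] at hj; exact hj.le
  have c2 : ∀ᶠ j in Filter.atTop, (m j : ℝ)/(n j) < 1 := hc.eventually_lt_const hc1
  have c3 : ∀ᶠ j in Filter.atTop, (2 + (k*c-2)/2)/k < (m j : ℝ)/(n j) := by
    apply hc.eventually_const_lt
    rw [div_lt_iff₀ hkR]; linarith
  refine ⟨K + 1, ?_⟩
  filter_upwards [e1, c1, c2, c3, hntop.eventually_ge_atTop n0, hntop.eventually_ge_atTop n1, hntop.eventually_ge_atTop n2] with j e1 c1 c2 c3 h0 h1 h2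
  have hmp := hm j
  have hnp := hn j
  generalize m j = m at *
  generalize n j = n at *
  have hmR : (0:ℝ) < m := by exact_mod_cast hmp
  have hnR : (0:ℝ) < n := by exact_mod_cast hnp
  have hmn : m ≤ n := by
    rw [div_lt_one hnR] at c2
    exact_mod_cast c2.le
  have hmnR : (m:ℝ) ≤ n := by exact_mod_cast hmn
  have hkm : (2 + (k*c-2)/2)*n ≤ k*m := by
    rw [div_lt_div_iff₀ hkR hnR] at c3; linarith
  have hmn2 : |((m*k:ℕ):ℝ) - k*c * n| ≤ δ2 * n := by
    have : ((m*k:ℕ):ℝ) - k*c*n = ((m:ℝ)/n - c) * (k * n) := by push_cast; field_simp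
    rw [this, abs_mul, abs_of_pos (by positivity : (0:ℝ) < k * n)]
    calc _ ≤ δ2/k * (k*n) := by gcongr; exact c1.trans (min_le_right _ _)
      _ = _ := by field_simp
  obtain ⟨hTp, -⟩ := hT m n h2 hmn2
  have hTR : (0:ℝ) < (rowSys (Fin m) k n ∅).card := by exact_mod_cast hTp
  refine le_trans ?_ (satProb_ge k m n hTp)
  have A := hsmall m n hmn h0 hmp hkm
  have B := sum_large_bound m (((Finset.univ : Finset (Finset (Fin m))).erase ∅).filter (fun R => ¬ (R.card:ℝ) ≤ ε*m))
    (fun R => ((critSys k m n R).card:ℝ)) (Real.exp (-η * n) * ((rowSys (Fin m) k n ∅).card : ℝ)) (by positivity) (by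
      intro R hR
      rw [Finset.mem_filter] at hR
      apply hlarge m n h1 (c1.trans (min_le_left _ _)) R
      constructor
      · rw [le_div_iff₀ hmR]; linarith [hR.2]
      · rw [div_le_one hmR]; exact_mod_cast (by simpa using R.card_le_univ : R.card ≤ m))
  have C := Finset.sum_filter_add_sum_filter_not ((Finset.univ : Finset (Finset (Fin m))).erase ∅) (fun R => (R.card:ℝ) ≤ ε*m) (fun R => ((critSys k m n R).card:ℝ))
  have D : ((m:ℝ)+1) * Real.exp (-η*n) ≤ 1 / (m:ℝ)^(k-2) := by
    rw [le_div_iff₀ (by positivity)]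
    have d1 : ((m:ℝ)+1) * (m:ℝ)^(k-2) ≤ Real.exp (η * n) := by
      calc ((m:ℝ)+1) * (m:ℝ)^(k-2) ≤ ((n:ℝ)+1) * ((n:ℝ)+1)^(k-2) := by gcongr; linarith
        _ = ((n:ℝ)+1)^(k-1) := by rw [← pow_succ']; congr 1; omega
        _ ≤ ((n:ℝ)+1)^k := by apply pow_le_pow_right₀ (by linarith); omega
        _ = Real.exp (k * Real.log (n+1)) := by rw [Real.exp_nat_mul, Real.exp_log (by positivity)]
        _ ≤ _ := by
          apply Real.exp_le_exp.mpr
          rw [Nat.cast_one, mul_one] at e1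
          calc _ ≤ k * (η/k*n) := by gcongr
            _ = _ := by field_simp
    calc _ = (((m:ℝ)+1) * (m:ℝ)^(k-2)) * Real.exp (-η*n) := by ring
      _ ≤ Real.exp (η * n) * Real.exp (-η*n) := by gcongr
      _ = 1 := by rw [← Real.exp_add]; simp
  have E : (∑ R ∈ (Finset.univ : Finset (Finset (Fin m))).erase ∅, ((critSys k m n R).card : ℝ)) ≤ (K+1)/(m:ℝ)^(k-2) * ((rowSys (Fin m) k n ∅).card : ℝ) := by
    rw [← C]
    have D' := mul_le_mul_of_nonneg_right D hTR.le
    calc _ ≤ _ := add_le_add A B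
      _ ≤ K/(m:ℝ)^(k-2) * ((rowSys (Fin m) k n ∅).card : ℝ) + 1 / (m:ℝ)^(k-2) * ((rowSys (Fin m) k n ∅).card : ℝ) := by
        apply add_le_add le_rfl
        refine le_trans (le_of_eq ?_) D'
        ring
      _ = _ := by ring
  have F := (div_le_iff₀ hTR).mpr E
  linarith


lemma nonneg_of_hasDeriv {f f' : ℝ → ℝ} (hf : ∀ x, 0 ≤ x → HasDerivAt f (f' x) x) (h0 : 0 ≤ f 0) (h : ∀ x, 0 ≤ x → 0 ≤ f' x) :
    ∀ x, 0 ≤ x → 0 ≤ f x := by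
  intro x hx
  have hm : MonotoneOn f (Set.Ici 0) := by
    apply monotoneOn_of_deriv_nonneg (convex_Ici 0)
    · intro y hy; exact (hf y hy).continuousAt.continuousWithinAt
    · intro y hy; rw [interior_Ici] at hy; exact (hf y (le_of_lt hy)).differentiableAt.differentiableWithinAt
    · intro y hy; rw [interior_Ici] at hy; rw [(hf y (le_of_lt hy)).deriv]; exact h y (le_of_lt hy)
  exact h0.trans (hm (Set.mem_Ici.mpr le_rfl) hx hx)

lemma K_nonneg : ∀ z : ℝ, 0 ≤ z → 0 ≤ 2*(z * Real.sinh z) - 8 * Real.cosh z + 2*z^2 + 8 := by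
  have hs := Real.hasDerivAt_sinh
  have hc := Real.hasDerivAt_cosh
  have hq : ∀ z : ℝ, HasDerivAt (fun z => z^2) (2*z) z := fun z => by simpa using hasDerivAt_pow 2 z
  have hid := fun z : ℝ => hasDerivAt_id' z
  have k0 : ∀ z : ℝ, 0 ≤ z → 0 ≤ z * Real.cosh z - Real.sinh z := by
    apply nonneg_of_hasDeriv (f' := fun z => z * Real.sinh z)
    · intro z _
      exact (((hid z).mul (hc z)).sub (hs z)).congr_deriv (by ring)
    · simp
    · intro z hz; exact mul_nonneg hz (Real.sinh_nonneg_iff.mpr hz)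
  have k1 : ∀ z : ℝ, 0 ≤ z → 0 ≤ 2*(z * Real.sinh z) - 4 * Real.cosh z + 4 := by
    apply nonneg_of_hasDeriv (f' := fun z => 2*(z * Real.cosh z - Real.sinh z))
    · intro z _
      exact (((((hid z).mul (hs z)).const_mul 2).sub ((hc z).const_mul 4)).add_const 4).congr_deriv (by ring)
    · simp
    · intro z hz; have := k0 z hz; linarith
  have k2 : ∀ z : ℝ, 0 ≤ z → 0 ≤ 2*(z * Real.cosh z) - 6 * Real.sinh z + 4*z := by
    apply nonneg_of_hasDeriv (f' := fun z => 2*(z * Real.sinh z) - 4 * Real.cosh z + 4)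
    · intro z _
      exact (((((hid z).mul (hc z)).const_mul 2).sub ((hs z).const_mul 6)).add ((hid z).const_mul 4)).congr_deriv (by ring)
    · simp
    · exact k1
  apply nonneg_of_hasDeriv (f' := fun z => 2*(z * Real.cosh z) - 6 * Real.sinh z + 4*z)
  · intro z _
    exact ((((((hid z).mul (hs z)).const_mul 2).sub ((hc z).const_mul 8)).add ((hq z).const_mul 2)).add_const 8).congr_deriv (by ring)
  · simp
  · exact k2

lemma K_ineq {z : ℝ} (hz : 0 < z) : 
    4 * phi z * (Real.exp z - 1) + 2 * z * phi z * Real.exp z ≤ 3 * z * (Real.exp z - 1)^2 := by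
  have h := K_nonneg z hz.le
  rw [Real.sinh_eq, Real.cosh_eq] at h
  have he := Real.exp_pos z
  have h1 : Real.exp z * Real.exp (-z) = 1 := by rw [← Real.exp_add]; simp
  have h2 := mul_nonneg he.le h
  unfold phi
  have e : Real.exp z * (2 * (z * ((Real.exp z - Real.exp (-z)) / 2)) - 8 * ((Real.exp z + Real.exp (-z)) / 2) + 2 * z ^ 2 + 8)
     = z * (Real.exp z)^2 - z * (Real.exp z * Real.exp (-z)) - 4 * (Real.exp z)^2 - 4 * (Real.exp z * Real.exp (-z)) + 2*z^2*Real.exp z + 8 * Real.exp z := by ring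
  rw [e, h1] at h2
  nlinarith

/-- auxiliary -/
noncomputable def qfun (z : ℝ) : ℝ := 1/z - 2 * phi z / (z^2 * (Real.exp z - 1))

lemma qfun_hasDeriv {z : ℝ} (hz : 0 < z) : HasDerivAt qfun 
    ((4 * phi z * (Real.exp z - 1) + 2 * z * phi z * Real.exp z - 3 * z * (Real.exp z - 1)^2)/(z^3 * (Real.exp z - 1)^2)) z := by
  have he : 0 < Real.exp z - 1 := by linarith [Real.add_one_lt_exp hz.ne']
  have hq : HasDerivAt (fun z : ℝ => z^2) (2*z) z := by simpa using hasDerivAt_pow 2 z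
  have h1 := (hasDerivAt_const z (1:ℝ)).div (hasDerivAt_id' z) hz.ne'
  have h2 := ((phi_hasDeriv z).const_mul 2).div (hq.mul ((Real.hasDerivAt_exp z).sub_const 1)) (show z^2 * (Real.exp z - 1) ≠ 0 by positivity)
  refine (h1.sub h2).congr_deriv ?_
  simp only [Pi.mul_apply]
  field_simp
  ring

lemma qfun_anti : AntitoneOn qfun (Set.Ioi 0) := by
  apply antitoneOn_of_deriv_nonpos (convex_Ioi 0)
  · intro y hy; exact (qfun_hasDeriv hy).continuousAt.continuousWithinAt
  · intro y hy; rw [interior_Ioi] at hy; exact (qfun_hasDeriv hy).differentiableAt.differentiableWithinAt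
  · intro y hy
    rw [interior_Ioi] at hy
    have hy0 : 0 < y := hy
    rw [(qfun_hasDeriv hy).deriv]
    have he : 0 < Real.exp y - 1 := by linarith [Real.add_one_lt_exp hy0.ne']
    apply div_nonpos_of_nonpos_of_nonneg
    · linarith [K_ineq hy0]
    · positivity

lemma qfun_eq {z : ℝ} (hz : 0 < z) : qfun z = (1 - 2 / Dfun z) / z := by
  have hp := phi_pos hz.ne'
  have he : 0 < Real.exp z - 1 := by linarith [Real.add_one_lt_exp hz.ne']
  unfold qfun Dfun
  field_simp

lemma rho_bound {l z a : ℝ} (hz : 0 < z) (hzl : z ≤ l) (ha : 0 ≤ a) (hD : Dfun l = 2 + 2*a) :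
    phi z * (l + a*(l-z))^2 ≤ phi l * z^2 := by
  have hl : 0 < l := lt_of_lt_of_le hz hzl
  have hder : ∀ x, 0 < x → x ≤ l → HasDerivAt (fun x => Real.log (phi x) + 2 * Real.log (l + a*(l-x)) - 2 * Real.log x)
      ((Real.exp x - 1)/phi x + 2 * (-a/(l + a*(l-x))) - 2 * (1/x)) x := by
    intro x hx hxl
    have hW : 0 < l + a*(l-x) := by have := mul_nonneg ha (sub_nonneg.mpr hxl); linarith
    have h1 := (phi_hasDeriv x).log (phi_pos hx.ne').ne'
    have h2 : HasDerivAt (fun x => l + a*(l-x)) (-a) x := by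
      have := (((hasDerivAt_id' x).const_sub l).const_mul a).const_add l
      exact this.congr_deriv (by ring)
    have h3 := h2.log hW.ne'
    have h4 : HasDerivAt (fun x : ℝ => Real.log x) (1/x) x := by simpa using Real.hasDerivAt_log hx.ne'
    exact (h1.add (h3.const_mul 2)).sub (h4.const_mul 2)
  have hmono : MonotoneOn (fun x => Real.log (phi x) + 2 * Real.log (l + a*(l-x)) - 2 * Real.log x) (Set.Icc z l) := by
    apply monotoneOn_of_deriv_nonneg (convex_Icc z l)
    · intro y hy; exact (hder y (lt_of_lt_of_le hz hy.1) hy.2).continuousAt.continuousWithinAt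
    · intro y hy; rw [interior_Icc] at hy; exact (hder y (hz.trans hy.1) hy.2.le).differentiableAt.differentiableWithinAt
    · intro x hy; rw [interior_Icc] at hy
      have hx : 0 < x := hz.trans hy.1
      have hxl := hy.2.le
      rw [(hder x hx hxl).deriv]
      have hp := phi_pos hx.ne'
      have hW : 0 < l + a*(l-x) := by have := mul_nonneg ha (sub_nonneg.mpr hxl); linarith
      have he : 0 < Real.exp x - 1 := by linarith [Real.add_one_lt_exp hx.ne']
      have hDx : 0 < Dfun x := by unfold Dfun; positivity
      have hq := qfun_anti hx hl hxl
      rw [qfun_eq hx, qfun_eq hl, hD, div_le_div_iff₀ hl hx] at hq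
      have h5 : 2 * l * (1+a) ≤ Dfun x * (l + a*(l-x)) := by
        have e1 : (1 - 2/(2+2*a)) = a/(1+a) := by field_simp; ring
        rw [e1] at hq
        have h6 : a / (1+a) * x * (Dfun x * (1+a)) ≤ (1 - 2/Dfun x) * l * (Dfun x * (1+a)) := 
          mul_le_mul_of_nonneg_right hq (by positivity)
        have e2 : a / (1+a) * x * (Dfun x * (1+a)) = a * x * Dfun x := by field_simp
        have e3 : (1 - 2/Dfun x) * l * (Dfun x * (1+a)) = (Dfun x - 2) * l * (1+a) := by field_simp
        rw [e2, e3] at h6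
        linarith
      have e4 : (Real.exp x - 1)/phi x + 2 * (-a/(l + a*(l-x))) - 2 * (1/x) = (Dfun x * (l + a*(l-x)) - 2 * l * (1+a)) / (x * (l + a*(l-x))) := by
        unfold Dfun
        field_simp
        ring
      rw [e4]
      apply div_nonneg (by linarith) (by positivity)
  have h := hmono ⟨le_rfl, hzl⟩ ⟨hzl, le_rfl⟩ hzl
  simp only [sub_self, mul_zero, add_zero] at h
  have hW : 0 < l + a*(l-z) := by have := mul_nonneg ha (sub_nonneg.mpr hzl); linarith
  have hp := phi_pos hz.ne'
  have hpl := phi_pos hl.ne'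
  rw [← Real.log_le_log_iff (by positivity) (by positivity), Real.log_mul (by positivity) (by positivity), Real.log_mul (by positivity) (by positivity), Real.log_pow, Real.log_pow]
  push_cast
  linarith


lemma nonneg_of_hasDeriv_lt {f f' : ℝ → ℝ} (hf : ∀ x, 0 ≤ x → x < 1 → HasDerivAt f (f' x) x) (h0 : 0 ≤ f 0) (h : ∀ x, 0 ≤ x → x < 1 → 0 ≤ f' x) :
    ∀ x, 0 ≤ x → x < 1 → 0 ≤ f x := by
  intro x hx hx1
  have hm : MonotoneOn f (Set.Ico 0 1) := by
    apply monotoneOn_of_deriv_nonneg (convex_Ico 0 1)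
    · intro y hy; exact (hf y hy.1 hy.2).continuousAt.continuousWithinAt
    · intro y hy; rw [interior_Ico] at hy; exact (hf y hy.1.le hy.2).differentiableAt.differentiableWithinAt
    · intro y hy; rw [interior_Ico] at hy; rw [(hf y hy.1.le hy.2).deriv]; exact h y hy.1.le hy.2
  exact h0.trans (hm ⟨le_rfl, one_pos⟩ ⟨hx, hx1⟩ hx)

lemma log_pade : ∀ w : ℝ, 0 ≤ w → Real.log (1+w) ≤ w*(6+w)/(6+4*w) := by
  intro w hw
  have := nonneg_of_hasDeriv (f := fun w => w*(6+w)/(6+4*w) - Real.log (1+w)) (f' := fun w => 4*w^3/((6+4*w)^2*(1+w))) ?_ (by simp) ?_ w hw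
  · linarith
  · intro x hx
    have h1 : HasDerivAt (fun w : ℝ => w*(6+w)) (1*(6+x)+x*1) x := (hasDerivAt_id' x).mul ((hasDerivAt_id' x).const_add 6)
    have h2 : HasDerivAt (fun w : ℝ => 6+4*w) (4*1) x := ((hasDerivAt_id' x).const_mul 4).const_add 6
    have h3 : HasDerivAt (fun w : ℝ => 1+w) 1 x := (hasDerivAt_id' x).const_add 1
    have p1 : (6+4*x) ≠ 0 := by positivity
    have p2 : 1+x ≠ 0 := by positivity
    refine ((h1.div h2 p1).sub (h3.log p2)).congr_deriv ?_
    field_simp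
    ring
  · intro x hx; positivity

lemma chi_nonneg : ∀ b : ℝ, 0 ≤ b → b < 1 → 0 ≤ Real.log (1+b) - Real.log (1-b) - 2*b - 2/3*b^3 - 2/5*b^5 := by
  apply nonneg_of_hasDeriv_lt (f' := fun b => 2*b^6/(1-b^2))
  · intro x hx hx1
    have h3 : HasDerivAt (fun w : ℝ => 1+w) 1 x := (hasDerivAt_id' x).const_add 1
    have h4 : HasDerivAt (fun w : ℝ => 1-w) (-1) x := (hasDerivAt_id' x).const_sub 1
    have p2 : 1+x ≠ 0 := by positivity
    have p3 : 1-x ≠ 0 := by linarith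
    have p4 : 1-x^2 ≠ 0 := by
      rw [show 1-x^2 = (1-x)*(1+x) by ring]; exact mul_ne_zero p3 p2
    have := ((((h3.log p2).sub (h4.log p3)).sub ((hasDerivAt_id' x).const_mul 2)).sub ((hasDerivAt_pow 3 x).const_mul (2/3))).sub ((hasDerivAt_pow 5 x).const_mul (2/5))
    refine this.congr_deriv ?_
    field_simp
    norm_num
    ring
  · simp
  · intro x hx hx1
    apply div_nonneg (by positivity)
    nlinarith

lemma psi_nonneg : ∀ b : ℝ, 0 ≤ b → b < 1 → 0 ≤ (1+b)*Real.log (1+b) + (1-b)*Real.log (1-b) - b^2 - 1/6*b^4 - 1/15*b^6 := by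
  apply nonneg_of_hasDeriv_lt (f' := fun b => Real.log (1+b) - Real.log (1-b) - 2*b - 2/3*b^3 - 2/5*b^5)
  · intro x hx hx1
    have h3 : HasDerivAt (fun w : ℝ => 1+w) 1 x := (hasDerivAt_id' x).const_add 1
    have h4 : HasDerivAt (fun w : ℝ => 1-w) (-1) x := (hasDerivAt_id' x).const_sub 1
    have p2 : 1+x ≠ 0 := by positivity
    have p3 : 1-x ≠ 0 := by linarith
    have := ((((h3.mul (h3.log p2)).add (h4.mul (h4.log p3))).sub (hasDerivAt_pow 2 x)).sub ((hasDerivAt_pow 4 x).const_mul (1/6))).sub ((hasDerivAt_pow 6 x).const_mul (1/15))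
    refine this.congr_deriv ?_
    field_simp
    norm_num
    ring
  · simp
  · exact chi_nonneg

lemma entropy_upper (α : ℝ) (h0 : 0 < α) (h1 : α ≤ 1/2) :
    Real.binEntropy α ≤ Real.log 2 - (1-2*α)^2/2 - (1-2*α)^4/12 - (1-2*α)^6/30 := by
  have h := psi_nonneg (1-2*α) (by linarith) (by linarith)
  rw [show 1 + (1-2*α) = 2*(1-α) by ring, show 1 - (1-2*α) = 2*α by ring, Real.log_mul (by norm_num) (by linarith), Real.log_mul (by norm_num) (by linarith)] at h
  rw [Real.binEntropy_eq_negMulLog_add_negMulLog_one_sub]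
  unfold Real.negMulLog
  linarith

lemma log2_bounds : 0.6931 < Real.log 2 ∧ Real.log 2 < 0.6932 := by
  have := Real.log_two_gt_d9
  have := Real.log_two_lt_d9
  constructor <;> linarith

lemma I0 (α : ℝ) (h0 : 0.12 ≤ α) (h1 : α ≤ 1/2) :
    Real.log (1 + (1-2*α)^2) + 1/2 * Real.binEntropy α < Real.log 2 := by
  have h := entropy_upper α (by linarith) h1
  obtain ⟨v, hv⟩ : ∃ v, v = (1-2*α)^2 := ⟨_, rfl⟩
  rw [← hv] at h ⊢
  have hv0 : 0 ≤ v := by rw [hv]; positivity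
  have hv1 : v ≤ 0.5776 := by rw [hv]; nlinarith
  have p4 : 0 ≤ (1-2*α)^4 := by positivity
  have p6 : 0 ≤ (1-2*α)^6 := by positivity
  have e : Real.log (1+v) = Real.log 1.5 + Real.log ((1+v)/1.5) := by
    rw [← Real.log_mul (by norm_num) (by positivity)]; congr 1; field_simp
  have h2 := Real.log_le_sub_one_of_pos (show 0 < (1+v)/1.5 by positivity)
  have h3 := log_pade 0.5 (by norm_num)
  norm_num at h3 h2 e
  have := log2_bounds
  linarith [this.1]

lemma I1 (α : ℝ) (h0 : 0.12 ≤ α) (h1 : α ≤ 1/2) :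
    Real.log (1 + ((1-2*α)/(1+2*α))^2) + Real.binEntropy α ≤ Real.log 2 := by
  have h := entropy_upper α (by linarith) h1
  obtain ⟨b, hb⟩ : ∃ b, b = 1-2*α := ⟨_, rfl⟩
  rw [show 1+2*α = 2-b by rw [hb]; ring]
  rw [← hb] at h ⊢
  have hb0 : 0 ≤ b := by linarith
  have hb1 : 0 ≤ 0.76 - b := by linarith
  have h2 := log_pade ((b/(2-b))^2) (by positivity)
  have p2 : 0 < 2-b := by linarith
  have key : (b/(2-b))^2*(6+(b/(2-b))^2)/(6+4*(b/(2-b))^2) ≤ b^2/2 + b^4/12+b^6/30 := by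
    have e : (b/(2-b))^2*(6+(b/(2-b))^2)/(6+4*(b/(2-b))^2) = b^2 * ((24-24*b+7*b^2)/((4-4*b+b^2)*(24-24*b+10*b^2))) := by
      have q1 : (4-4*b+b^2) = (2-b)^2 := by ring
      have q2 : (24-24*b+10*b^2) = 6*(2-b)^2+4*b^2 := by ring
      rw [q1, q2]
      field_simp
      ring
    rw [e, show b^2/2 + b^4/12+b^6/30 = b^2 * (1/2+b^2/12+b^4/30) by ring]
    apply mul_le_mul_of_nonneg_left _ (by positivity)
    have q1 : 0 < (4-4*b+b^2) := by nlinarith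
    have q2 : 0 < (24-24*b+10*b^2) := by nlinarith
    rw [div_le_iff₀ (by positivity)]
    have T : ∀ i j : ℕ, 0 ≤ b^i * (0.76-b)^j := fun i j => by positivity
    have t0 := T 0 8
    have t1 := T 1 7
    have t2 := T 2 6
    have t3 := T 3 5
    have t4 := T 4 4
    have t5 := T 5 3
    have t6 := T 6 2
    have t7 := T 7 1
    have t8 := T 8 0
    linarith
  linarith


/-- Exponent with `d = k c`. -/
noncomputable def Ph (d c l s t α : ℝ) : ℝ :=
  -(d-c) * Real.binEntropy α - d * (α * Real.log s + (1-α) * Real.log t) + Real.log (Fgen (l*s) (l*t) / phi l)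

lemma PhiE_eq (k : ℕ) (l s t c α : ℝ) : PhiE k l s t c α = Ph (k*c) c l s t α := by
  unfold PhiE Ph; ring

lemma Fgen_eq (x y : ℝ) : Fgen x y = (phi (y+x) + phi (y-x))/2 := by
  unfold Fgen phi
  rw [Real.cosh_eq, sub_eq_add_neg y x, Real.exp_add, Real.exp_add]; ring

lemma P0_val (d c l α : ℝ) (hl : 0 < l) :
    Ph d c l α (1-α) α = c * Real.binEntropy α + Real.log ((1 + phi (l*(1-2*α))/phi l)/2) := by
  have hp := phi_pos hl.ne'
  unfold Ph
  rw [Fgen_eq, show l*(1-α)+l*α = l by ring, show l*(1-α)-l*α = l*(1-2*α) by ring,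
    show (phi l + phi (l*(1-2*α)))/2/phi l = (1 + phi (l*(1-2*α))/phi l)/2 by field_simp]
  rw [Real.binEntropy_eq_negMulLog_add_negMulLog_one_sub]
  unfold Real.negMulLog
  ring

lemma rho_le (l α a : ℝ) (hl : 0 < l) (h0 : 0 < α) (h1 : α ≤ 1/2) (ha : 0 ≤ a) (hD : Dfun l = 2 + 2*a) :
    phi (l*(1-2*α))/phi l ≤ ((1-2*α)/(1+2*a*α))^2 := by
  have hp := phi_pos hl.ne'
  rcases h1.lt_or_eq with h | h
  · have h2 : 0 < 1-2*α := by linarith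
    have := rho_bound (l := l) (z := l*(1-2*α)) (a := a) (by positivity) (by nlinarith) ha hD
    rw [div_pow, div_le_div_iff₀ hp (by positivity)]
    have e : phi (l*(1-2*α)) * (l + a*(l-l*(1-2*α)))^2 = l^2 * (phi (l*(1-2*α)) * (1+2*a*α)^2) := by ring
    have e2 : phi l * (l*(1-2*α))^2 = l^2 * ((1-2*α)^2 * phi l) := by ring
    rw [e, e2] at this
    exact le_of_mul_le_mul_left this (by positivity)
  · rw [h]; norm_num; unfold phi; simp

lemma P0_neg (d c l α r : ℝ) (hl : 0 < l) (h0 : 0 < α) (h1 : α ≤ 1/2)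
    (hr : phi (l*(1-2*α))/phi l ≤ r) (h : c * Real.binEntropy α + Real.log (1+r) < Real.log 2) :
    Ph d c l α (1-α) α < 0 := by
  rw [P0_val d c l α hl]
  have hp := phi_pos hl.ne'
  have hpn : 0 ≤ phi (l*(1-2*α)) := by
    have := Real.add_one_le_exp (l*(1-2*α))
    unfold phi; linarith
  have hq : 0 ≤ phi (l*(1-2*α))/phi l := by positivity
  have : Real.log ((1 + phi (l*(1-2*α))/phi l)/2) ≤ Real.log (1+r) - Real.log 2 := by
    rw [← Real.log_div (by linarith) (by norm_num)]
    apply Real.log_le_log (by positivity)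
    linarith
  linarith

lemma fa_convex (b α : ℝ) (hα : 0 < α) : 
    ConvexOn ℝ (Set.Ici 0) (fun a => Real.log ((1+2*a*α)^2 + b^2) - 2 * Real.log (1+2*a*α)) := by
  have hder : ∀ a, 0 ≤ a → HasDerivAt (fun a => Real.log ((1+2*a*α)^2 + b^2) - 2 * Real.log (1+2*a*α))
      (-(4*α*b^2)/((1+2*a*α)*((1+2*a*α)^2+b^2))) a := by
    intro a ha
    have hX : 0 < 1+2*a*α := by positivity
    have h1 : HasDerivAt (fun a => 1+2*a*α) (2*1*α) a := (((hasDerivAt_id' a).const_mul 2).mul_const α).const_add 1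
    have h2 := ((h1.pow 2).add_const (b^2)).log (show (1+2*a*α)^2+b^2 ≠ 0 by positivity)
    refine (h2.sub ((h1.log hX.ne').const_mul 2)).congr_deriv ?_
    simp only [Pi.pow_apply]
    field_simp
    norm_num
    ring
  apply MonotoneOn.convexOn_of_deriv (convex_Ici 0)
  · intro a ha; exact (hder a ha).continuousAt.continuousWithinAt
  · intro a ha; rw [interior_Ici] at ha; exact (hder a (le_of_lt ha)).differentiableAt.differentiableWithinAt
  · intro x hx y hy hxy
    rw [interior_Ici] at hx hy
    have hx0 : 0 < x := hx
    have hy0 : 0 < y := hy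
    rw [(hder x hx0.le).deriv, (hder y hy0.le).deriv, neg_div, neg_div, neg_le_neg_iff]
    gcongr

lemma P0_main (d c α a : ℝ) (h0 : 0.12 ≤ α) (h1 : α ≤ 1/2) (ha : 0 ≤ a) (hd : d = 2+2*a) (hc1 : c < 1) (hcd : 4*c ≤ d) :
    c * Real.binEntropy α + Real.log (1+((1-2*α)/(1+2*a*α))^2) < Real.log 2 := by
  have hα : 0 < α := by linarith
  have hh := Real.binEntropy_pos hα (by linarith)
  have hI1 := I1 α h0 h1
  have hI0 := I0 α h0 h1
  rcases le_or_gt 1 a with h | h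
  · have hb : ((1-2*α)/(1+2*a*α))^2 ≤ ((1-2*α)/(1+2*α))^2 := by
      have : 0 ≤ 1-2*α := by linarith
      gcongr
      nlinarith
    have h2 := Real.log_le_log (show 0 < 1+((1-2*α)/(1+2*a*α))^2 by positivity) (show _ ≤ 1+((1-2*α)/(1+2*α))^2 by linarith)
    nlinarith
  · have hconv := (fa_convex (1-2*α) α hα).2 (show (0:ℝ) ∈ Set.Ici 0 by simp) (show (1:ℝ) ∈ Set.Ici 0 by simp) (show 0 ≤ 1-a by linarith) ha (by ring)
    have e : ∀ x : ℝ, 0 ≤ x → Real.log (1+((1-2*α)/(1+2*x*α))^2) = Real.log ((1+2*x*α)^2 + (1-2*α)^2) - 2 * Real.log (1+2*x*α) := by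
      intro x hx
      have hX : 0 < 1+2*x*α := by positivity
      rw [show 1+((1-2*α)/(1+2*x*α))^2 = ((1+2*x*α)^2 + (1-2*α)^2)/(1+2*x*α)^2 by field_simp, Real.log_div (by positivity) (by positivity), Real.log_pow]
      norm_num
    simp only [smul_eq_mul, mul_zero, zero_add, mul_one] at hconv
    have e0 := e 0 le_rfl
    have e1 := e 1 zero_le_one
    have ea := e a ha
    simp only [mul_zero, mul_one, zero_mul, add_zero, div_one] at e0 e1 hconv
    rw [← e0, ← e1, ← ea] at hconv
    have h2 : c * Real.binEntropy α ≤ (1+a)/2 * Real.binEntropy α := by gcongr; linarith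
    have h3 := mul_lt_mul_of_pos_left hI0 (show 0 < 1-a by linarith)
    have h4 := mul_le_mul_of_nonneg_left hI1 ha
    linarith

lemma num_logs : Real.log 10 < 2.31 ∧ Real.log (10/9) < 0.1055 ∧ Real.log 5 < 1.612 ∧ 0.5 ≤ Real.log (5/3) := by
  obtain ⟨a, b⟩ := log2_bounds
  have e1 := log_pade 0.25 (by norm_num)
  have e2 := log_pade (1/9) (by norm_num)
  have e3 := Real.le_log_one_add_of_nonneg (show (0:ℝ) ≤ 2/3 by norm_num)
  have f1 : Real.log 10 = 3 * Real.log 2 + Real.log (1+0.25) := by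
    rw [show (10:ℝ) = 2^3 * (1+0.25) by norm_num, Real.log_mul (by norm_num) (by norm_num), Real.log_pow]; norm_num
  have f2 : Real.log 5 = 2 * Real.log 2 + Real.log (1+0.25) := by
    rw [show (5:ℝ) = 2^2 * (1+0.25) by norm_num, Real.log_mul (by norm_num) (by norm_num), Real.log_pow]; norm_num
  norm_num at e1 e2 e3 f1 f2 ⊢
  refine ⟨?_, ?_, ?_, ?_⟩ <;> linarith

lemma P0_big (d c α a : ℝ) (hd : d = 2+2*a) (hd5 : 5 ≤ d) (h0 : 0.6 ≤ α * d) (h1 : α ≤ 0.12) (hα : 0 < α) (hc1 : c < 1) :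
    c * Real.binEntropy α + Real.log (1+((1-2*α)/(1+2*a*α))^2) < Real.log 2 := by
  have hh := Real.binEntropy_pos hα (by linarith)
  have hch : c * Real.binEntropy α < Real.binEntropy α := by nlinarith
  have hmono := Real.binEntropy_strictMonoOn.monotoneOn
  have e : (1+2*a*α) = (1-2*α) + α*d := by rw [hd]; ring
  have hb : 0 < 1-2*α := by linarith
  have hden : 0 < (1-2*α) + α*d := by positivity
  obtain ⟨n1, n2, -, -⟩ := num_logs
  have hl2 := log2_bounds
  rcases le_or_gt α 0.1 with h | h
  · have hr : ((1-2*α)/(1+2*a*α)) ≤ 1/1.6 := by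
      rw [e, div_le_div_iff₀ hden (by norm_num)]; nlinarith
    have hr2 : ((1-2*α)/(1+2*a*α))^2 ≤ (1/1.6)^2 := by
      apply pow_le_pow_left₀ _ hr; rw [e]; positivity
    have hH : Real.binEntropy α ≤ Real.binEntropy 0.1 := hmono ⟨hα.le, by norm_num; linarith⟩ ⟨by norm_num, by norm_num⟩ h
    have hH2 : Real.binEntropy 0.1 < 0.3261 := by
      unfold Real.binEntropy
      norm_num
      linarith
    have hL : Real.log (1+((1-2*α)/(1+2*a*α))^2) ≤ Real.log (1+0.390625) := Real.log_le_log (by positivity) (by norm_num at hr2 ⊢; linarith)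
    have hP := log_pade 0.390625 (by norm_num)
    norm_num at hP hL hH2
    linarith
  · have hr : ((1-2*α)/(1+2*a*α)) ≤ 1/1.75 := by
      rw [e, div_le_div_iff₀ hden (by norm_num)]; nlinarith
    have hr2 : ((1-2*α)/(1+2*a*α))^2 ≤ (1/1.75)^2 := by
      apply pow_le_pow_left₀ _ hr; rw [e]; positivity
    have hH : Real.binEntropy α ≤ Real.binEntropy 0.12 := hmono ⟨hα.le, by norm_num; linarith⟩ ⟨by norm_num, by norm_num⟩ h1
    have hH2 := entropy_upper 0.12 (by norm_num) (by norm_num)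
    have hL : Real.log (1+((1-2*α)/(1+2*a*α))^2) ≤ Real.log (1+16/49) := Real.log_le_log (by positivity) (by norm_num at hr2 ⊢; linarith)
    have hP := log_pade (16/49) (by norm_num)
    norm_num at hP hL hH2
    linarith


lemma cosh_le (x : ℝ) (hx : 0 ≤ x) (hx2 : x^2 ≤ 0.6) : Real.cosh x - 1 ≤ x^2 * (1/2 + x^2/23) := by
  have hx1 : x ≤ 1 := by nlinarith
  have h1 := Real.exp_bound (x := x) (by rw [abs_of_nonneg hx]; exact hx1) (n := 6) (by norm_num)
  have h2 := Real.exp_bound (x := -x) (by rw [abs_neg, abs_of_nonneg hx]; exact hx1) (n := 6) (by norm_num)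
  rw [abs_neg] at h2
  rw [abs_of_nonneg hx] at h1 h2
  have g1 := (abs_le.mp h1).2
  have g2 := (abs_le.mp h2).2
  rw [Real.cosh_eq]
  simp only [Finset.sum_range_succ, Finset.sum_range_zero, Nat.factorial] at g1 g2
  norm_num at g1 g2
  have h6 : x^6 ≤ 0.6 * x^4 := by
    have : 0 ≤ x^4 := by positivity
    nlinarith
  have h4 : 0 ≤ x^4 := by positivity
  have e2 : (-x)^2 = x^2 := by ring
  have e3 : (-x)^3 = -x^3 := by ring
  have e4 : (-x)^4 = x^4 := by ring
  have e5 : (-x)^5 = -x^5 := by ring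
  nlinarith

lemma P1_le (d c l α : ℝ) (hl : 0 < l) (hD : Dfun l = d) (hα : 0 < α) (hα1 : α ≤ 0.12) (hαd : α * d ≤ 0.6) (hcd : c ≤ d) :
    ∃ s, 0 < s ∧ s ≤ 1 ∧ Ph d c l s 1 α ≤ α * (-(d/2-c) * (-Real.log α) + d/2 * Real.log d + d * (1/2 + α*d/23) - (d-c) * 0.936) := by
  have hp := phi_pos hl.ne'
  obtain ⟨B, hB⟩ : ∃ B, B = 1 - Real.exp (-l) := ⟨_, rfl⟩
  have hB0 : 0 < B := by
    rw [hB]; have : Real.exp (-l) < 1 := by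
      have := Real.exp_lt_exp.mpr (show -l < 0 by linarith)
      rwa [Real.exp_zero] at this
    linarith
  have hB1 : B < 1 := by rw [hB]; linarith [Real.exp_pos (-l)]
  have hBl : B ≤ l := by rw [hB]; linarith [Real.add_one_le_exp (-l)]
  have hee : Real.exp l * Real.exp (-l) = 1 := by rw [← Real.exp_add]; simp
  have heB : Real.exp l * B = Real.exp l - 1 := by rw [hB, mul_sub, hee, mul_one]
  have hdphi : d * phi l = l * (Real.exp l - 1) := by
    rw [← hD]; unfold Dfun; field_simp
  have hld : l ≤ d := by
    rw [← hD, Dfun_eq hl]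
    have : 0 ≤ l^2/phi l := by positivity
    linarith
  have hd0 : 0 < d := by linarith
  have hκ : l / B ≤ d := by
    rw [div_le_iff₀ hB0]
    refine le_of_mul_le_mul_right ?_ hp
    have : d * B * phi l = l * (Real.exp l - 1) * B := by rw [mul_right_comm, hdphi]
    rw [this]
    have h2 : phi l ≤ (Real.exp l - 1) * B := by
      have : (Real.exp l - 1) * B = Real.exp l - 1 - B := by rw [sub_mul, heB]; ring
      rw [this]; unfold phi; linarith
    nlinarith
  refine ⟨Real.sqrt (α*B/l), by positivity, ?_, ?_⟩
  · exact Real.sqrt_le_iff.mpr ⟨zero_le_one, by rw [one_pow, div_le_one hl]; nlinarith⟩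
  have hs : 0 < Real.sqrt (α*B/l) := by positivity
  have hs2 : Real.sqrt (α*B/l)^2 = α*B/l := Real.sq_sqrt (by positivity)
  obtain ⟨s, hsd⟩ : ∃ s, s = Real.sqrt (α*B/l) := ⟨_, rfl⟩
  rw [← hsd] at hs hs2 ⊢
  have hlogs : Real.log s = (Real.log α - Real.log (l/B))/2 := by
    have : Real.log (s^2) = Real.log α - Real.log (l/B) := by
      rw [hs2, ← Real.log_div hα.ne' (by positivity)]; congr 1; field_simp
    rw [Real.log_pow] at this
    push_cast at this
    linarith
  have hlogκ : Real.log (l/B) ≤ Real.log d := Real.log_le_log (by positivity) hκ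
  have hx2 : (l*s)^2 = α*l*B := by rw [mul_pow, hs2]; field_simp
  have hx2d : (l*s)^2 ≤ α*d := by
    rw [hx2, mul_assoc]; gcongr; nlinarith
  have hcosh := cosh_le (l*s) (by positivity) (by linarith)
  have hF : Fgen (l*s) (l*1) / phi l ≤ 1 + α*d*(1/2 + α*d/23) := by
    rw [div_le_iff₀ hp]
    have e1 : Fgen (l*s) (l*1) = phi l + (Real.cosh (l*s) - 1) * Real.exp l := by
      unfold Fgen phi; rw [mul_one]; ring
    have e2 : (Real.cosh (l*s) - 1) * Real.exp l ≤ (α*l*B) * (1/2 + α*d/23) * Real.exp l := by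
      apply mul_le_mul_of_nonneg_right _ (Real.exp_pos l).le
      calc _ ≤ _ := hcosh
        _ ≤ (l*s)^2 * (1/2 + α*d/23) := by gcongr
        _ = _ := by rw [hx2]
    have e3 : (α*l*B) * (1/2 + α*d/23) * Real.exp l = α*(1/2 + α*d/23) * (l * (Real.exp l * B)) := by ring
    rw [e3, heB, ← hdphi] at e2
    rw [e1]; linarith
  have hFpos : 0 < Fgen (l*s) (l*1) / phi l := div_pos (Fgen_pos (by positivity) (by positivity)) hp
  have hlogF : Real.log (Fgen (l*s) (l*1) / phi l) ≤ α*d*(1/2 + α*d/23) := by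
    have := Real.log_le_sub_one_of_pos hFpos
    linarith
  have hent : α * (-Real.log α) + 0.936 * α ≤ Real.binEntropy α := by
    rw [Real.binEntropy_eq_negMulLog_add_negMulLog_one_sub]
    unfold Real.negMulLog
    have h1α : 0 < 1-α := by linarith
    have h1 := Real.le_log_one_add_of_nonneg (show 0 ≤ α/(1-α) by positivity)
    have e1 : Real.log (1+α/(1-α)) = - Real.log (1-α) := by
      rw [← Real.log_inv]; congr 1; field_simp; ring
    have h2α : 0 < 2-α := by linarith
    have e2 : 2*(α/(1-α))/(α/(1-α)+2) = 2*α/(2-α) := by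
      rw [div_eq_div_iff (by positivity) (by positivity)]; field_simp; ring
    rw [e1, e2] at h1
    have h2 := mul_le_mul_of_nonneg_left h1 h1α.le
    have h3 : 0.936 * α ≤ (1-α) * (2*α/(2-α)) := by
      rw [← mul_div_assoc, le_div_iff₀ h2α]; nlinarith
    linarith
  unfold Ph
  rw [hlogs, Real.log_one]
  have g1 := mul_le_mul_of_nonneg_left hent (show 0 ≤ d-c by linarith)
  have g2 := mul_le_mul_of_nonneg_left hlogκ (show 0 ≤ d*α/2 by positivity)
  linarith

lemma log_012 (α : ℝ) (hα : 0 < α) (hα1 : α ≤ 0.12) : 2.12 ≤ -Real.log α := by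
  have h1 := Real.log_le_log hα hα1
  have h2 : Real.log 0.12 = -(3 * Real.log 2 + Real.log (1+1/24)) := by
    rw [show (0.12:ℝ) = (2^3 * (1+1/24))⁻¹ by norm_num, Real.log_inv, Real.log_mul (by norm_num) (by norm_num), Real.log_pow]; norm_num
  have h3 := Real.le_log_one_add_of_nonneg (show (0:ℝ) ≤ 1/24 by norm_num)
  have h4 := log2_bounds.1
  norm_num at h2 h3 h1
  linarith

lemma P1_neg (d c α : ℝ) (hd : 2 < d) (hc1 : c < 1) (hcd : 4*c ≤ d) (hα : 0 < α) (hα1 : α ≤ 0.12) (hαd : α * d ≤ 0.6) :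
    -(d/2-c) * (-Real.log α) + d/2 * Real.log d + d * (1/2 + α*d/23) - (d-c) * 0.936 < 0 := by
  have hL := log_012 α hα hα1
  obtain ⟨L, hLd⟩ : ∃ L, L = -Real.log α := ⟨_, rfl⟩
  obtain ⟨a2, b2⟩ := log2_bounds
  rcases le_or_gt d 4 with h4 | h4
  · rw [← hLd] at hL ⊢
    have hlog : Real.log d ≤ 1.3864 := by
      have := Real.log_le_log (by linarith) h4
      rw [show (4:ℝ) = 2^2 by norm_num, Real.log_pow] at this
      push_cast at this; linarith
    have h1 : c * (L + 0.936) ≤ d/4 * (L+0.936) := by gcongr; linarith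
    have h2 : d * (L) ≥ d * 2.12 := by gcongr
    have h3 : d * Real.log d ≤ d * 1.3864 := by gcongr
    have h5 : α * d ≤ 0.48 := by nlinarith
    have h6 : d * (α * d) ≤ d * 0.48 := by gcongr
    linarith
  · have h1 : c * (L + 0.936) ≤ 1 * (L+0.936) := by
      apply mul_le_mul_of_nonneg_right hc1.le; rw [hLd]; linarith
    have h6 : d * (α * d) ≤ d * 0.6 := by gcongr
    rcases le_or_gt d 5 with h5 | h5
    · rw [← hLd] at hL ⊢
      have hlog : Real.log d ≤ 1.3864 + (d-4)/4 := by
        have e : Real.log d = 2 * Real.log 2 + Real.log (d/4) := by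
          rw [show d = 2^2 * (d/4) by ring, Real.log_mul (by norm_num) (by positivity), Real.log_pow]; norm_num
        have := Real.log_le_sub_one_of_pos (show 0 < d/4 by linarith)
        linarith
      have h2 : (d-2) * L ≥ (d-2) * 2.12 := by gcongr
      have h3 : d * Real.log d ≤ d * (1.3864 + (d-4)/4) := by gcongr
      nlinarith
    · obtain ⟨-, -, l5, l53⟩ := num_logs
      have hLL : Real.log d + 0.5 ≤ L := by
        have e : Real.log (d * (5/3)) ≤ Real.log (α⁻¹) := by
          apply Real.log_le_log (by linarith)
          rw [le_inv_comm₀ (by linarith) hα, ← one_div, le_div_iff₀ (by linarith)]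
          linarith
        rw [Real.log_inv, Real.log_mul (by linarith) (by norm_num)] at e
        rw [hLd]; linarith
      rw [← hLd]
      have hlog : Real.log d ≤ 1.612 + (d-5)/5 := by
        have e : Real.log d = Real.log 5 + Real.log (d/5) := by
          rw [← Real.log_mul (by norm_num) (by linarith)]; congr 1; field_simp
        have := Real.log_le_sub_one_of_pos (show 0 < d/5 by linarith)
        linarith
      have h2 : (d-2) * L ≥ (d-2) * (Real.log d + 0.5) := by gcongr
      linarith

lemma V3_half (d c l α : ℝ) (hd : 2 < d) (hc0 : 0 < c) (hc1 : c < 1) (hcd : 4*c ≤ d) (hl : 0 < l) (hD : Dfun l = d) (hα : 0 < α) (hα1 : α ≤ 1/2) :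
    ∃ s t, 0 < s ∧ s ≤ t ∧ Ph d c l s t α < 0 := by
  obtain ⟨a, ha⟩ : ∃ a, d = 2+2*a := ⟨(d-2)/2, by ring⟩
  have ha0 : 0 ≤ a := by linarith
  have hrho := rho_le l α a hl hα hα1 ha0 (by rw [hD, ha])
  rcases le_or_gt 0.12 α with h | h
  · exact ⟨α, 1-α, hα, by linarith, P0_neg d c l α _ hl hα hα1 hrho (P0_main d c α a h hα1 ha0 ha hc1 hcd)⟩
  · rcases le_or_gt (α*d) 0.6 with h6 | h6
    · obtain ⟨s, hs, hs1, hP⟩ := P1_le d c l α hl hD hα h.le h6 (by linarith)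
      refine ⟨s, 1, hs, hs1, hP.trans_lt ?_⟩
      have := P1_neg d c α hd hc1 hcd hα h.le h6
      exact mul_neg_of_pos_of_neg hα this
    · have h5 : 5 ≤ d := by nlinarith
      exact ⟨α, 1-α, hα, by linarith, P0_neg d c l α _ hl hα hα1 hrho (P0_big d c α a ha h5 h6.le h.le hα hc1)⟩

lemma phi_neg_lt {z : ℝ} (hz : 0 ≤ z) : phi (-z) ≤ phi z := by
  have := Real.self_le_sinh_iff.mpr hz
  rw [Real.sinh_eq] at this
  unfold phi; linarith

lemma V3 (d c l α : ℝ) (hd : 2 < d) (hc0 : 0 < c) (hc1 : c < 1) (hcd : 4*c ≤ d) (hl : 0 < l) (hD : Dfun l = d) (hα : 0 < α) (hα1 : α ≤ 1) :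
    ∃ s t, 0 < s ∧ 0 < t ∧ Ph d c l s t α < 0 := by
  have hp := phi_pos hl.ne'
  rcases le_or_gt α (1/2) with h | h
  · obtain ⟨s, t, hs, hst, H⟩ := V3_half d c l α hd hc0 hc1 hcd hl hD hα h
    exact ⟨s, t, hs, hs.trans_le hst, H⟩
  rcases hα1.lt_or_eq with h1 | h1
  · obtain ⟨s, t, hs, hst, H⟩ := V3_half d c l (1-α) hd hc0 hc1 hcd hl hD (by linarith) (by linarith)
    refine ⟨t, s, hs.trans_le hst, hs, lt_of_le_of_lt ?_ H⟩
    unfold Ph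
    rw [Real.binEntropy_one_sub]
    have hF : Fgen (l*t) (l*s) ≤ Fgen (l*s) (l*t) := by
      rw [Fgen_eq, Fgen_eq]
      have := phi_neg_lt (show 0 ≤ l*t - l*s by nlinarith)
      rw [show -(l*t - l*s) = l*s - l*t by ring] at this
      rw [add_comm (l*s) (l*t)]
      linarith
    have hlog : Real.log (Fgen (l*t) (l*s) / phi l) ≤ Real.log (Fgen (l*s) (l*t) / phi l) := by
      have : 0 < Fgen (l*t) (l*s) := Fgen_pos (mul_pos hl (hs.trans_le hst)) (by positivity)
      apply Real.log_le_log (by positivity)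
      gcongr
    linarith
  · subst h1
    have hcont : ContinuousAt (fun t => Fgen (l*1) (l*t) / phi l) 0 := by
      unfold Fgen; fun_prop
    have hlt : Fgen (l*1) (l*0) / phi l < 1 := by
      rw [div_lt_one hp]
      have := Real.self_lt_sinh_iff.mpr hl
      rw [Real.sinh_eq] at this
      unfold Fgen phi
      rw [mul_one, mul_zero, Real.exp_zero, Real.cosh_eq]; linarith
    have hev := hcont.eventually_lt_const hlt
    obtain ⟨r, hr, hball⟩ := Metric.eventually_nhds_iff.mp hev
    have hb := hball (y := r/2) (by rw [Real.dist_eq, sub_zero, abs_of_pos (by linarith)]; linarith)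
    refine ⟨1, r/2, one_pos, by linarith, ?_⟩
    unfold Ph
    have hpos : 0 < Fgen (l*1) (l*(r/2)) / phi l := div_pos (Fgen_pos (by linarith) (by positivity)) hp
    have := Real.log_neg hpos hb
    simp only [Real.binEntropy_one, Real.log_one]
    linarith

theorem constrained_kxorsat_threshold
    (k : ℕ) (hk : 4 ≤ k) (m n : ℕ → ℕ)
    (hm : ∀ j, 0 < m j) (hn : ∀ j, 0 < n j)
    (hmtop : Filter.Tendsto m Filter.atTop Filter.atTop)
    (hntop : Filter.Tendsto n Filter.atTop Filter.atTop)
    (c : ℝ)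
    (hc : Filter.Tendsto (fun j => (m j : ℝ) / (n j : ℝ)) Filter.atTop (nhds c)) :
    ((2 / k < c ∧ c < 1) →
      ∃ K : ℝ, ∀ᶠ j in Filter.atTop,
        1 - K / (m j : ℝ) ^ (k - 2) ≤ satProb k (m j) (n j)) ∧
    (1 < c →
      (∀ j, satProb k (m j) (n j) ≤ (2 : ℝ) ^ ((n j : ℤ) - (m j : ℤ))) ∧
      Filter.Tendsto (fun j => satProb k (m j) (n j)) Filter.atTop (nhds 0)) := by
  refine ⟨?_, fun h1 => ⟨fun j => satProb_le k (m j) (n j), supercritical k m n hn hntop c hc h1⟩⟩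
  rintro ⟨h2, h1⟩
  have hk4 : (4:ℝ) ≤ k := by exact_mod_cast hk
  have hkR : (0:ℝ) < k := by linarith
  have hc0 : 0 < c := lt_trans (by positivity) h2
  have hc2 : 2 < k*c := by
    rw [div_lt_iff₀ hkR] at h2
    linarith
  have hcd : 4*c ≤ k*c := by nlinarith
  obtain ⟨l, hl, hD⟩ := exists_lambda (k*c) hc2
  refine subcritical k hk m n hm hn hntop c hc hc2 h1 l hl hD ?_
  intro α h0 hα1
  obtain ⟨s, t, hs, ht, H⟩ := V3 (k*c) c l α hc2 hc0 h1 hcd hl hD h0 hα1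
  exact ⟨s, t, hs, ht, by rw [PhiE_eq]; exact H⟩
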